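/- Suppose M is spherically symmetric about p and nonpositively curved. Then there exists a with 0 < a < π such that for every θ ∈ S_pM, the boundary point (f_1(θ),θ) ∈ ∂Ω_1 is visible_1 exactly when ∠(θ,u_0) ≤ a. Moreover a ≤ π − arccos(1/λ); in particular a is bounded away from π in terms of λ alone. -/

import Mathlib

/-!
Formalization framework for "growth competitions" (after the paper's
Section 2), at the metric-space level.

Since Mathlib does not yet have Riemannian metrics, a complete Riemannian
manifold is represented by a proper (hence complete; Hopf-Rinow) metric
space whose distance is the induced length (intrinsic) metric, and
spherical symmetry about `p` with warping function `G` is expressed through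
global geodesic polar normal coordinates `Φ : ℝⁿ ≃ M` with `Φ 0 = p` and
`dist (Φ x) p = ‖x‖`, in which the Riemannian distance is the infimum of
lengths of Lipschitz curves measured in the warped metric
`g = dr² + G(r)² dθ²`.
-/

open Set Metric Filter MeasureTheory InnerProductGeometry NNReal ENNReal
open scoped RealInnerProductSpace Classical

noncomputable section

namespace GrowthComp

variable {M : Type*} [MetricSpace M]

/-- Length of the path `γ : ℝ → M` over the time interval `[0, T]`
(the total variation of `γ` on `[0, T]`, valued in `ℝ≥0∞`). -/
def pathLength (γ : ℝ → M) (T : ℝ) : ℝ≥0∞ := eVariationOn γ (Set.Icc 0 T)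

/-- The intrinsic metric `d_S` of `M ∖ S`: the infimum of lengths of Lipschitz
paths from `x` to `y` avoiding `S` (with `sInf ∅ = ∞`). -/
def dCompl (S : Set M) (x y : M) : ℝ≥0∞ :=
  sInf {L : ℝ≥0∞ | ∃ (T : ℝ) (γ : ℝ → M), 0 ≤ T ∧ γ 0 = x ∧ γ T = y ∧
    (∃ K : ℝ≥0, LipschitzOnWith K γ (Set.Icc 0 T)) ∧
    (∀ t ∈ Set.Icc 0 T, γ t ∉ S) ∧ L = pathLength γ T}

/-- The distance of `M` is the induced length metric (true for every
complete Riemannian manifold). -/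
def IsLengthSpace (M : Type*) [MetricSpace M] : Prop :=
  ∀ x y : M, ENNReal.ofReal (dist x y) = dCompl (∅ : Set M) x y

/-- A path `γ : [0, T] → M` *avoids* the (time-indexed) family `B`:
it starts at `q`, is `λ`-Lipschitz, and `γ s ∉ B s` for all `s ∈ [0, T]`. -/
def AvoidsB (q : M) (lam : ℝ) (B : ℝ → Set M) (T : ℝ) (γ : ℝ → M) : Prop :=
  γ 0 = q ∧ LipschitzOnWith (Real.toNNReal lam) γ (Set.Icc 0 T) ∧
    ∀ s ∈ Set.Icc 0 T, γ s ∉ B s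

/-- A path `η : [0, T] → M` *avoids* the family `A`:
it starts at `p`, is `1`-Lipschitz, and `η s ∉ A s` for all `s ∈ [0, T]`. -/
def AvoidsA (p : M) (A : ℝ → Set M) (T : ℝ) (η : ℝ → M) : Prop :=
  η 0 = p ∧ LipschitzOnWith 1 η (Set.Icc 0 T) ∧ ∀ s ∈ Set.Icc 0 T, η s ∉ A s

/-- `{A_t, B_t}_{t ≥ 0}` is a *growth competition* between `p` and `q` with
speed ratio `λ`: both families are increasing, `A 0 = {q}`, `B 0 = {p}`, and
for `t > 0`, `A t` is the union of `γ([0,t])` over paths `γ` avoiding `B`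
and `B t` is the union of `η([0,t))` over paths `η` avoiding `A`. -/
structure IsGrowthCompetition (p q : M) (lam : ℝ) (A B : ℝ → Set M) : Prop where
  monoA : ∀ ⦃t₁ t₂ : ℝ⦄, 0 ≤ t₁ → t₁ ≤ t₂ → A t₁ ⊆ A t₂
  monoB : ∀ ⦃t₁ t₂ : ℝ⦄, 0 ≤ t₁ → t₁ ≤ t₂ → B t₁ ⊆ B t₂
  A_zero : A 0 = {q}
  B_zero : B 0 = {p}
  A_eq : ∀ t : ℝ, 0 < t →
    A t = {x | ∃ γ : ℝ → M, AvoidsB q lam B t γ ∧ x ∈ γ '' Set.Icc 0 t}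
  B_eq : ∀ t : ℝ, 0 < t →
    B t = {x | ∃ η : ℝ → M, AvoidsA p A t η ∧ x ∈ η '' Set.Ico 0 t}

/-- `A_∞ = ⋃_{t ≥ 0} A_t`. -/
def Ainfty (A : ℝ → Set M) : Set M := ⋃ t ∈ Set.Ici (0 : ℝ), A t

/-- `B_∞ = ⋃_{t ≥ 0} B_t`. -/
def Binfty (B : ℝ → Set M) : Set M := ⋃ t ∈ Set.Ici (0 : ℝ), B t

/-- The recursively defined sets `Ω_n`:
`Ω_0 = ∅`, `Ω_{n+1} = Ω_n ∪ {x ∈ M ∖ Ω_n | d_{Ω_n}(x, q) > λ d(x, p)}`. -/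
def OmegaSeq (p q : M) (lam : ℝ) : ℕ → Set M
  | 0 => ∅
  | n + 1 => OmegaSeq p q lam n ∪
      {x | x ∉ OmegaSeq p q lam n ∧
        ENNReal.ofReal (lam * dist x p) < dCompl (OmegaSeq p q lam n) x q}

/-- `Ω = ⋃_{n ≥ 1} Ω_n`. -/
def Omega (p q : M) (lam : ℝ) : Set M := ⋃ n : ℕ, OmegaSeq p q lam (n + 1)

/-- `γ` is a unit-speed minimizing geodesic from `x` to `y`, parametrized on
`[0, dist x y]`. -/
def IsMinGeodesicFromTo (γ : ℝ → M) (x y : M) : Prop :=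
  γ 0 = x ∧ γ (dist x y) = y ∧
    ∀ s ∈ Set.Icc (0 : ℝ) (dist x y), ∀ t ∈ Set.Icc (0 : ℝ) (dist x y),
      dist (γ s) (γ t) = |s - t|

/-- `S` is star-shaped about `p`: every minimizing geodesic from `p` to a
point of `S` lies inside `S`. -/
def StarShapedAbout (p : M) (S : Set M) : Prop :=
  ∀ x ∈ S, ∀ γ : ℝ → M, IsMinGeodesicFromTo γ p x →
    ∀ t ∈ Set.Icc (0 : ℝ) (dist p x), γ t ∈ S

/-- `x` is *visible* from `q` through the obstacle `S`: no minimizing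
geodesic joining `q` and `x` intersects `S`.  (On a nonpositively curved
simply connected manifold minimizing geodesics are unique, so this matches
"the minimizing geodesic joining `q` and `x` does not intersect `S`".) -/
def VisibleThrough (S : Set M) (q x : M) : Prop :=
  ∀ γ : ℝ → M, IsMinGeodesicFromTo γ q x →
    ∀ t ∈ Set.Icc (0 : ℝ) (dist q x), γ t ∉ S

/-! ### Spherically symmetric manifolds, via polar normal coordinates -/

/-- Euclidean `n`-space, the model space for polar normal coordinates. -/
abbrev Euc (n : ℕ) : Type := EuclideanSpace ℝ (Fin n)

/-- The norm of the tangent vector `v` at the point `x ∈ ℝⁿ ∖ {0}` in the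
spherically symmetric (warped product) metric `g = dr² + G(r)² dθ²`:
`g_x(v,v) = ⟨v, x̂⟩² + (G(‖x‖)²/‖x‖²) (‖v‖² − ⟨v, x̂⟩²)`. -/
def warpNorm {n : ℕ} (G : ℝ → ℝ) (x v : Euc n) : ℝ :=
  if x = 0 then ‖v‖
  else Real.sqrt (⟪v, ‖x‖⁻¹ • x⟫ ^ 2 +
    (G ‖x‖ / ‖x‖) ^ 2 * (‖v‖ ^ 2 - ⟪v, ‖x‖⁻¹ • x⟫ ^ 2))

/-- The length of a (Lipschitz, hence a.e. differentiable) curve `c` on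
`[0, T]` in the warped metric `dr² + G(r)² dθ²`. -/
def warpLength {n : ℕ} (G : ℝ → ℝ) (c : ℝ → Euc n) (T : ℝ) : ℝ≥0∞ :=
  ∫⁻ t in Set.Icc (0 : ℝ) T, ENNReal.ofReal (warpNorm G (c t) (deriv c t))

/-- `G` is an admissible warping function: positive and smooth on `(0,∞)`,
with `G(r) → 0` and `G(r)/r → 1` as `r → 0⁺`. -/
def IsWarping (G : ℝ → ℝ) : Prop :=
  (∀ r : ℝ, 0 < r → 0 < G r) ∧ ContDiffOn ℝ (⊤ : ℕ∞) G (Set.Ioi 0) ∧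
    Tendsto G (nhdsWithin 0 (Set.Ioi 0)) (nhds 0) ∧
    Tendsto (fun r => G r / r) (nhdsWithin 0 (Set.Ioi 0)) (nhds 1)

/-- `Φ : ℝⁿ ≃ M` realizes `M` as spherically symmetric about `p` with
warping function `G`: `Φ` is a global geodesic polar normal coordinate
chart — `Φ 0 = p` and the radial coordinate is the distance to `p` — and
the Riemannian distance of `M` is the infimum of warped lengths of
Lipschitz curves computed in the chart. -/
def IsSphericallySymmetric {n : ℕ} (p : M) (G : ℝ → ℝ) (Φ : Euc n ≃ M) : Prop :=
  IsWarping G ∧ Φ 0 = p ∧ (∀ x : Euc n, dist (Φ x) p = ‖x‖) ∧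
    ∀ x y : Euc n, ENNReal.ofReal (dist (Φ x) (Φ y)) =
      sInf {L : ℝ≥0∞ | ∃ (T : ℝ) (c : ℝ → Euc n), 0 ≤ T ∧ c 0 = x ∧ c T = y ∧
        (∃ K : ℝ≥0, LipschitzOnWith K c (Set.Icc 0 T)) ∧ L = warpLength G c T}

/-- The angular polar coordinate `θ(x) ∈ S_pM ≅ S^{n-1}` of a point
`x ≠ p`, read off through the polar chart `Φ`. -/
def polarTheta {n : ℕ} {M : Type*} [MetricSpace M] (Φ : Euc n ≃ M) (x : M) : Euc n :=
  ‖Φ.symm x‖⁻¹ • Φ.symm x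

/-- Nonpositive sectional curvature for the spherically symmetric metric
`dr² + G(r)² dθ²`: the radial sectional curvature is `−G''/G ≤ 0`,
i.e. `G` is convex, and the tangential one is `(1 − G'²)/G² ≤ 0`,
i.e. `G' ≥ 1`. -/
def NonposCurvWarping (G : ℝ → ℝ) : Prop :=
  ConvexOn ℝ (Set.Ioi 0) G ∧ ∀ r : ℝ, 0 < r → 1 ≤ deriv G r

/-- `∫₁^∞ dr / G(r) = ∞`.  For a surface of revolution this is, by a theorem
of Milnor cited in the paper, equivalent to parabolicity, i.e. conformal
equivalence to the Euclidean plane. -/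
def ParabolicWarping (G : ℝ → ℝ) : Prop :=
  ∫⁻ r in Set.Ici (1 : ℝ), ENNReal.ofReal ((G r)⁻¹) = ⊤

/-- `∫₁^∞ dr / G(r) < ∞`.  For a surface of revolution this is, by a theorem
of Milnor cited in the paper, equivalent to hyperbolicity, i.e. conformal
equivalence to the hyperbolic plane. -/
def HyperbolicWarping (G : ℝ → ℝ) : Prop :=
  ∫⁻ r in Set.Ici (1 : ℝ), ENNReal.ofReal ((G r)⁻¹) < ⊤

/-! ### Warping functions of nonpositive curvature -/

section Warping

variable {G : ℝ → ℝ}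

lemma IsWarping.hasDerivAt (hG : IsWarping G) {r : ℝ} (hr : 0 < r) :
    HasDerivAt G (deriv G r) r :=
  ((hG.2.1.contDiffAt (Ioi_mem_nhds hr)).differentiableAt (by simp)).hasDerivAt

lemma IsWarping.continuousOn (hG : IsWarping G) : ContinuousOn G (Ioi 0) :=
  hG.2.1.continuousOn

lemma IsWarping.continuousOn_deriv (hG : IsWarping G) : ContinuousOn (deriv G) (Ioi 0) :=
  hG.2.1.continuousOn_deriv_of_isOpen isOpen_Ioi (by simp)

lemma NonposCurvWarping.le_apply (hG : IsWarping G) (hN : NonposCurvWarping G) {r : ℝ}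
    (hr : 0 < r) : r ≤ G r := by
  have hmono : MonotoneOn (fun x => G x - x) (Ioi 0) := by
    refine monotoneOn_of_deriv_nonneg (convex_Ioi 0) (hG.continuousOn.sub continuousOn_id) ?_ ?_
    · rw [interior_Ioi]
      intro x hx
      exact ((hG.hasDerivAt hx).sub (hasDerivAt_id x)).differentiableAt.differentiableWithinAt
    · rw [interior_Ioi]
      intro x hx
      have := ((hG.hasDerivAt hx).sub (hasDerivAt_id x)).deriv
      change 0 ≤ deriv (fun x => G x - x) x
      rw [show (fun x => G x - x) = G - id from rfl, this]
      linarith [hN.2 x hx]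
  have hlim : Tendsto (fun x => G x - x) (nhdsWithin 0 (Ioi 0)) (nhds (0 - 0)) :=
    hG.2.2.1.sub (tendsto_id.mono_left nhdsWithin_le_nhds)
  have := le_of_tendsto hlim (b := G r - r) (by
    filter_upwards [Ioo_mem_nhdsGT hr] with x hx
    exact hmono hx.1 hr hx.2.le)
  linarith

lemma NonposCurvWarping.strictMonoOn (hG : IsWarping G) (hN : NonposCurvWarping G) :
    StrictMonoOn G (Ioi 0) := by
  refine strictMonoOn_of_deriv_pos (convex_Ioi 0) hG.continuousOn ?_
  rw [interior_Ioi]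
  intro x hx
  linarith [hN.2 x hx]

lemma NonposCurvWarping.monotoneOn_deriv (hG : IsWarping G) (hN : NonposCurvWarping G) :
    MonotoneOn (deriv G) (Ioi 0) :=
  hN.1.monotoneOn_deriv fun _ hx => (hG.hasDerivAt hx).differentiableAt

lemma NonposCurvWarping.le_mul_deriv (hG : IsWarping G) (hN : NonposCurvWarping G) {r : ℝ}
    (hr : 0 < r) : G r ≤ r * deriv G r := by
  have hlim : Tendsto (fun x => G r - G x) (nhdsWithin 0 (Ioi 0)) (nhds (G r - 0)) :=
    tendsto_const_nhds.sub hG.2.2.1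
  have hlim' : Tendsto (fun x => (r - x) * deriv G r) (nhdsWithin 0 (Ioi 0))
      (nhds ((r - 0) * deriv G r)) :=
    (tendsto_const_nhds.sub (tendsto_id.mono_left nhdsWithin_le_nhds)).mul_const _
  have := le_of_tendsto_of_tendsto hlim hlim' (by
    filter_upwards [Ioo_mem_nhdsGT hr] with x hx
    have := hN.1.slope_le_deriv hx.1 (show r ∈ Ioi 0 from hr) hx.2
      (hG.hasDerivAt hr).differentiableAt
    rw [slope_def_field, div_le_iff₀ (by linarith [hx.2])] at this
    linarith)
  linarith

end Warping

/-! ### Lipschitz functions on an interval -/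

/-- `f` is Lipschitz on `[0, L]`. -/
def LipOn (L : ℝ) (f : ℝ → ℝ) : Prop := ∃ K : ℝ≥0, LipschitzOnWith K f (Icc 0 L)

namespace LipOn

variable {L : ℝ} {f g : ℝ → ℝ}

lemma of_abs_le {K : ℝ} (h : ∀ x ∈ Icc 0 L, ∀ y ∈ Icc 0 L, |f x - f y| ≤ K * |x - y|) :
    LipOn L f := by
  refine ⟨K.toNNReal, LipschitzOnWith.of_dist_le_mul fun x hx y hy => ?_⟩
  rw [Real.dist_eq, Real.dist_eq]
  exact (h x hx y hy).trans (mul_le_mul_of_nonneg_right (Real.le_coe_toNNReal K) (abs_nonneg _))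

lemma exists_abs_le (hf : LipOn L f) :
    ∃ K : ℝ, 0 ≤ K ∧ ∀ x ∈ Icc 0 L, ∀ y ∈ Icc 0 L, |f x - f y| ≤ K * |x - y| := by
  obtain ⟨K, hK⟩ := hf
  refine ⟨K, K.2, fun x hx y hy => ?_⟩
  simpa [Real.dist_eq] using hK.dist_le_mul x hx y hy

lemma continuousOn (hf : LipOn L f) : ContinuousOn f (Icc 0 L) := hf.choose_spec.continuousOn

lemma exists_bound (hf : LipOn L f) : ∃ B : ℝ, 0 ≤ B ∧ ∀ x ∈ Icc 0 L, |f x| ≤ B := by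
  obtain ⟨B, hB⟩ := isCompact_Icc.exists_bound_of_continuousOn hf.continuousOn
  exact ⟨max B 0, le_max_right _ _, fun x hx => (hB x hx).trans (le_max_left _ _)⟩

lemma const (c : ℝ) : LipOn L fun _ => c :=
  of_abs_le (K := 0) fun _ _ _ _ => by simp

lemma add (hf : LipOn L f) (hg : LipOn L g) : LipOn L fun s => f s + g s := by
  obtain ⟨K, -, hK⟩ := hf.exists_abs_le
  obtain ⟨K', -, hK'⟩ := hg.exists_abs_le
  refine of_abs_le (K := K + K') fun x hx y hy => ?_
  calc |f x + g x - (f y + g y)| = |(f x - f y) + (g x - g y)| := by ring_nf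
    _ ≤ |f x - f y| + |g x - g y| := abs_add_le _ _
    _ ≤ _ := by linarith [hK x hx y hy, hK' x hx y hy]

lemma mul (hf : LipOn L f) (hg : LipOn L g) : LipOn L fun s => f s * g s := by
  obtain ⟨K, hK0, hK⟩ := hf.exists_abs_le
  obtain ⟨K', hK0', hK'⟩ := hg.exists_abs_le
  obtain ⟨B, hB0, hB⟩ := hf.exists_bound
  obtain ⟨B', hB0', hB'⟩ := hg.exists_bound
  refine of_abs_le (K := B * K' + K * B') fun x hx y hy => ?_
  calc |f x * g x - f y * g y| = |f x * (g x - g y) + (f x - f y) * g y| := by ring_nf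
    _ ≤ |f x * (g x - g y)| + |(f x - f y) * g y| := abs_add_le _ _
    _ = |f x| * |g x - g y| + |f x - f y| * |g y| := by rw [abs_mul, abs_mul]
    _ ≤ B * (K' * |x - y|) + K * |x - y| * B' := by
        gcongr
        · exact hB x hx
        · exact hK' x hx y hy
        · exact hK x hx y hy
        · exact hB' y hy
    _ = _ := by ring

lemma const_mul (c : ℝ) (hf : LipOn L f) : LipOn L fun s => c * f s := (const c).mul hf

lemma sub (hf : LipOn L f) (hg : LipOn L g) : LipOn L fun s => f s - g s := by
  simpa [sub_eq_add_neg] using hf.add (hg.const_mul (-1))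

lemma absolutelyContinuous (hf : LipOn L f) {a b : ℝ} (ha : a ∈ Icc 0 L) (hb : b ∈ Icc 0 L) :
    AbsolutelyContinuousOnInterval f a b := by
  obtain ⟨K, hK⟩ := hf
  exact (hK.mono (uIcc_subset_Icc ha hb)).absolutelyContinuousOnInterval

lemma ae_differentiableAt (hf : LipOn L f) : ∀ᵐ s, s ∈ Ioo 0 L → DifferentiableAt ℝ f s := by
  rcases le_or_gt 0 L with hL | hL
  · filter_upwards [(hf.absolutelyContinuous (left_mem_Icc.2 hL)
      (right_mem_Icc.2 hL)).ae_differentiableAt] with s hs hs'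
    exact hs (by rw [uIcc_of_le hL]; exact Ioo_subset_Icc_self hs')
  · simp [Ioo_eq_empty (not_lt.2 hL.le)]

lemma exists_deriv_bound (hf : LipOn L f) :
    ∃ K : ℝ, 0 ≤ K ∧ ∀ s ∈ Ioo 0 L, |deriv f s| ≤ K := by
  obtain ⟨K, hK⟩ := hf
  exact ⟨K, K.2, fun s hs => norm_deriv_le_of_lipschitzOn (Icc_mem_nhds hs.1 hs.2) hK⟩

lemma integral_deriv (hf : LipOn L f) {a b : ℝ} (ha : a ∈ Icc 0 L) (hb : b ∈ Icc 0 L) :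
    ∫ s in a..b, deriv f s = f b - f a :=
  (hf.absolutelyContinuous ha hb).integral_deriv_eq_sub

/-- Composition with a function that is `C¹` on the positive axis. -/
lemma comp_pos {F F' : ℝ → ℝ} (hF : ∀ x, 0 < x → HasDerivAt F (F' x) x)
    (hF' : ContinuousOn F' (Ioi 0)) (hf : LipOn L f) (hpos : ∀ s ∈ Icc 0 L, 0 < f s) :
    LipOn L fun s => F (f s) := by
  rcases lt_or_ge L 0 with hL | hL
  · exact of_abs_le (K := 0) fun x hx => absurd hx (by simp [Icc_eq_empty (not_le.2 hL)])
  obtain ⟨s₀, hs₀, hmin⟩ := isCompact_Icc.exists_isMinOn ⟨0, left_mem_Icc.2 hL⟩ hf.continuousOn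
  obtain ⟨B, hB0, hB⟩ := hf.exists_bound
  have hmem : ∀ s ∈ Icc 0 L, f s ∈ Icc (f s₀) B := fun s hs =>
    ⟨hmin hs, (le_abs_self _).trans (hB s hs)⟩
  have hsub : Icc (f s₀) B ⊆ Ioi 0 := fun x hx => (hpos s₀ hs₀).trans_le hx.1
  obtain ⟨C, hC⟩ := isCompact_Icc.exists_bound_of_continuousOn (hF'.mono hsub)
  have hlip : LipschitzOnWith C.toNNReal F (Icc (f s₀) B) := by
    refine (convex_Icc _ _).lipschitzOnWith_of_nnnorm_hasDerivWithin_le (f' := F')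
      (fun x hx => (hF x (hsub hx)).hasDerivWithinAt) fun x hx => ?_
    rw [← NNReal.coe_le_coe]
    exact (hC x hx).trans (Real.le_coe_toNNReal C)
  obtain ⟨K, hK⟩ := hf
  exact ⟨_, hlip.comp hK hmem⟩

end LipOn

lemma ae_Ioc_of_ae_Ioo {L : ℝ} {P : ℝ → Prop} (h : ∀ᵐ s, s ∈ Ioo 0 L → P s) :
    ∀ᵐ s, s ∈ Ioc 0 L → P s := by
  filter_upwards [h, Measure.ae_ne volume L] with s hs hne hs'
  exact hs ⟨hs'.1, lt_of_le_of_ne hs'.2 hne⟩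

/-- An a.e. identity on `(0, L)` lets one replace the integrand. -/
lemma integral_congr_Ioo {L : ℝ} (hL : 0 ≤ L) {f g : ℝ → ℝ}
    (h : ∀ᵐ s, s ∈ Ioo 0 L → f s = g s) : ∫ s in 0..L, f s = ∫ s in 0..L, g s := by
  refine intervalIntegral.integral_congr_ae ?_
  rw [uIoc_of_le hL]
  exact ae_Ioc_of_ae_Ioo h

/-- Bounded a.e. measurable functions are interval integrable. -/
lemma intervalIntegrable_of_bound {L : ℝ} (hL : 0 ≤ L) {f : ℝ → ℝ} {C : ℝ}
    (hm : AEStronglyMeasurable f (volume.restrict (Ioc 0 L)))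
    (h : ∀ s ∈ Ioo 0 L, |f s| ≤ C) : IntervalIntegrable f volume 0 L := by
  rw [intervalIntegrable_iff_integrableOn_Ioc_of_le hL]
  refine Integrable.of_bound hm C ?_
  rw [ae_restrict_iff' measurableSet_Ioc]
  exact ae_Ioc_of_ae_Ioo (Eventually.of_forall h)

lemma aestronglyMeasurable_Ioc {L : ℝ} {f : ℝ → ℝ} (hf : ContinuousOn f (Icc 0 L)) :
    AEStronglyMeasurable f (volume.restrict (Ioc 0 L)) :=
  (hf.mono Ioc_subset_Icc_self).aestronglyMeasurable measurableSet_Ioc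

lemma LipOn.exists_pos_le {L : ℝ} (hL : 0 ≤ L) {f : ℝ → ℝ} (hf : LipOn L f)
    (hpos : ∀ s ∈ Icc 0 L, 0 < f s) : ∃ m : ℝ, 0 < m ∧ ∀ s ∈ Icc 0 L, m ≤ f s := by
  obtain ⟨s₀, hs₀, hmin⟩ := isCompact_Icc.exists_isMinOn ⟨0, left_mem_Icc.2 hL⟩ hf.continuousOn
  exact ⟨f s₀, hpos s₀ hs₀, fun s hs => hmin hs⟩

lemma abs_add_mul_le {a b ε K : ℝ} (ha : |a| ≤ K) (hb : |b| ≤ K) (hε : |ε| ≤ 1) :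
    |a + ε * b| ≤ 2 * K := by
  have hK : 0 ≤ K := (abs_nonneg a).trans ha
  calc |a + ε * b| ≤ |a| + |ε * b| := abs_add_le _ _
    _ = |a| + |ε| * |b| := by rw [abs_mul]
    _ ≤ K + 1 * K := by gcongr
    _ = 2 * K := by ring

lemma IsWarping.hasDerivAt_energy {G : ℝ → ℝ} (hG : IsWarping G) {L : ℝ} (hL : 0 < L)
    {r ψ ζ ξ : ℝ → ℝ} (hr : LipOn L r) (hψ : LipOn L ψ) (hζ : LipOn L ζ) (hξ : LipOn L ξ)
    (hpos : ∀ s ∈ Icc 0 L, 0 < r s) :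
    HasDerivAt (fun ε => ∫ s in 0..L, ((deriv r s + ε * deriv ζ s) ^ 2 +
        G (r s + ε * ζ s) ^ 2 * (deriv ψ s + ε * deriv ξ s) ^ 2))
      (∫ s in 0..L, 2 * (deriv r s * deriv ζ s +
        G (r s) * deriv G (r s) * deriv ψ s ^ 2 * ζ s +
          G (r s) ^ 2 * (deriv ψ s * deriv ξ s))) 0 := by
  obtain ⟨m, hm0, hm⟩ := hr.exists_pos_le hL.le hpos
  obtain ⟨B, hB0, hB⟩ := hr.exists_bound
  obtain ⟨Z, hZ0, hZ⟩ := hζ.exists_bound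
  obtain ⟨K₁, h₁0, h₁⟩ := hr.exists_deriv_bound
  obtain ⟨K₂, h₂0, h₂⟩ := hψ.exists_deriv_bound
  obtain ⟨K₃, h₃0, h₃⟩ := hζ.exists_deriv_bound
  obtain ⟨K₄, h₄0, h₄⟩ := hξ.exists_deriv_bound
  have hsub : Icc (m / 2) (B + Z) ⊆ Ioi 0 := fun x hx => (half_pos hm0).trans_le hx.1
  obtain ⟨C₁, hC₁⟩ := isCompact_Icc.exists_bound_of_continuousOn (hG.continuousOn.mono hsub)
  obtain ⟨C₂, hC₂⟩ := isCompact_Icc.exists_bound_of_continuousOn (hG.continuousOn_deriv.mono hsub)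
  set δ : ℝ := min 1 (m / 2 / (Z + 1)) with hδ
  have hδ0 : 0 < δ := by positivity
  set K : ℝ := K₁ + K₂ + K₃ + K₄ + |C₁| + |C₂| + Z with hK
  have hmem : ∀ ε ∈ Ioo (-δ) δ, ∀ s ∈ Icc 0 L, r s + ε * ζ s ∈ Icc (m / 2) (B + Z) := by
    intro ε hε s hs
    have hε' : |ε| ≤ δ := (abs_lt.2 hε).le
    have e1 : |ε * ζ s| ≤ m / 2 := by
      rw [abs_mul]
      calc |ε| * |ζ s| ≤ (m / 2 / (Z + 1)) * (Z + 1) := by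
            gcongr
            · exact hε'.trans (min_le_right _ _)
            · linarith [hZ s hs]
        _ = m / 2 := by field_simp
    have e2 : |ε * ζ s| ≤ Z := by
      rw [abs_mul]
      calc |ε| * |ζ s| ≤ 1 * Z := by
            gcongr
            · exact hε'.trans (min_le_left _ _)
            · exact hZ s hs
        _ = Z := one_mul Z
    have := hm s hs
    have := (abs_le.1 (hB s hs)).2
    rw [abs_le] at e1 e2
    constructor <;> linarith [e1.1, e2.2]
  have h0mem : (0 : ℝ) ∈ Ioo (-δ) δ := ⟨by linarith, hδ0⟩
  have hcont : ∀ ε ∈ Ioo (-δ) δ, AEStronglyMeasurable (fun s => G (r s + ε * ζ s))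
      (volume.restrict (Ioc 0 L)) := fun ε hε =>
    aestronglyMeasurable_Ioc (hG.continuousOn.comp
      (hr.add (hζ.const_mul ε)).continuousOn fun s hs => hsub (hmem ε hε s hs))
  have hmeas : ∀ ε ∈ Ioo (-δ) δ, AEStronglyMeasurable (fun s => (deriv r s + ε * deriv ζ s) ^ 2 +
      G (r s + ε * ζ s) ^ 2 * (deriv ψ s + ε * deriv ξ s) ^ 2)
      (volume.restrict (Ioc 0 L)) := by
    intro ε hε
    have e1 : AEStronglyMeasurable (fun s => (deriv r s + ε * deriv ζ s) ^ 2)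
        (volume.restrict (Ioc 0 L)) :=
      (((measurable_deriv r).add ((measurable_deriv ζ).const_mul ε)).pow_const
        2).aestronglyMeasurable
    have e2 : AEStronglyMeasurable (fun s => (deriv ψ s + ε * deriv ξ s) ^ 2)
        (volume.restrict (Ioc 0 L)) :=
      (((measurable_deriv ψ).add ((measurable_deriv ξ).const_mul ε)).pow_const
        2).aestronglyMeasurable
    exact e1.add (((hcont ε hε).pow 2).mul e2)
  have hb : ∀ ε ∈ Ioo (-δ) δ, ∀ s ∈ Ioo 0 L, |G (r s + ε * ζ s)| ≤ K ∧
      |deriv G (r s + ε * ζ s)| ≤ K ∧ |ζ s| ≤ K ∧ |deriv ζ s| ≤ K ∧ |deriv ξ s| ≤ K ∧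
      |deriv r s + ε * deriv ζ s| ≤ 2 * K ∧ |deriv ψ s + ε * deriv ξ s| ≤ 2 * K := by
    intro ε hε s hs
    have hs' := Ioo_subset_Icc_self hs
    have hε1 : |ε| ≤ 1 := (abs_lt.2 hε).le.trans (min_le_left _ _)
    have g1 := hC₁ _ (hmem ε hε s hs')
    have g2 := hC₂ _ (hmem ε hε s hs')
    rw [Real.norm_eq_abs] at g1 g2
    have := le_abs_self C₁
    have := le_abs_self C₂
    have := abs_nonneg C₁
    have := abs_nonneg C₂
    have := hZ s hs'
    refine ⟨by linarith, by linarith, by linarith, by linarith [h₃ s hs], by linarith [h₄ s hs],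
      abs_add_mul_le (by linarith [h₁ s hs]) (by linarith [h₃ s hs]) hε1,
      abs_add_mul_le (by linarith [h₂ s hs]) (by linarith [h₄ s hs]) hε1⟩
  have key := intervalIntegral.hasDerivAt_integral_of_dominated_loc_of_deriv_le
    (μ := volume) (a := 0) (b := L) (x₀ := (0 : ℝ)) (s := Ioo (-δ) δ)
    (bound := fun _ => 2 * (2 * K * K + K * K * (2 * K) ^ 2 * K + K ^ 2 * (2 * K * K)))
    (F := fun ε s => (deriv r s + ε * deriv ζ s) ^ 2 +
      G (r s + ε * ζ s) ^ 2 * (deriv ψ s + ε * deriv ξ s) ^ 2)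
    (F' := fun ε s => 2 * ((deriv r s + ε * deriv ζ s) * deriv ζ s +
      G (r s + ε * ζ s) * deriv G (r s + ε * ζ s) * (deriv ψ s + ε * deriv ξ s) ^ 2 * ζ s +
      G (r s + ε * ζ s) ^ 2 * ((deriv ψ s + ε * deriv ξ s) * deriv ξ s)))
    (Ioo_mem_nhds h0mem.1 h0mem.2) ?_ ?_ ?_ ?_ ?_ ?_
  · simpa using key.2
  · rw [uIoc_of_le hL.le]
    filter_upwards [Ioo_mem_nhds h0mem.1 h0mem.2] with ε hε using hmeas ε hε
  · refine intervalIntegrable_of_bound hL.le (C := (2 * K) ^ 2 + K ^ 2 * (2 * K) ^ 2)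
      (hmeas 0 h0mem) fun s hs => ?_
    obtain ⟨b1, -, -, -, -, b6, b7⟩ := hb 0 h0mem s hs
    refine (abs_add_le _ _).trans ?_
    rw [abs_mul, abs_pow, abs_pow, abs_pow]
    gcongr
  · rw [uIoc_of_le hL.le]
    have e2 : AEStronglyMeasurable (fun s => deriv G (r s + 0 * ζ s))
        (volume.restrict (Ioc 0 L)) :=
      aestronglyMeasurable_Ioc (hG.continuousOn_deriv.comp
        (hr.add (hζ.const_mul 0)).continuousOn fun s hs => hsub (hmem 0 h0mem s hs))
    have m1 : ∀ f : ℝ → ℝ, AEStronglyMeasurable (deriv f) (volume.restrict (Ioc 0 L)) :=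
      fun f => (measurable_deriv f).aestronglyMeasurable
    have m2 : ∀ f g : ℝ → ℝ, AEStronglyMeasurable (fun s => deriv f s + 0 * deriv g s)
      (volume.restrict (Ioc 0 L)) := fun f g => (m1 f).add ((m1 g).const_mul 0)
    exact ((((m2 r ζ).mul (m1 ζ)).add ((((hcont 0 h0mem).mul e2).mul ((m2 ψ ξ).pow 2)).mul
      (aestronglyMeasurable_Ioc hζ.continuousOn))).add
      (((hcont 0 h0mem).pow 2).mul ((m2 ψ ξ).mul (m1 ξ)))).const_mul 2
  · rw [uIoc_of_le hL.le]
    refine ae_Ioc_of_ae_Ioo (Eventually.of_forall fun s hs ε hε => ?_)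
    obtain ⟨b1, b2, b3, b4, b5, b6, b7⟩ := hb ε hε s hs
    rw [Real.norm_eq_abs, abs_mul, abs_two]
    gcongr
    refine (abs_add_three _ _ _).trans ?_
    simp only [abs_mul, abs_pow]
    gcongr
  · simp
  · rw [uIoc_of_le hL.le]
    refine ae_Ioc_of_ae_Ioo (Eventually.of_forall fun s hs ε hε => ?_)
    have hlin : ∀ a b : ℝ, HasDerivAt (fun ε => a + ε * b) b ε := fun a b => by
      simpa using ((hasDerivAt_id ε).mul_const b).const_add a
    have hg := (hG.hasDerivAt (hsub (hmem ε hε s (Ioo_subset_Icc_self hs)))).comp ε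
      (hlin (r s) (ζ s))
    have := ((hlin (deriv r s) (deriv ζ s)).pow 2).add ((hg.pow 2).mul
      ((hlin (deriv ψ s) (deriv ξ s)).pow 2))
    refine this.congr_deriv ?_
    simp [Function.comp]
    ring

/-- `(r, ψ)` is a unit-speed polar profile on `[0, L]` which minimizes length among the
Lipschitz profiles with the same end points. -/
structure IsMinProfile (G : ℝ → ℝ) (L : ℝ) (r ψ : ℝ → ℝ) : Prop where
  lip_r : LipOn L r
  lip_ψ : LipOn L ψ
  pos : ∀ s ∈ Icc 0 L, 0 < r s
  speed : ∀ᵐ s, s ∈ Ioo 0 L → deriv r s ^ 2 + G (r s) ^ 2 * deriv ψ s ^ 2 ≤ 1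
  le_length : ∀ ρ φ : ℝ → ℝ, LipOn L ρ → LipOn L φ → (∀ s ∈ Icc 0 L, 0 < ρ s) →
    ρ 0 = r 0 → ρ L = r L → φ 0 = ψ 0 → φ L = ψ L →
    L ≤ ∫ s in 0..L, √(deriv ρ s ^ 2 + G (ρ s) ^ 2 * deriv φ s ^ 2)

lemma IsWarping.exists_energy_bound {G : ℝ → ℝ} (hG : IsWarping G) {L : ℝ}
    {r ψ : ℝ → ℝ} (hr : LipOn L r) (hψ : LipOn L ψ) (hpos : ∀ s ∈ Icc 0 L, 0 < r s) :
    AEStronglyMeasurable (fun s => deriv r s ^ 2 + G (r s) ^ 2 * deriv ψ s ^ 2)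
      (volume.restrict (Ioc 0 L)) ∧
    ∃ C, ∀ s ∈ Ioo 0 L, |deriv r s ^ 2 + G (r s) ^ 2 * deriv ψ s ^ 2| ≤ C := by
  obtain ⟨K₁, h₁0, h₁⟩ := hr.exists_deriv_bound
  obtain ⟨K₂, h₂0, h₂⟩ := hψ.exists_deriv_bound
  have hGr : ContinuousOn (fun s => G (r s)) (Icc 0 L) :=
    hG.continuousOn.comp hr.continuousOn hpos
  obtain ⟨C, hC⟩ := isCompact_Icc.exists_bound_of_continuousOn hGr
  refine ⟨?_, K₁ ^ 2 + C ^ 2 * K₂ ^ 2, fun s hs => ?_⟩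
  · exact ((measurable_deriv r).pow_const 2).aestronglyMeasurable.add
      (((aestronglyMeasurable_Ioc hGr).pow 2).mul
        ((measurable_deriv ψ).pow_const 2).aestronglyMeasurable)
  · have := hC s (Ioo_subset_Icc_self hs)
    rw [Real.norm_eq_abs] at this
    refine (abs_add_le _ _).trans ?_
    rw [abs_mul, abs_pow, abs_pow, abs_pow]
    have := h₁ s hs
    have := h₂ s hs
    gcongr

lemma IsWarping.intervalIntegrable_energy {G : ℝ → ℝ} (hG : IsWarping G) {L : ℝ} (hL : 0 < L)
    {r ψ : ℝ → ℝ} (hr : LipOn L r) (hψ : LipOn L ψ) (hpos : ∀ s ∈ Icc 0 L, 0 < r s) :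
    IntervalIntegrable (fun s => deriv r s ^ 2 + G (r s) ^ 2 * deriv ψ s ^ 2) volume 0 L := by
  obtain ⟨hm, C, hC⟩ := hG.exists_energy_bound hr hψ hpos
  exact intervalIntegrable_of_bound hL.le hm hC

lemma IsWarping.intervalIntegrable_sqrt_energy {G : ℝ → ℝ} (hG : IsWarping G) {L : ℝ} (hL : 0 < L)
    {r ψ : ℝ → ℝ} (hr : LipOn L r) (hψ : LipOn L ψ) (hpos : ∀ s ∈ Icc 0 L, 0 < r s) :
    IntervalIntegrable (fun s => √(deriv r s ^ 2 + G (r s) ^ 2 * deriv ψ s ^ 2)) volume 0 L := by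
  obtain ⟨hm, C, hC⟩ := hG.exists_energy_bound hr hψ hpos
  refine intervalIntegrable_of_bound hL.le (C := √C)
    (Real.continuous_sqrt.comp_aestronglyMeasurable hm) fun s hs => ?_
  rw [abs_of_nonneg (Real.sqrt_nonneg _)]
  exact Real.sqrt_le_sqrt ((le_abs_self _).trans (hC s hs))

namespace IsMinProfile

variable {G : ℝ → ℝ} {L : ℝ} {r ψ : ℝ → ℝ}

lemma le_energy (hG : IsWarping G) (hL : 0 < L) (h : IsMinProfile G L r ψ) {ρ φ : ℝ → ℝ}
    (hρ : LipOn L ρ) (hφ : LipOn L φ) (hpos : ∀ s ∈ Icc 0 L, 0 < ρ s) (h1 : ρ 0 = r 0)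
    (h2 : ρ L = r L) (h3 : φ 0 = ψ 0) (h4 : φ L = ψ L) :
    L ≤ ∫ s in 0..L, (deriv ρ s ^ 2 + G (ρ s) ^ 2 * deriv φ s ^ 2) := by
  have e1 := h.le_length ρ φ hρ hφ hpos h1 h2 h3 h4
  have e2 : ∫ s in 0..L, √(deriv ρ s ^ 2 + G (ρ s) ^ 2 * deriv φ s ^ 2) ≤
      ∫ s in 0..L, (1 / 2 + (1 / 2) * (deriv ρ s ^ 2 + G (ρ s) ^ 2 * deriv φ s ^ 2)) := by
    refine intervalIntegral.integral_mono_on hL.le (hG.intervalIntegrable_sqrt_energy hL hρ hφ hpos)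
      (intervalIntegrable_const.add ((hG.intervalIntegrable_energy hL hρ hφ hpos).const_mul _))
      fun s _ => ?_
    have h0 : 0 ≤ deriv ρ s ^ 2 + G (ρ s) ^ 2 * deriv φ s ^ 2 := by positivity
    nlinarith [Real.sq_sqrt h0, sq_nonneg (√(deriv ρ s ^ 2 + G (ρ s) ^ 2 * deriv φ s ^ 2) - 1)]
  rw [intervalIntegral.integral_add intervalIntegrable_const
    ((hG.intervalIntegrable_energy hL hρ hφ hpos).const_mul _),
    intervalIntegral.integral_const_mul, intervalIntegral.integral_const] at e2
  simp only [sub_zero, smul_eq_mul] at e2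
  linarith

lemma integral_energy_le (hG : IsWarping G) (hL : 0 < L) (h : IsMinProfile G L r ψ) :
    ∫ s in 0..L, (deriv r s ^ 2 + G (r s) ^ 2 * deriv ψ s ^ 2) ≤ L := by
  have := intervalIntegral.integral_mono_ae_restrict (μ := volume) hL.le
    (hG.intervalIntegrable_energy hL h.lip_r h.lip_ψ h.pos)
    (intervalIntegrable_const (c := (1 : ℝ))) (by
      rw [EventuallyLE, ae_restrict_iff' measurableSet_Icc]
      filter_upwards [h.speed, Measure.ae_ne volume 0, Measure.ae_ne volume L] with s hs h0 hL' hs'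
      exact hs ⟨lt_of_le_of_ne hs'.1 h0.symm, lt_of_le_of_ne hs'.2 hL'⟩)
  simpa using this

lemma speed_eq (hG : IsWarping G) (hL : 0 < L) (h : IsMinProfile G L r ψ) :
    ∀ᵐ s, s ∈ Ioo 0 L → deriv r s ^ 2 + G (r s) ^ 2 * deriv ψ s ^ 2 = 1 := by
  have hI := hG.intervalIntegrable_energy hL h.lip_r h.lip_ψ h.pos
  have e1 := h.le_energy hG hL h.lip_r h.lip_ψ h.pos rfl rfl rfl rfl
  have e2 := h.integral_energy_le hG hL
  have e3 : ∫ s in 0..L, (1 - (deriv r s ^ 2 + G (r s) ^ 2 * deriv ψ s ^ 2)) = 0 := by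
    rw [intervalIntegral.integral_sub intervalIntegrable_const hI]
    simp
    linarith
  rw [intervalIntegral.integral_eq_zero_iff_of_le_of_nonneg_ae hL.le] at e3
  · rw [EventuallyEq, ae_restrict_iff' measurableSet_Ioc] at e3
    filter_upwards [e3] with s hs hs'
    have := hs (Ioo_subset_Ioc_self hs')
    simp only [Pi.zero_apply] at this
    linarith
  · rw [EventuallyLE, ae_restrict_iff' measurableSet_Ioc]
    filter_upwards [ae_Ioc_of_ae_Ioo h.speed] with s hs hs'
    have := hs hs'
    simp only [Pi.zero_apply]
    linarith
  · exact intervalIntegrable_const.sub hI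

/-- The first variation formula. -/
lemma first_variation (hG : IsWarping G) (hL : 0 < L) (h : IsMinProfile G L r ψ)
    {ζ ξ : ℝ → ℝ} (hζ : LipOn L ζ) (hξ : LipOn L ξ) (hζ0 : ζ 0 = 0) (hζL : ζ L = 0)
    (hξ0 : ξ 0 = 0) (hξL : ξ L = 0) :
    ∫ s in 0..L, (deriv r s * deriv ζ s + G (r s) * deriv G (r s) * deriv ψ s ^ 2 * ζ s +
      G (r s) ^ 2 * (deriv ψ s * deriv ξ s)) = 0 := by
  have hder := hG.hasDerivAt_energy hL h.lip_r h.lip_ψ hζ hξ h.pos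
  have hmin : IsLocalMin (fun ε => ∫ s in 0..L, ((deriv r s + ε * deriv ζ s) ^ 2 +
        G (r s + ε * ζ s) ^ 2 * (deriv ψ s + ε * deriv ξ s) ^ 2)) 0 := by
    obtain ⟨m, hm0, hm⟩ := h.lip_r.exists_pos_le hL.le h.pos
    obtain ⟨Z, hZ0, hZ⟩ := hζ.exists_bound
    have hδ : 0 < m / (Z + 1) := by positivity
    filter_upwards [Ioo_mem_nhds (neg_lt_zero.2 hδ) hδ] with ε hε
    have hpos : ∀ s ∈ Icc 0 L, 0 < r s + ε * ζ s := by
      intro s hs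
      have : |ε * ζ s| < m := by
        rw [abs_mul]
        calc |ε| * |ζ s| ≤ |ε| * (Z + 1) := by gcongr; linarith [hZ s hs]
          _ < m / (Z + 1) * (Z + 1) := by gcongr; exact abs_lt.2 hε
          _ = m := by field_simp
      linarith [hm s hs, (abs_lt.1 this).1]
    have e1 := h.le_energy hG hL (h.lip_r.add (hζ.const_mul ε)) (h.lip_ψ.add (hξ.const_mul ε)) hpos
      (by simp [hζ0]) (by simp [hζL]) (by simp [hξ0]) (by simp [hξL])
    have e2 := h.integral_energy_le hG hL
    simp only [zero_mul, add_zero]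
    refine e2.trans (e1.trans_eq ?_)
    refine integral_congr_Ioo hL.le ?_
    filter_upwards [h.lip_r.ae_differentiableAt, h.lip_ψ.ae_differentiableAt,
      hζ.ae_differentiableAt, hξ.ae_differentiableAt] with s d1 d2 d3 d4 hs
    have a1 := ((d1 hs).hasDerivAt.fun_add ((d3 hs).hasDerivAt.const_mul ε)).deriv
    have a2 := ((d2 hs).hasDerivAt.fun_add ((d4 hs).hasDerivAt.const_mul ε)).deriv
    rw [a1, a2]
  have := hmin.hasDerivAt_eq_zero hder
  rw [intervalIntegral.integral_const_mul] at this
  linarith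

end IsMinProfile

/-- Bounded measurable functions on `(0, L)`. -/
def BddMeas (L : ℝ) (f : ℝ → ℝ) : Prop :=
  AEStronglyMeasurable f (volume.restrict (Ioc 0 L)) ∧ ∃ C, ∀ s ∈ Ioo 0 L, |f s| ≤ C

namespace BddMeas

variable {L : ℝ} {f g : ℝ → ℝ}

lemma of_continuousOn (hf : ContinuousOn f (Icc 0 L)) : BddMeas L f := by
  obtain ⟨C, hC⟩ := isCompact_Icc.exists_bound_of_continuousOn hf
  exact ⟨aestronglyMeasurable_Ioc hf, C, fun s hs => hC s (Ioo_subset_Icc_self hs)⟩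

lemma deriv (hf : LipOn L f) : BddMeas L (deriv f) := by
  obtain ⟨K, -, hK⟩ := hf.exists_deriv_bound
  exact ⟨(measurable_deriv f).aestronglyMeasurable, K, hK⟩

lemma add (hf : BddMeas L f) (hg : BddMeas L g) : BddMeas L fun s => f s + g s := by
  obtain ⟨hf, C, hC⟩ := hf
  obtain ⟨hg, C', hC'⟩ := hg
  exact ⟨hf.add hg, C + C', fun s hs => (abs_add_le _ _).trans (add_le_add (hC s hs) (hC' s hs))⟩

lemma mul (hf : BddMeas L f) (hg : BddMeas L g) : BddMeas L fun s => f s * g s := by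
  obtain ⟨hf, C, hC⟩ := hf
  obtain ⟨hg, C', hC'⟩ := hg
  refine ⟨hf.mul hg, C * C', fun s hs => ?_⟩
  rw [abs_mul]
  have := (abs_nonneg _).trans (hC s hs)
  exact mul_le_mul (hC s hs) (hC' s hs) (abs_nonneg _) this

lemma const (c : ℝ) : BddMeas L fun _ => c := of_continuousOn continuousOn_const

lemma sub (hf : BddMeas L f) (hg : BddMeas L g) : BddMeas L fun s => f s - g s := by
  simpa [sub_eq_add_neg] using hf.add ((const (-1)).mul hg)

lemma intervalIntegrable (hL : 0 ≤ L) (hf : BddMeas L f) : IntervalIntegrable f volume 0 L :=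
  intervalIntegrable_of_bound hL hf.1 hf.2.choose_spec

lemma lipOn_primitive (hL : 0 ≤ L) (hf : BddMeas L f) : LipOn L fun s => ∫ t in 0..s, f t := by
  have hI := hf.intervalIntegrable hL
  obtain ⟨-, C, hC⟩ := hf
  refine LipOn.of_abs_le (K := C) fun x hx y hy => ?_
  have hsub : ∀ z ∈ Icc 0 L, IntervalIntegrable f volume 0 z := fun z hz =>
    hI.mono_set (by rw [uIcc_of_le hz.1, uIcc_of_le hL]; exact Icc_subset_Icc_right hz.2)
  rw [intervalIntegral.integral_interval_sub_left (hsub x hx) (hsub y hy)]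
  rw [← Real.norm_eq_abs]
  refine intervalIntegral.norm_integral_le_of_norm_le_const_ae ?_
  filter_upwards [Measure.ae_ne volume L] with s hs hs'
  have h1 : s ∈ Ioc 0 L := by
    rcases le_total y x with h | h
    · rw [uIoc_of_le h] at hs'
      exact ⟨hy.1.trans_lt hs'.1, hs'.2.trans hx.2⟩
    · rw [uIoc_of_ge h] at hs'
      exact ⟨hx.1.trans_lt hs'.1, hs'.2.trans hy.2⟩
  exact hC s ⟨h1.1, lt_of_le_of_ne h1.2 hs⟩

lemma ae_deriv_primitive (hL : 0 ≤ L) (hf : BddMeas L f) :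
    ∀ᵐ s, s ∈ Ioo 0 L → _root_.deriv (fun s => ∫ t in 0..s, f t) s = f s := by
  filter_upwards [(hf.intervalIntegrable hL).ae_hasDerivAt_integral] with s hs hs'
  refine (hs ?_ 0 ?_).deriv
  · rw [uIcc_of_le hL]; exact Ioo_subset_Icc_self hs'
  · rw [uIcc_of_le hL]; exact left_mem_Icc.2 hL

/-- A nonnegative function with nonpositive integral vanishes a.e. -/
lemma ae_eq_zero_of_integral_le (hL : 0 ≤ L) (hf : BddMeas L f)
    (h0 : ∀ᵐ s, s ∈ Ioo 0 L → 0 ≤ f s) (hI : ∫ s in 0..L, f s ≤ 0) :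
    ∀ᵐ s, s ∈ Ioo 0 L → f s = 0 := by
  have h0' : 0 ≤ᵐ[volume.restrict (Ioc 0 L)] f := by
    rw [EventuallyLE, ae_restrict_iff' measurableSet_Ioc]
    exact ae_Ioc_of_ae_Ioo h0
  have h1 : ∫ s in 0..L, f s = 0 :=
    hI.antisymm (intervalIntegral.integral_nonneg_of_ae_restrict hL (by
      rw [EventuallyLE, ae_restrict_iff' measurableSet_Icc]
      filter_upwards [h0, Measure.ae_ne volume 0, Measure.ae_ne volume L] with s hs h0 hL' hs'
      exact hs ⟨lt_of_le_of_ne hs'.1 h0.symm, lt_of_le_of_ne hs'.2 hL'⟩))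
  rw [intervalIntegral.integral_eq_zero_iff_of_le_of_nonneg_ae hL h0'
    (hf.intervalIntegrable hL), EventuallyEq, ae_restrict_iff' measurableSet_Ioc] at h1
  filter_upwards [h1] with s hs hs'
  exact hs (Ioo_subset_Ioc_self hs')

end BddMeas

lemma LipOn.eq_of_ae_deriv_eq {L : ℝ} {f g : ℝ → ℝ} (hf : LipOn L f)
    (hg : LipOn L g) (h0 : f 0 = g 0) (h : ∀ᵐ s, s ∈ Ioo 0 L → deriv f s = deriv g s) :
    ∀ s ∈ Icc 0 L, f s = g s := by
  intro s hs
  have h0' : (0 : ℝ) ∈ Icc 0 L := left_mem_Icc.2 (hs.1.trans hs.2)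
  have e := integral_congr_Ioo hs.1 (f := deriv f) (g := deriv g) (by
    filter_upwards [h] with t ht ht'
    exact ht ⟨ht'.1, ht'.2.trans_le hs.2⟩)
  rw [hf.integral_deriv h0' hs, hg.integral_deriv h0' hs] at e
  linarith

namespace IsMinProfile

variable {G : ℝ → ℝ} {L : ℝ} {r ψ : ℝ → ℝ}

lemma continuousOn_warp (hG : IsWarping G) (h : IsMinProfile G L r ψ) :
    ContinuousOn (fun s => G (r s)) (Icc 0 L) :=
  hG.continuousOn.comp h.lip_r.continuousOn h.pos

lemma continuousOn_inv_sq (hG : IsWarping G) (h : IsMinProfile G L r ψ) :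
    ContinuousOn (fun s => (G (r s) ^ 2)⁻¹) (Icc 0 L) :=
  ((h.continuousOn_warp hG).pow 2).inv₀ fun s hs => (pow_pos (hG.1 _ (h.pos s hs)) 2).ne'

/-- Clairaut's relation. -/
lemma clairaut (hG : IsWarping G) (hL : 0 < L) (h : IsMinProfile G L r ψ) :
    ∃ c, ∀ s ∈ Icc 0 L, ψ s = ψ 0 + c * ∫ t in 0..s, (G (r t) ^ 2)⁻¹ := by
  have hg : BddMeas L fun s => G (r s) ^ 2 * deriv ψ s :=
    (BddMeas.of_continuousOn ((h.continuousOn_warp hG).pow 2)).mul (BddMeas.deriv h.lip_ψ)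
  set c := (∫ s in 0..L, G (r s) ^ 2 * deriv ψ s) / L with hc
  have hgc := hg.sub (BddMeas.const c)
  have hgc0 : ∫ s in 0..L, (G (r s) ^ 2 * deriv ψ s - c) = 0 := by
    rw [intervalIntegral.integral_sub (hg.intervalIntegrable hL.le) intervalIntegrable_const]
    simp only [intervalIntegral.integral_const, sub_zero, smul_eq_mul, hc]
    field_simp
    ring
  have hV := h.first_variation hG hL (LipOn.const 0) (hgc.lipOn_primitive hL.le) rfl rfl
    (by simp) hgc0
  have hsq : ∫ s in 0..L, (G (r s) ^ 2 * deriv ψ s - c) ^ 2 = 0 := by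
    have e : ∫ s in 0..L, (G (r s) ^ 2 * deriv ψ s - c) ^ 2 =
        (∫ s in 0..L, (deriv r s * deriv (fun _ => (0 : ℝ)) s +
        G (r s) * deriv G (r s) * deriv ψ s ^ 2 * 0 + G (r s) ^ 2 * (deriv ψ s *
          deriv (fun s => ∫ t in 0..s, (G (r t) ^ 2 * deriv ψ t - c)) s))) -
        ∫ s in 0..L, c * (G (r s) ^ 2 * deriv ψ s - c) := by
      rw [← intervalIntegral.integral_sub]
      · refine integral_congr_Ioo hL.le ?_
        filter_upwards [hgc.ae_deriv_primitive hL.le] with s hs hs'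
        rw [hs hs']
        simp
        ring
      · refine BddMeas.intervalIntegrable hL.le ?_
        simp only [deriv_const, mul_zero, zero_add]
        exact (BddMeas.of_continuousOn ((h.continuousOn_warp hG).pow 2)).mul
          ((BddMeas.deriv h.lip_ψ).mul (BddMeas.deriv (hgc.lipOn_primitive hL.le)))
      · exact ((BddMeas.const c).mul hgc).intervalIntegrable hL.le
    rw [e, hV, intervalIntegral.integral_const_mul, hgc0]
    simp
  have hae := (hgc.mul hgc).ae_eq_zero_of_integral_le hL.le
    (Eventually.of_forall fun s _ => mul_self_nonneg _)
    (le_of_eq (by simpa only [sq] using hsq))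
  have hinv := (BddMeas.const c).mul (BddMeas.of_continuousOn (h.continuousOn_inv_sq hG))
  refine ⟨c, fun s hs => ?_⟩
  have := h.lip_ψ.eq_of_ae_deriv_eq ((LipOn.const (ψ 0)).add
    (hinv.lipOn_primitive hL.le)) (by simp) (by
    filter_upwards [hae, hinv.ae_deriv_primitive hL.le,
      (hinv.lipOn_primitive hL.le).ae_differentiableAt] with s h1 h2 h3 hs
    rw [((h3 hs).hasDerivAt.const_add (ψ 0)).deriv, h2 hs]
    have := mul_self_eq_zero.1 (h1 hs)
    have hpos := pow_pos (hG.1 _ (h.pos s (Ioo_subset_Icc_self hs))) 2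
    rw [← div_eq_mul_inv, eq_div_iff hpos.ne']
    linarith) s hs
  rw [this, intervalIntegral.integral_const_mul]

lemma strictMonoOn_integral (hG : IsWarping G) (h : IsMinProfile G L r ψ) :
    StrictMonoOn (fun s => ∫ t in 0..s, (G (r t) ^ 2)⁻¹) (Icc 0 L) := by
  intro s hs t ht hst
  have hI : ∀ z ∈ Icc 0 L, IntervalIntegrable (fun t => (G (r t) ^ 2)⁻¹) volume 0 z := fun z hz =>
    ((h.continuousOn_inv_sq hG).mono (Icc_subset_Icc_right hz.2)).intervalIntegrable_of_Icc hz.1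
  have : 0 < ∫ u in s..t, (G (r u) ^ 2)⁻¹ := by
    refine intervalIntegral.intervalIntegral_pos_of_pos_on
      (((h.continuousOn_inv_sq hG).mono
        (Icc_subset_Icc hs.1 ht.2)).intervalIntegrable_of_Icc hst.le)
      (fun u hu => ?_) hst
    exact inv_pos.2 (pow_pos (hG.1 _ (h.pos u ⟨hs.1.trans hu.1.le, hu.2.le.trans ht.2⟩)) 2)
  rw [← intervalIntegral.integral_interval_sub_left (hI t ht) (hI s hs)] at this
  simpa using this

lemma strictMonoOn_angle (hG : IsWarping G) (hL : 0 < L) (h : IsMinProfile G L r ψ)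
    (hψ : ψ 0 < ψ L) : StrictMonoOn ψ (Icc 0 L) := by
  obtain ⟨c, hc⟩ := h.clairaut hG hL
  have hm := h.strictMonoOn_integral hG
  have h0 := left_mem_Icc.2 hL.le
  have hL' := right_mem_Icc.2 hL.le
  have hc0 : 0 < c := by
    have e := hc L hL'
    have := hm h0 hL' hL
    simp only [intervalIntegral.integral_same] at this
    by_contra hc0
    nlinarith
  intro s hs t ht hst
  rw [hc s hs, hc t ht]
  have := mul_lt_mul_of_pos_left (hm hs ht hst) hc0
  simpa using this

/-- The squared radius is at least as convex as in Euclidean space. -/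
lemma stewart (hG : IsWarping G) (hN : NonposCurvWarping G) (h : IsMinProfile G L r ψ) {s : ℝ}
    (hs : s ∈ Ioo 0 L) :
    L * r s ^ 2 ≤ (L - s) * r 0 ^ 2 + s * r L ^ 2 - s * (L - s) * L := by
  have hL : 0 < L := hs.1.trans hs.2
  obtain ⟨hs0, hsL⟩ := hs
  set η : ℝ → ℝ := fun t => if t ≤ s then (L - s) * t else s * (L - t) with hη
  have hηmin : ∀ t, η t = min ((L - s) * t) (s * (L - t)) := by
    intro t
    by_cases ht : t ≤ s
    · simp only [hη, if_pos ht]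
      rw [min_eq_left]; nlinarith
    · simp only [hη, if_neg ht]
      rw [min_eq_right]; push Not at ht; nlinarith
  have hη_lip : LipOn L η := by
    refine LipOn.of_abs_le (K := L) fun x _ y _ => ?_
    rw [hηmin, hηmin]
    refine (abs_min_sub_min_le_max _ _ _ _).trans (max_le ?_ ?_)
    · rw [← mul_sub, abs_mul, abs_of_pos (sub_pos.2 hsL)]
      gcongr; linarith
    · rw [← mul_sub, abs_mul, abs_of_pos hs0, show L - x - (L - y) = -(x - y) by ring, abs_neg]
      gcongr
  have hη_nonneg : ∀ t ∈ Icc 0 L, 0 ≤ η t := by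
    intro t ht
    rw [hηmin]
    exact le_min (mul_nonneg (by linarith) ht.1) (mul_nonneg hs0.le (by linarith [ht.2]))
  have hd1 : ∀ t ∈ Ioo 0 s, deriv η t = L - s := by
    intro t ht
    have : η =ᶠ[nhds t] fun t => (L - s) * t := by
      filter_upwards [Iio_mem_nhds ht.2] with u hu
      simp only [hη, if_pos (le_of_lt (show u < s from hu))]
    rw [this.deriv_eq]
    simp
  have hd2 : ∀ t ∈ Ioo s L, deriv η t = -s := by
    intro t ht
    have : η =ᶠ[nhds t] fun t => s * (L - t) := by
      filter_upwards [Ioi_mem_nhds ht.1] with u hu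
      simp only [hη, if_neg (not_le.2 (show s < u from hu))]
    rw [this.deriv_eq]
    simp
  have hη0 : η 0 = 0 := by simp [hη, hs0.le]
  have hηL : η L = 0 := by simp [hη, hsL]
  have hV := h.first_variation hG hL (h.lip_r.mul hη_lip) (LipOn.const 0) (by simp [hη0])
    (by simp [hηL]) rfl rfl
  have hf : LipOn L fun t => r t * r t := h.lip_r.mul h.lip_r
  have hmain : ∫ t in 0..L, (η t + 1 / 2 * (deriv (fun t => r t * r t) t * deriv η t)) ≤ 0 := by
    refine le_of_le_of_eq ?_ hV
    have hB1 : BddMeas L fun t => η t + 1 / 2 * (deriv (fun t => r t * r t) t * deriv η t) :=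
      (BddMeas.of_continuousOn hη_lip.continuousOn).add
        ((BddMeas.const _).mul ((BddMeas.deriv hf).mul (BddMeas.deriv hη_lip)))
    have hB2 : BddMeas L fun t => deriv r t * deriv (fun t => r t * η t) t +
        G (r t) * deriv G (r t) * deriv ψ t ^ 2 * (r t * η t) +
        G (r t) ^ 2 * (deriv ψ t * deriv (fun _ => (0 : ℝ)) t) := by
      have hG' : BddMeas L fun t => deriv G (r t) :=
        BddMeas.of_continuousOn (hG.continuousOn_deriv.comp h.lip_r.continuousOn h.pos)
      have hG0 := BddMeas.of_continuousOn (h.continuousOn_warp hG)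
      have hψ' := BddMeas.deriv h.lip_ψ
      have hζ := h.lip_r.mul hη_lip
      simp only [sq]
      exact (((BddMeas.deriv h.lip_r).mul (BddMeas.deriv hζ)).add
        (((hG0.mul hG').mul (hψ'.mul hψ')).mul (BddMeas.of_continuousOn hζ.continuousOn))).add
        ((hG0.mul hG0).mul (hψ'.mul (BddMeas.deriv (LipOn.const 0))))
    refine intervalIntegral.integral_mono_ae_restrict hL.le (hB1.intervalIntegrable hL.le)
      (hB2.intervalIntegrable hL.le) ?_
    rw [EventuallyLE, ae_restrict_iff' measurableSet_Icc]
    filter_upwards [h.speed_eq hG hL, h.lip_r.ae_differentiableAt, hη_lip.ae_differentiableAt,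
      Measure.ae_ne volume 0, Measure.ae_ne volume L] with t h1 h2 h3 h4 h5 ht
    have ht' : t ∈ Ioo 0 L := ⟨lt_of_le_of_ne ht.1 h4.symm, lt_of_le_of_ne ht.2 h5⟩
    have a1 := ((h2 ht').hasDerivAt.fun_mul (h2 ht').hasDerivAt).deriv
    have a2 := ((h2 ht').hasDerivAt.fun_mul (h3 ht').hasDerivAt).deriv
    rw [a1, a2]
    have hr := h.pos t ht
    have hGr := hG.1 _ hr
    have hle := NonposCurvWarping.le_mul_deriv hG hN hr
    have hsp := h1 ht'
    have hη' := hη_nonneg t ht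
    have key : G (r t) ^ 2 * deriv ψ t ^ 2 ≤ G (r t) * deriv G (r t) * deriv ψ t ^ 2 * r t := by
      have : 0 ≤ (G (r t) * deriv ψ t ^ 2) * (r t * deriv G (r t) - G (r t)) :=
        mul_nonneg (by positivity) (by linarith)
      linarith
    have key2 := mul_le_mul_of_nonneg_right key hη'
    simp only [deriv_const]
    have : G (r t) ^ 2 * deriv ψ t ^ 2 = 1 - deriv r t ^ 2 := by linarith
    rw [this] at key2
    linarith
  have hsI : s ∈ Icc 0 L := ⟨hs0.le, hsL.le⟩
  have h0I : (0 : ℝ) ∈ Icc 0 L := left_mem_Icc.2 hL.le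
  have hLI : L ∈ Icc 0 L := right_mem_Icc.2 hL.le
  have hη_int : IntervalIntegrable η volume 0 L :=
    (BddMeas.of_continuousOn hη_lip.continuousOn).intervalIntegrable hL.le
  have hp_int : IntervalIntegrable (fun t => deriv (fun t => r t * r t) t * deriv η t) volume 0 L :=
    ((BddMeas.deriv hf).mul (BddMeas.deriv hη_lip)).intervalIntegrable hL.le
  have hm1 : uIcc 0 s ⊆ uIcc 0 L := by
    rw [uIcc_of_le hs0.le, uIcc_of_le hL.le]; exact Icc_subset_Icc_right hsL.le
  have hm2 : uIcc s L ⊆ uIcc 0 L := by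
    rw [uIcc_of_le hsL.le, uIcc_of_le hL.le]; exact Icc_subset_Icc_left hs0.le
  rw [intervalIntegral.integral_add hη_int (hp_int.const_mul _),
    intervalIntegral.integral_const_mul,
    ← intervalIntegral.integral_add_adjacent_intervals (hη_int.mono_set hm1) (hη_int.mono_set hm2),
    ← intervalIntegral.integral_add_adjacent_intervals (hp_int.mono_set hm1)
      (hp_int.mono_set hm2)] at hmain
  have i1 : ∫ t in 0..s, η t = (L - s) * (s ^ 2 / 2) := by
    rw [intervalIntegral.integral_congr (g := fun t => (L - s) * t)]
    · rw [intervalIntegral.integral_const_mul, integral_id]; ring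
    · intro t ht
      rw [uIcc_of_le hs0.le] at ht
      simp [hη, ht.2]
  have i2 : ∫ t in s..L, η t = s * ((L - s) ^ 2 / 2) := by
    rw [intervalIntegral.integral_congr (g := fun t => s * (L - t))]
    · rw [intervalIntegral.integral_const_mul, intervalIntegral.integral_sub
        intervalIntegrable_const intervalIntegral.intervalIntegrable_id, integral_id,
        intervalIntegral.integral_const, smul_eq_mul]
      ring
    · intro t ht
      rw [uIcc_of_le hsL.le] at ht
      rcases ht.1.eq_or_lt with rfl | hlt
      · simp [hη]; ring
      · simp [hη, hlt]
  have i3 : ∫ t in 0..s, deriv (fun t => r t * r t) t * deriv η t =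
      (L - s) * (r s * r s - r 0 * r 0) := by
    rw [integral_congr_Ioo hs0.le (g := fun t => (L - s) * deriv (fun t => r t * r t) t),
      intervalIntegral.integral_const_mul, hf.integral_deriv h0I hsI]
    exact Eventually.of_forall fun t ht => by rw [hd1 t ht]; ring
  have i4 : ∫ t in s..L, deriv (fun t => r t * r t) t * deriv η t =
      -s * (r L * r L - r s * r s) := by
    rw [intervalIntegral.integral_congr_ae (g := fun t => -s * deriv (fun t => r t * r t) t),
      intervalIntegral.integral_const_mul, hf.integral_deriv hsI hLI]
    rw [uIoc_of_le hsL.le]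
    filter_upwards [Measure.ae_ne volume L] with t htL ht
    rw [hd2 t ⟨ht.1, lt_of_le_of_ne ht.2 htL⟩]; ring
  rw [i1, i2, i3, i4] at hmain
  nlinarith

end IsMinProfile

/-- An antiderivative of the warping function. -/
lemma IsWarping.hasDerivAt_primitive {G : ℝ → ℝ} (hG : IsWarping G) {x : ℝ} (hx : 0 < x) :
    HasDerivAt (fun y => ∫ t in 1..y, G t) (G x) x := by
  have hsub : uIcc 1 x ⊆ Ioi 0 := fun y hy => (lt_min one_pos hx).trans_le hy.1
  exact intervalIntegral.integral_hasDerivAt_right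
    (hG.continuousOn.mono hsub).intervalIntegrable
    (hG.continuousOn.stronglyMeasurableAtFilter isOpen_Ioi x hx)
    (hG.continuousOn.continuousAt (Ioi_mem_nhds hx))

namespace IsMinProfile

variable {G : ℝ → ℝ} {L : ℝ} {r ψ : ℝ → ℝ}

/-- The radial Euler-Lagrange equation, in weak form. -/
lemma radial_euler_lagrange (hG : IsWarping G) (hL : 0 < L) (h : IsMinProfile G L r ψ) {η : ℝ → ℝ}
    (hη : LipOn L η) (hη0 : η 0 = 0) (hηL : η L = 0) :
    ∫ s in 0..L, (G (r s) * deriv r s * deriv η s + deriv G (r s) * η s) = 0 := by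
  have hGr : LipOn L fun s => G (r s) :=
    h.lip_r.comp_pos (fun x hx => hG.hasDerivAt hx) hG.continuousOn_deriv h.pos
  have hV := h.first_variation hG hL (hGr.mul hη) (LipOn.const 0) (by simp [hη0])
    (by simp [hηL]) rfl rfl
  refine Eq.trans (integral_congr_Ioo hL.le ?_) hV
  filter_upwards [h.speed_eq hG hL, h.lip_r.ae_differentiableAt, hη.ae_differentiableAt]
    with t h1 h2 h3 ht
  have a1 := (hG.hasDerivAt (h.pos t (Ioo_subset_Icc_self ht))).comp t (h2 ht).hasDerivAt
  have a2 := (a1.fun_mul (h3 ht).hasDerivAt).deriv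
  simp only [Function.comp_def] at a2
  rw [a2]
  simp only [deriv_const]
  linear_combination (- deriv G (r t) * η t) * (h1 ht)

lemma eqOn_radius (hG : IsWarping G) (hN : NonposCurvWarping G) (hL : 0 < L) {r' ψ' : ℝ → ℝ}
    (h : IsMinProfile G L r ψ) (h' : IsMinProfile G L r' ψ') (h0 : r 0 = r' 0) (h1 : r L = r' L) :
    ∀ s ∈ Icc 0 L, r s = r' s := by
  set V : ℝ → ℝ := fun y => ∫ t in 1..y, G t with hV
  have hVd : ∀ x, 0 < x → HasDerivAt V (G x) x := fun x hx => hG.hasDerivAt_primitive hx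
  have hw := h.lip_r.comp_pos hVd hG.continuousOn h.pos
  have hw' := h'.lip_r.comp_pos hVd hG.continuousOn h'.pos
  have hη := hw.sub hw'
  set η : ℝ → ℝ := fun s => V (r s) - V (r' s) with hηdef
  have hη0 : η 0 = 0 := by simp [hηdef, h0]
  have hηL : η L = 0 := by simp [hηdef, h1]
  have e := h.radial_euler_lagrange hG hL hη hη0 hηL
  have e' := h'.radial_euler_lagrange hG hL hη hη0 hηL
  have hVmono : StrictMonoOn V (Ioi 0) := by
    refine strictMonoOn_of_deriv_pos (convex_Ioi 0)
      (fun x hx => (hVd x hx).continuousAt.continuousWithinAt) ?_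
    rw [interior_Ioi]
    intro x hx
    rw [(hVd x hx).deriv]
    exact hG.1 x hx
  have hb : ∀ {r ψ : ℝ → ℝ}, IsMinProfile G L r ψ → BddMeas L fun s =>
      G (r s) * deriv r s * deriv η s + deriv G (r s) * η s := fun h =>
    (((BddMeas.of_continuousOn (h.continuousOn_warp hG)).mul (BddMeas.deriv h.lip_r)).mul
      (BddMeas.deriv hη)).add ((BddMeas.of_continuousOn
        (hG.continuousOn_deriv.comp h.lip_r.continuousOn h.pos)).mul
          (BddMeas.of_continuousOn hη.continuousOn))
  have hdη : ∀ᵐ s, s ∈ Ioo 0 L → deriv η s = G (r s) * deriv r s - G (r' s) * deriv r' s := by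
    filter_upwards [h.lip_r.ae_differentiableAt, h'.lip_r.ae_differentiableAt] with t d1 d2 ht
    exact (((hVd _ (h.pos t (Ioo_subset_Icc_self ht))).comp t (d1 ht).hasDerivAt).fun_sub
      ((hVd _ (h'.pos t (Ioo_subset_Icc_self ht))).comp t (d2 ht).hasDerivAt)).deriv
  have hmono : ∀ s ∈ Icc 0 L, 0 ≤ (deriv G (r s) - deriv G (r' s)) * η s := by
    intro s hs
    have hr := h.pos s hs
    have hr' := h'.pos s hs
    have hm := NonposCurvWarping.monotoneOn_deriv hG hN
    rcases le_total (r s) (r' s) with hle | hle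
    · exact mul_nonneg_of_nonpos_of_nonpos (by linarith [hm hr hr' hle])
        (by simp only [hηdef]; linarith [hVmono.monotoneOn hr hr' hle])
    · exact mul_nonneg (by linarith [hm hr' hr hle])
        (by simp only [hηdef]; linarith [hVmono.monotoneOn hr' hr hle])
  have hsq : ∫ s in 0..L, deriv η s * deriv η s ≤ 0 := by
    have : ∫ s in 0..L, ((G (r s) * deriv r s * deriv η s + deriv G (r s) * η s) -
        (G (r' s) * deriv r' s * deriv η s + deriv G (r' s) * η s)) = 0 := by
      rw [intervalIntegral.integral_sub ((hb h).intervalIntegrable hL.le)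
        ((hb h').intervalIntegrable hL.le), e, e', sub_zero]
    refine le_of_le_of_eq ?_ this
    refine intervalIntegral.integral_mono_ae_restrict hL.le
      (((BddMeas.deriv hη).mul (BddMeas.deriv hη)).intervalIntegrable hL.le)
      (((hb h).sub (hb h')).intervalIntegrable hL.le) ?_
    rw [EventuallyLE, ae_restrict_iff' measurableSet_Icc]
    filter_upwards [hdη, Measure.ae_ne volume 0, Measure.ae_ne volume L] with t h1 h4 h5 ht
    have ht' : t ∈ Ioo 0 L := ⟨lt_of_le_of_ne ht.1 h4.symm, lt_of_le_of_ne ht.2 h5⟩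
    have := hmono t ht
    have e2 : deriv η t * deriv η t = G (r t) * deriv r t * deriv η t -
      G (r' t) * deriv r' t * deriv η t := by nth_rw 1 [h1 ht']; ring
    linarith
  have hae := ((BddMeas.deriv hη).mul (BddMeas.deriv hη)).ae_eq_zero_of_integral_le hL.le
    (Eventually.of_forall fun s _ => mul_self_nonneg _) hsq
  intro s hs
  have hη_zero := hη.eq_of_ae_deriv_eq (LipOn.const 0) hη0 (by
    filter_upwards [hae] with s hs hs'
    simpa using hs hs') s hs
  exact hVmono.injOn (h.pos s hs) (h'.pos s hs) (sub_eq_zero.1 hη_zero)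

lemma eqOn_angle (hG : IsWarping G) (hN : NonposCurvWarping G) (hL : 0 < L) {r' ψ' : ℝ → ℝ}
    (h : IsMinProfile G L r ψ) (h' : IsMinProfile G L r' ψ') (h0 : r 0 = r' 0) (h1 : r L = r' L)
    (h2 : ψ 0 = ψ' 0) (h3 : ψ L = ψ' L) :
    ∀ s ∈ Icc 0 L, ψ s = ψ' s := by
  have hr := h.eqOn_radius hG hN hL h' h0 h1
  obtain ⟨c, hc⟩ := h.clairaut hG hL
  obtain ⟨c', hc'⟩ := h'.clairaut hG hL
  have hint : ∀ s ∈ Icc 0 L,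
      ∫ t in 0..s, (G (r t) ^ 2)⁻¹ = ∫ t in 0..s, (G (r' t) ^ 2)⁻¹ := by
    intro s hs
    refine intervalIntegral.integral_congr fun t ht => ?_
    rw [uIcc_of_le hs.1] at ht
    simp only [hr t ⟨ht.1, ht.2.trans hs.2⟩]
  have hLI : L ∈ Icc 0 L := right_mem_Icc.2 hL.le
  have hpos := h.strictMonoOn_integral hG (left_mem_Icc.2 hL.le) hLI hL
  simp only [intervalIntegral.integral_same] at hpos
  have e := hc L hLI
  have e' := hc' L hLI
  rw [← hint L hLI] at e'
  have hcc : c = c' := by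
    refine mul_right_cancel₀ hpos.ne' ?_
    linarith
  intro s hs
  rw [hc s hs, hc' s hs, hint s hs, h2, hcc]

end IsMinProfile

/-! ### The warped metric in the chart -/

section WarpNorm

variable {n : ℕ} {G : ℝ → ℝ}

lemma sq_inner_unit_le (x v : Euc n) : ⟪v, ‖x‖⁻¹ • x⟫ ^ 2 ≤ ‖v‖ ^ 2 := by
  have h1 : ‖‖x‖⁻¹ • x‖ ≤ 1 := by
    rw [norm_smul, norm_inv, norm_norm]
    exact inv_mul_le_one
  rw [← sq_abs]
  refine pow_le_pow_left₀ (abs_nonneg _) ((abs_real_inner_le_norm _ _).trans ?_) 2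
  exact mul_le_of_le_one_right (norm_nonneg _) h1

lemma norm_le_warpNorm (hG : IsWarping G) (hN : NonposCurvWarping G) (x v : Euc n) :
    ‖v‖ ≤ warpNorm G x v := by
  unfold warpNorm
  split_ifs with hx
  · exact le_rfl
  · refine Real.le_sqrt_of_sq_le ?_
    have hx0 := norm_pos_iff.2 hx
    have h1 : 1 ≤ G ‖x‖ / ‖x‖ := (one_le_div hx0).2 (NonposCurvWarping.le_apply hG hN hx0)
    have h2 : 1 ≤ (G ‖x‖ / ‖x‖) ^ 2 := one_le_pow₀ h1
    nlinarith [sq_inner_unit_le x v]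

lemma warpNorm_le_mul (hG : IsWarping G) (hN : NonposCurvWarping G) {x v : Euc n} {C : ℝ}
    (hC : 1 ≤ C) (h : x ≠ 0 → G ‖x‖ / ‖x‖ ≤ C) : warpNorm G x v ≤ C * ‖v‖ := by
  unfold warpNorm
  split_ifs with hx
  · nlinarith [norm_nonneg v]
  · refine Real.sqrt_le_iff.2 ⟨by positivity, ?_⟩
    have hx0 := norm_pos_iff.2 hx
    have h1 : 1 ≤ G ‖x‖ / ‖x‖ := (one_le_div hx0).2 (NonposCurvWarping.le_apply hG hN hx0)
    have h2 : (G ‖x‖ / ‖x‖) ^ 2 ≤ C ^ 2 := pow_le_pow_left₀ (by linarith) (h hx) 2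
    have h3 : 1 ≤ C ^ 2 := one_le_pow₀ hC
    rw [mul_pow]
    nlinarith [sq_inner_unit_le x v, sq_nonneg ⟪v, ‖x‖⁻¹ • x⟫]

lemma warpNorm_radial {θ : Euc n} (hθ : ‖θ‖ = 1) (s : ℝ) : warpNorm G (s • θ) θ = 1 := by
  unfold warpNorm
  split_ifs with hx
  · exact hθ
  · have hs : s ≠ 0 := fun h => hx (by simp [h])
    have h1 : ⟪θ, ‖s • θ‖⁻¹ • s • θ⟫ ^ 2 = 1 := by
      rw [inner_smul_right, inner_smul_right, real_inner_self_eq_norm_sq, norm_smul, hθ]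
      rw [Real.norm_eq_abs, mul_one, one_pow, mul_one, mul_pow, inv_pow, sq_abs]
      exact inv_mul_cancel₀ (pow_ne_zero 2 hs)
    rw [h1, hθ]
    simp

end WarpNorm

section Chart

variable {n : ℕ} {p : M} {G : ℝ → ℝ} {Φ : Euc n ≃ M}

lemma lipschitz_ae_differentiableAt {c : ℝ → Euc n} {K : ℝ≥0} {T : ℝ}
    (hc : LipschitzOnWith K c (Icc 0 T)) :
    ∀ᵐ t, t ∈ Ioo 0 T → DifferentiableAt ℝ c t := by
  filter_upwards [hc.ae_differentiableWithinAt_of_mem_real] with t ht ht'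
  exact (ht (Ioo_subset_Icc_self ht')).differentiableAt (Icc_mem_nhds ht'.1 ht'.2)

lemma IsSphericallySymmetric.dist_le_warpLength (hS : IsSphericallySymmetric p G Φ)
    {c : ℝ → Euc n} {K : ℝ≥0} {T : ℝ} (hT : 0 ≤ T) (hc : LipschitzOnWith K c (Icc 0 T)) :
    ENNReal.ofReal (dist (Φ (c 0)) (Φ (c T))) ≤ warpLength G c T := by
  rw [hS.2.2.2]
  exact sInf_le ⟨T, c, hT, rfl, rfl, ⟨K, hc⟩, rfl⟩

/-- Length bound on a subinterval. -/
lemma IsSphericallySymmetric.dist_le_arc (hS : IsSphericallySymmetric p G Φ)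
    {c : ℝ → Euc n} {K : ℝ≥0} {T : ℝ} (hc : LipschitzOnWith K c (Icc 0 T)) {a b : ℝ}
    (ha : 0 ≤ a) (hab : a ≤ b) (hb : b ≤ T) :
    ENNReal.ofReal (dist (Φ (c a)) (Φ (c b))) ≤
      ∫⁻ t in Icc a b, ENNReal.ofReal (warpNorm G (c t) (deriv c t)) := by
  have hsub : MapsTo (fun t => a + t) (Icc 0 (b - a)) (Icc 0 T) := fun t ht =>
    ⟨by linarith [ht.1], by linarith [ht.2]⟩
  have hl : LipschitzOnWith K (fun t => c (a + t)) (Icc 0 (b - a)) := by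
    have h1 : LipschitzOnWith 1 (fun t => a + t) (Icc 0 (b - a)) :=
      LipschitzOnWith.of_dist_le_mul fun x _ y _ => by simp
    simpa [Function.comp_def] using hc.comp h1 hsub
  have := hS.dist_le_warpLength (sub_nonneg.2 hab) hl
  simp only [add_zero, add_sub_cancel] at this
  refine this.trans_eq ?_
  unfold warpLength
  simp only [deriv_comp_const_add]
  have hpre : Icc 0 (b - a) = (fun t => a + t) ⁻¹' Icc a b := by
    rw [preimage_const_add_Icc, sub_self]
  rw [hpre]
  exact (measurePreserving_add_left volume a).setLIntegral_comp_preimage_emb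
    (measurableEmbedding_addLeft a) (fun t => ENNReal.ofReal (warpNorm G (c t) (deriv c t))) _

lemma IsSphericallySymmetric.exists_curve (hS : IsSphericallySymmetric p G Φ) (x y : Euc n)
    {D : ℝ} (hD : dist (Φ x) (Φ y) < D) :
    ∃ (T : ℝ) (c : ℝ → Euc n) (K : ℝ≥0), 0 ≤ T ∧ c 0 = x ∧ c T = y ∧
      LipschitzOnWith K c (Icc 0 T) ∧ warpLength G c T < ENNReal.ofReal D := by
  have h : ENNReal.ofReal (dist (Φ x) (Φ y)) < ENNReal.ofReal D :=
    (ENNReal.ofReal_lt_ofReal_iff (dist_nonneg.trans_lt hD)).2 hD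
  rw [hS.2.2.2, sInf_lt_iff] at h
  obtain ⟨_, ⟨T, c, hT, h0, h1, ⟨K, hK⟩, rfl⟩, hlt⟩ := h
  exact ⟨T, c, K, hT, h0, h1, hK, hlt⟩

/-- A real function calibrated by a curve. -/
lemma le_warpLength_of_deriv_le {c : ℝ → Euc n} {T : ℝ} (hT : 0 ≤ T) {F : ℝ → ℝ} (hF : LipOn T F)
    (h : ∀ᵐ t, t ∈ Ioo 0 T → |deriv F t| ≤ warpNorm G (c t) (deriv c t)) :
    ENNReal.ofReal (F T - F 0) ≤ warpLength G c T := by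
  rw [← hF.integral_deriv (left_mem_Icc.2 hT) (right_mem_Icc.2 hT),
    intervalIntegral.integral_of_le hT]
  calc ENNReal.ofReal (∫ t in Ioc 0 T, deriv F t)
      ≤ ‖∫ t in Ioc 0 T, deriv F t‖ₑ := by
        rw [← ofReal_norm]
        exact ENNReal.ofReal_le_ofReal (le_abs_self _)
    _ ≤ ∫⁻ t in Ioc 0 T, ‖deriv F t‖ₑ := enorm_integral_le_lintegral_enorm _
    _ ≤ ∫⁻ t in Ioc 0 T, ENNReal.ofReal (warpNorm G (c t) (deriv c t)) := by
        refine setLIntegral_mono_ae' measurableSet_Ioc ?_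
        filter_upwards [ae_Ioc_of_ae_Ioo h] with t ht ht'
        rw [← ofReal_norm]
        exact ENNReal.ofReal_le_ofReal (ht ht')
    _ ≤ warpLength G c T := lintegral_mono_set Ioc_subset_Icc_self

/-- The chart is distance nondecreasing. -/
lemma IsSphericallySymmetric.norm_sub_le_dist (hS : IsSphericallySymmetric p G Φ)
    (hN : NonposCurvWarping G) (x y : Euc n) : ‖x - y‖ ≤ dist (Φ x) (Φ y) := by
  refine le_of_forall_gt_imp_ge_of_dense fun D hD => ?_
  obtain ⟨T, c, K, hT, h0, h1, hc, hlt⟩ := hS.exists_curve x y hD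
  have hD0 : 0 < D := dist_nonneg.trans_lt hD
  rcases eq_or_ne x y with rfl | hxy
  · simpa using hD0.le
  set u : Euc n := ‖y - x‖⁻¹ • (y - x) with hu
  have hxy' : ‖y - x‖ ≠ 0 := norm_ne_zero_iff.2 (sub_ne_zero.2 hxy.symm)
  have hu1 : ‖u‖ = 1 := by rw [hu, norm_smul, norm_inv, norm_norm, inv_mul_cancel₀ hxy']
  have hF : LipOn T fun t => ⟪u, c t⟫ := by
    refine LipOn.of_abs_le (K := K) fun s hs t ht => ?_
    rw [← inner_sub_right]
    refine (abs_real_inner_le_norm _ _).trans ?_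
    rw [hu1, one_mul, ← dist_eq_norm, ← Real.dist_eq]
    exact hc.dist_le_mul s hs t ht
  have key := le_warpLength_of_deriv_le (G := G) hT hF (c := c) (by
    filter_upwards [lipschitz_ae_differentiableAt hc] with t ht ht'
    have := ((hasDerivAt_const t u).inner ℝ (ht ht').hasDerivAt).deriv
    rw [this]
    simp only [inner_zero_left, add_zero]
    refine (abs_real_inner_le_norm _ _).trans ?_
    rw [hu1, one_mul]
    exact norm_le_warpNorm hS.1 hN _ _)
  have := key.trans_lt hlt
  rw [ENNReal.ofReal_lt_ofReal_iff hD0, ← inner_sub_right, h0, h1, hu, real_inner_smul_left,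
    real_inner_self_eq_norm_sq, sq, inv_mul_cancel_left₀ hxy'] at this
  rw [norm_sub_rev]
  exact this.le

lemma IsSphericallySymmetric.dist_radial (hS : IsSphericallySymmetric p G Φ)
    (hN : NonposCurvWarping G) {θ : Euc n} (hθ : ‖θ‖ = 1) (r s : ℝ) :
    dist (Φ (r • θ)) (Φ (s • θ)) = |r - s| := by
  apply le_antisymm
  · wlog hrs : r ≤ s generalizing r s
    · rw [dist_comm, abs_sub_comm]
      exact this s r (le_of_not_ge hrs)
    have hc : LipschitzOnWith 1 (fun t : ℝ => (r + t) • θ) (Icc 0 (s - r)) :=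
      LipschitzOnWith.of_dist_le_mul fun x _ y _ => by
        rw [dist_eq_norm, ← sub_smul, norm_smul, hθ, add_sub_add_left_eq_sub, dist_eq_norm]
        simp
    have h := hS.dist_le_warpLength (sub_nonneg.2 hrs) hc
    have hd : ∀ t : ℝ, deriv (fun t : ℝ => (r + t) • θ) t = θ := fun t => by
      have := ((hasDerivAt_id t).const_add r).smul_const θ
      simpa using this.deriv
    unfold warpLength at h
    simp only [hd, warpNorm_radial hθ, ENNReal.ofReal_one, lintegral_const, one_mul, add_zero,
      add_sub_cancel, Measure.restrict_apply MeasurableSet.univ, univ_inter, Real.volume_Icc,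
      sub_zero] at h
    rw [abs_sub_comm, abs_of_nonneg (sub_nonneg.2 hrs)]
    exact (ENNReal.ofReal_le_ofReal_iff (sub_nonneg.2 hrs)).1 h
  · have := hS.norm_sub_le_dist hN (r • θ) (s • θ)
    rwa [← sub_smul, norm_smul, hθ, mul_one] at this

/-- Passing through the center is not minimizing unless the directions are opposite. -/
lemma IsSphericallySymmetric.dist_lt_add (hS : IsSphericallySymmetric p G Φ)
    (hN : NonposCurvWarping G) {x y : Euc n} (hx : x ≠ 0) (hy : y ≠ 0) (hxy : angle x y ≠ Real.pi) :
    dist (Φ x) (Φ y) < ‖x‖ + ‖y‖ := by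
  set u : Euc n := ‖x‖⁻¹ • x with hu
  set v : Euc n := ‖y‖⁻¹ • y with hv
  have hx0 := norm_pos_iff.2 hx
  have hy0 := norm_pos_iff.2 hy
  have hu1 : ‖u‖ = 1 := by rw [hu, norm_smul, norm_inv, norm_norm, inv_mul_cancel₀ hx0.ne']
  have hv1 : ‖v‖ = 1 := by rw [hv, norm_smul, norm_inv, norm_norm, inv_mul_cancel₀ hy0.ne']
  have hxu : x = ‖x‖ • u := by rw [hu, smul_inv_smul₀ hx0.ne']
  have hyv : y = ‖y‖ • v := by rw [hv, smul_inv_smul₀ hy0.ne']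
  have huv : ‖v - u‖ < 2 := by
    have h1 : angle u v = angle x y := by
      rw [hu, hv, angle_smul_left_of_pos _ _ (inv_pos.2 hx0),
        angle_smul_right_of_pos _ _ (inv_pos.2 hy0)]
    have h2 : -1 < ⟪u, v⟫ := by
      have h3 : Real.cos (angle u v) = ⟪u, v⟫ := by rw [cos_angle, hu1, hv1]; simp
      rw [← h3, ← Real.cos_pi]
      refine Real.cos_lt_cos_of_nonneg_of_le_pi (angle_nonneg _ _) le_rfl ?_
      rw [h1]
      exact lt_of_le_of_ne (angle_le_pi _ _) hxy
    have h4 := norm_sub_sq_real v u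
    rw [hu1, hv1, real_inner_comm] at h4
    nlinarith [norm_nonneg (v - u)]
  obtain ⟨C, hC1, hC2⟩ : ∃ C : ℝ, 1 < C ∧ C * ‖v - u‖ < 2 := by
    have hcont : Tendsto (fun C : ℝ => C * ‖v - u‖) (nhdsWithin 1 (Ioi 1)) (nhds (1 * ‖v - u‖)) :=
      ((continuous_id.mul continuous_const).tendsto 1).mono_left nhdsWithin_le_nhds
    rw [one_mul] at hcont
    obtain ⟨C, hC, hC'⟩ := ((hcont.eventually (gt_mem_nhds huv)).and self_mem_nhdsWithin).exists
    exact ⟨C, hC', hC⟩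
  obtain ⟨δ, hδ, hδC⟩ := mem_nhdsGT_iff_exists_Ioc_subset.1
    (hS.1.2.2.2.eventually (gt_mem_nhds hC1))
  set ρ : ℝ := min δ (min ‖x‖ ‖y‖) with hρ
  have hρ0 : 0 < ρ := lt_min hδ (lt_min hx0 hy0)
  have hρx : ρ ≤ ‖x‖ := (min_le_right _ _).trans (min_le_left _ _)
  have hρy : ρ ≤ ‖y‖ := (min_le_right _ _).trans (min_le_right _ _)
  have hmid : dist (Φ (ρ • u)) (Φ (ρ • v)) < 2 * ρ := by
    have hc : LipschitzOnWith (‖ρ • (v - u)‖₊) (fun t : ℝ => ρ • u + t • (ρ • (v - u))) (Icc 0 1) :=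
      LipschitzOnWith.of_dist_le_mul fun s _ t _ => by
        rw [dist_add_left, dist_eq_norm, ← sub_smul, norm_smul, mul_comm, dist_eq_norm]
        simp
    have h := hS.dist_le_warpLength zero_le_one hc
    have hd : ∀ t : ℝ, deriv (fun t : ℝ => ρ • u + t • (ρ • (v - u))) t = ρ • (v - u) := fun t => by
      have := (((hasDerivAt_id t).smul_const (ρ • (v - u))).const_add (ρ • u)).deriv
      simpa using this
    have hb : warpLength G (fun t : ℝ => ρ • u + t • (ρ • (v - u))) 1 ≤
        ENNReal.ofReal (C * ‖ρ • (v - u)‖) := by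
      unfold warpLength
      simp only [hd]
      calc _ ≤ ∫⁻ _ in Icc (0 : ℝ) 1, ENNReal.ofReal (C * ‖ρ • (v - u)‖) := by
            refine setLIntegral_mono' measurableSet_Icc fun t ht => ENNReal.ofReal_le_ofReal ?_
            refine warpNorm_le_mul hS.1 hN hC1.le fun hne => ?_
            refine le_of_lt (hδC ⟨norm_pos_iff.2 hne, ?_⟩)
            have : ρ • u + t • (ρ • (v - u)) = ρ • ((1 - t) • u + t • v) := by module
            rw [this, norm_smul, Real.norm_of_nonneg hρ0.le]
            have h1 : ‖(1 - t) • u + t • v‖ ≤ 1 := by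
              refine (norm_add_le _ _).trans ?_
              rw [norm_smul (1 - t), norm_smul t, hu1, hv1,
                Real.norm_of_nonneg (by linarith [ht.2]),
                Real.norm_of_nonneg ht.1]
              linarith
            exact (mul_le_of_le_one_right hρ0.le h1).trans (min_le_left _ _)
        _ = ENNReal.ofReal (C * ‖ρ • (v - u)‖) := by simp
    have h2 := h.trans hb
    have e1 : ρ • u + (1 : ℝ) • (ρ • (v - u)) = ρ • v := by module
    rw [ENNReal.ofReal_le_ofReal_iff (by positivity), zero_smul, add_zero, e1] at h2
    rw [norm_smul, Real.norm_of_nonneg hρ0.le] at h2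
    nlinarith
  have h1 := hS.dist_radial hN hu1 ‖x‖ ρ
  have h2 := hS.dist_radial hN hv1 ρ ‖y‖
  rw [← hxu, abs_of_nonneg (sub_nonneg.2 hρx)] at h1
  rw [← hyv, abs_sub_comm, abs_of_nonneg (sub_nonneg.2 hρy)] at h2
  linarith [dist_triangle4 (Φ x) (Φ (ρ • u)) (Φ (ρ • v)) (Φ y)]

end Chart

/-! ### Polar coordinates -/

section Angle

variable {n : ℕ} {G : ℝ → ℝ}

lemma two_mul_sin_half_sq (x : ℝ) : (2 * Real.sin (x / 2)) ^ 2 = 2 - 2 * Real.cos x := by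
  have h1 := Real.sin_sq_eq_half_sub (x / 2)
  rw [mul_div_cancel₀ _ two_ne_zero] at h1
  rw [mul_pow, h1]
  ring

lemma abs_angle_sub_angle_le (u x y : Euc n) : |angle u x - angle u y| ≤ angle x y := by
  rw [abs_le]
  have h1 := angle_le_angle_add_angle u x y
  have h2 := angle_le_angle_add_angle u y x
  rw [angle_comm y x] at h2
  constructor <;> linarith

lemma polar_sub_sq_le (u x y : Euc n) :
    (‖x‖ - ‖y‖) ^ 2 + ‖x‖ * ‖y‖ * (2 * Real.sin ((angle u x - angle u y) / 2)) ^ 2 ≤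
      ‖x - y‖ ^ 2 := by
  have h1 : Real.cos (angle x y) ≤ Real.cos (angle u x - angle u y) := by
    rw [← Real.cos_abs (angle u x - angle u y)]
    exact Real.cos_le_cos_of_nonneg_of_le_pi (abs_nonneg _) (angle_le_pi _ _)
      (abs_angle_sub_angle_le u x y)
  rw [two_mul_sin_half_sq, norm_sub_sq_real, ← cos_angle_mul_norm_mul_norm]
  nlinarith [mul_le_mul_of_nonneg_left h1 (mul_nonneg (norm_nonneg x) (norm_nonneg y))]

lemma abs_angle_sub_le {ρ : ℝ} (hρ : 0 < ρ) (u : Euc n) {x y : Euc n} (hx : ρ ≤ ‖x‖)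
    (hy : ρ ≤ ‖y‖) : |angle u x - angle u y| ≤ Real.pi / (2 * ρ) * ‖x - y‖ := by
  set δ := angle u x - angle u y with hδ
  have hδ0 : |δ| / 2 ≤ Real.pi / 2 := by
    have := (abs_angle_sub_angle_le u x y).trans (angle_le_pi _ _)
    linarith
  have h1 := Real.mul_le_sin (by positivity) hδ0
  have h2 := polar_sub_sq_le u x y
  rw [← hδ] at h2
  have h3 : (2 * Real.sin (δ / 2)) ^ 2 = (2 * Real.sin (|δ| / 2)) ^ 2 := by
    rw [two_mul_sin_half_sq, two_mul_sin_half_sq, Real.cos_abs]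
  have hpi := Real.pi_pos
  have h4 : ρ * (2 * (2 / Real.pi * (|δ| / 2))) ≤ ‖x - y‖ := by
    refine le_of_sq_le_sq ?_ (norm_nonneg _)
    calc (ρ * (2 * (2 / Real.pi * (|δ| / 2)))) ^ 2
        = ρ * ρ * (2 * (2 / Real.pi * (|δ| / 2))) ^ 2 := by ring
      _ ≤ ‖x‖ * ‖y‖ * (2 * Real.sin (|δ| / 2)) ^ 2 := by gcongr
      _ ≤ ‖x - y‖ ^ 2 := by rw [← h3]; nlinarith [sq_nonneg (‖x‖ - ‖y‖)]
  have h5 : ρ * (2 * (2 / Real.pi * (|δ| / 2))) = |δ| / (Real.pi / (2 * ρ)) := by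
    field_simp
  rw [h5, div_le_iff₀ (by positivity)] at h4
  linarith

/-- The polar speed is at most the warped norm of the velocity. -/
lemma polar_speed_le_warpNorm {c : ℝ → Euc n} {u c' : Euc n} {ψ' t : ℝ}
    (hc : HasDerivAt c c' t) (h0 : c t ≠ 0) (hψ : HasDerivAt (fun s => angle u (c s)) ψ' t) :
    ∃ r', HasDerivAt (fun s => ‖c s‖) r' t ∧
      r' ^ 2 + G ‖c t‖ ^ 2 * ψ' ^ 2 ≤ warpNorm G (c t) c' ^ 2 := by
  have hr0 := norm_pos_iff.2 h0
  set r' := ⟪c', ‖c t‖⁻¹ • c t⟫ with hr'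
  have hr : HasDerivAt (fun s => ‖c s‖) r' t := by
    have h1 := hc.norm_sq.sqrt (pow_pos hr0 2).ne'
    simp only [Real.sqrt_sq (norm_nonneg _)] at h1
    refine h1.congr_deriv ?_
    rw [hr', inner_smul_right, real_inner_comm]
    field_simp
  refine ⟨r', hr, ?_⟩
  have key : r' ^ 2 + ‖c t‖ * ‖c t‖ * ψ' ^ 2 ≤ ‖c'‖ ^ 2 := by
    have hf : HasDerivAt (fun s => 2 * Real.sin ((angle u (c s) - angle u (c t)) / 2)) ψ' t := by
      have := ((((hψ.sub_const (angle u (c t))).div_const 2).sin).const_mul 2)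
      refine this.congr_deriv ?_
      simp only [sub_self, zero_div, Real.cos_zero]
      ring
    have l1 := hasDerivAt_iff_tendsto_slope.1 hr
    have l2 := hasDerivAt_iff_tendsto_slope.1 hf
    have l3 := hasDerivAt_iff_tendsto_slope.1 hc
    have l4 : Tendsto (fun s => ‖c s‖) (nhdsWithin t {t}ᶜ) (nhds ‖c t‖) :=
      hc.continuousAt.norm.tendsto.mono_left nhdsWithin_le_nhds
    refine le_of_tendsto_of_tendsto' ((l1.pow 2).add ((l4.mul_const ‖c t‖).mul (l2.pow 2)))
      (l3.norm.pow 2) fun s => ?_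
    have := mul_le_mul_of_nonneg_left (polar_sub_sq_le u (c s) (c t)) (sq_nonneg ((s - t)⁻¹))
    simp only [slope_def_module, smul_eq_mul, norm_smul, mul_pow, sub_self, zero_div, Real.sin_zero,
      mul_zero, sub_zero, Real.norm_eq_abs, sq_abs] at this ⊢
    linarith
  have hw : warpNorm G (c t) c' ^ 2 = r' ^ 2 + (G ‖c t‖ / ‖c t‖) ^ 2 * (‖c'‖ ^ 2 - r' ^ 2) := by
    unfold warpNorm
    rw [if_neg h0, Real.sq_sqrt]
    have := sq_inner_unit_le (c t) c'
    have : 0 ≤ ‖c'‖ ^ 2 - r' ^ 2 := by linarith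
    positivity
  rw [hw]
  have h1 : G ‖c t‖ ^ 2 * ψ' ^ 2 = (G ‖c t‖ / ‖c t‖) ^ 2 * (‖c t‖ * ‖c t‖ * ψ' ^ 2) := by
    field_simp
  rw [h1]
  gcongr
  linarith

end Angle

section PolarBounds

variable {n : ℕ} {p : M} {G : ℝ → ℝ} {Φ : Euc n ≃ M}

lemma lipOn_norm {c : ℝ → Euc n} {K : ℝ≥0} {T : ℝ} (hc : LipschitzOnWith K c (Icc 0 T)) :
    LipOn T fun t => ‖c t‖ :=
  LipOn.of_abs_le (K := K) fun s hs t ht => (abs_norm_sub_norm_le _ _).trans (by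
    rw [← dist_eq_norm, ← Real.dist_eq]
    exact hc.dist_le_mul s hs t ht)

lemma lipOn_angle {c : ℝ → Euc n} {K : ℝ≥0} {T ρ : ℝ} (hc : LipschitzOnWith K c (Icc 0 T))
    (hρ : 0 < ρ) (h : ∀ t ∈ Icc 0 T, ρ ≤ ‖c t‖) (u : Euc n) : LipOn T fun t => angle u (c t) :=
  LipOn.of_abs_le (K := Real.pi / (2 * ρ) * K) fun s hs t ht => by
    refine (abs_angle_sub_le hρ u (h s hs) (h t ht)).trans ?_
    rw [mul_assoc]
    have := hc.dist_le_mul s hs t ht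
    rw [dist_eq_norm, Real.dist_eq] at this
    have := Real.pi_pos
    gcongr

/-- Comparison with the polar rectangle at radius `ρ`, for points whose minimizing geodesics stay
outside the ball of radius `ρ`. -/
lemma IsSphericallySymmetric.polar_rect_le_dist (hS : IsSphericallySymmetric p G Φ)
    (hN : NonposCurvWarping G) (u : Euc n) {x y : Euc n} {ρ : ℝ} (hρ : 0 < ρ)
    (h : ρ + dist (Φ x) (Φ y) < ‖x‖) :
    (‖y‖ - ‖x‖) ^ 2 + G ρ ^ 2 * (angle u y - angle u x) ^ 2 ≤ dist (Φ x) (Φ y) ^ 2 := by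
  set A := ‖y‖ - ‖x‖ with hA
  set B := G ρ * (angle u y - angle u x) with hB
  set S := √(A ^ 2 + B ^ 2) with hSd
  have hAB : (0 : ℝ) ≤ A ^ 2 + B ^ 2 := by positivity
  have hS2 : S ^ 2 = A ^ 2 + B ^ 2 := Real.sq_sqrt hAB
  have hS0 : 0 ≤ S := Real.sqrt_nonneg _
  suffices S ≤ dist (Φ x) (Φ y) by
    calc A ^ 2 + G ρ ^ 2 * (angle u y - angle u x) ^ 2 = S ^ 2 := by rw [hS2, hB]; ring
      _ ≤ _ := pow_le_pow_left₀ hS0 this 2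
  rcases hS0.eq_or_lt with hS0 | hS0
  · rw [← hS0]; exact dist_nonneg
  have h' : dist (Φ x) (Φ y) < ‖x‖ - ρ := by linarith
  refine le_of_forall_gt_imp_ge_of_dense fun D hD => ?_
  have hD0 : 0 < D := dist_nonneg.trans_lt hD
  obtain ⟨T, c, K, hT, h0, h1, hc, hlt⟩ := hS.exists_curve x y (lt_min hD h')
  have hmin0 : 0 < min D (‖x‖ - ρ) := lt_min hD0 (dist_nonneg.trans_lt h')
  have hfar : ∀ t ∈ Icc 0 T, ρ ≤ ‖c t‖ := by
    intro t ht
    have e1 := (hS.dist_le_arc hc le_rfl ht.1 ht.2).trans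
      ((lintegral_mono_set (Icc_subset_Icc_right ht.2)).trans_lt hlt).le
    rw [ENNReal.ofReal_le_ofReal_iff hmin0.le, h0] at e1
    have e2 := hS.norm_sub_le_dist hN x (c t)
    have e3 := norm_sub_norm_le x (c t)
    linarith [min_le_right D (‖x‖ - ρ)]
  have hψ := lipOn_angle hc hρ hfar u
  have hr := lipOn_norm hc
  have hF := (hr.const_mul (A / S)).add (hψ.const_mul (B / S * G ρ))
  have key := le_warpLength_of_deriv_le (G := G) (c := c) hT hF (by
    filter_upwards [lipschitz_ae_differentiableAt hc, hψ.ae_differentiableAt] with t d1 d2 ht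
    have hρt := hfar t (Ioo_subset_Icc_self ht)
    have hct : c t ≠ 0 := norm_pos_iff.1 (hρ.trans_le hρt)
    obtain ⟨r', hr', hle⟩ := polar_speed_le_warpNorm (G := G) (d1 ht).hasDerivAt hct
      (d2 ht).hasDerivAt
    rw [((hr'.const_mul (A / S)).fun_add ((d2 ht).hasDerivAt.const_mul (B / S * G ρ))).deriv]
    have hw : 0 ≤ warpNorm G (c t) (deriv c t) :=
      (norm_nonneg _).trans (norm_le_warpNorm hS.1 hN _ _)
    refine abs_le_of_sq_le_sq ?_ hw
    refine le_trans ?_ hle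
    set ψ' := deriv (fun t => angle u (c t)) t
    have hGρ : G ρ ^ 2 ≤ G ‖c t‖ ^ 2 :=
      pow_le_pow_left₀ (hS.1.1 ρ hρ).le ((NonposCurvWarping.strictMonoOn hS.1 hN).monotoneOn hρ
        (show 0 < ‖c t‖ from hρ.trans_le hρt) hρt) 2
    have hunit : (A / S) ^ 2 + (B / S) ^ 2 = 1 := by
      rw [div_pow, div_pow, ← add_div, ← hS2, div_self (pow_pos hS0 2).ne']
    have e1 : (A / S * r' + B / S * G ρ * ψ') ^ 2 ≤ r' ^ 2 + (G ρ * ψ') ^ 2 := by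
      have : ((A / S) ^ 2 + (B / S) ^ 2) * (r' ^ 2 + (G ρ * ψ') ^ 2) =
        (A / S * r' + B / S * G ρ * ψ') ^ 2 + (A / S * (G ρ * ψ') - B / S * r') ^ 2 := by ring
      rw [hunit, one_mul] at this
      rw [this]
      exact le_add_of_nonneg_right (sq_nonneg _)
    refine e1.trans ?_
    rw [mul_pow]
    gcongr)
  have := key.trans_lt hlt
  rw [ENNReal.ofReal_lt_ofReal_iff hmin0, h0, h1] at this
  have e : A / S * ‖y‖ + B / S * G ρ * angle u y - (A / S * ‖x‖ + B / S * G ρ * angle u x) = S := by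
    have : A / S * ‖y‖ + B / S * G ρ * angle u y - (A / S * ‖x‖ + B / S * G ρ * angle u x) =
      (A ^ 2 + B ^ 2) / S := by rw [hA, hB]; ring
    rw [this, ← hS2, sq, mul_div_cancel_right₀ _ hS0.ne']
  rw [e] at this
  exact (this.trans_le (min_le_left _ _)).le

end PolarBounds

/-- The point with polar coordinates `(r, ψ)` in the plane with orthonormal basis `(u, e)`. -/
def polarPoint {n : ℕ} (u e : Euc n) (r ψ : ℝ) : Euc n := r • (Real.cos ψ • u + Real.sin ψ • e)

section polarPoint

variable {n : ℕ} {u e : Euc n}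

lemma norm_comb (hu : ‖u‖ = 1) (he : ‖e‖ = 1) (hue : ⟪u, e⟫ = 0) (a b : ℝ) :
    ‖a • u + b • e‖ ^ 2 = a ^ 2 + b ^ 2 := by
  rw [norm_add_sq_real, norm_smul, norm_smul, inner_smul_left, inner_smul_right, hu, he, hue]
  simp

lemma norm_direction (hu : ‖u‖ = 1) (he : ‖e‖ = 1) (hue : ⟪u, e⟫ = 0) (ψ : ℝ) :
    ‖Real.cos ψ • u + Real.sin ψ • e‖ = 1 := by
  have := norm_comb hu he hue (Real.cos ψ) (Real.sin ψ)
  rw [Real.cos_sq_add_sin_sq] at this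
  exact (pow_eq_one_iff_of_nonneg (norm_nonneg _) two_ne_zero).1 this

lemma norm_polarPoint (hu : ‖u‖ = 1) (he : ‖e‖ = 1) (hue : ⟪u, e⟫ = 0) {r : ℝ} (hr : 0 ≤ r)
    (ψ : ℝ) : ‖polarPoint u e r ψ‖ = r := by
  rw [polarPoint, norm_smul, norm_direction hu he hue, Real.norm_of_nonneg hr, mul_one]

lemma polarPoint_eq_comb (u e : Euc n) (r ψ : ℝ) :
    polarPoint u e r ψ = (r * Real.cos ψ) • u + (r * Real.sin ψ) • e := by
  rw [polarPoint, smul_add, smul_smul, smul_smul]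

lemma angle_direction (hu : ‖u‖ = 1) (he : ‖e‖ = 1) (hue : ⟪u, e⟫ = 0) {ψ : ℝ}
    (hψ : ψ ∈ Icc 0 Real.pi) : angle u (Real.cos ψ • u + Real.sin ψ • e) = ψ := by
  rw [angle, norm_direction hu he hue, inner_add_right, inner_smul_right, inner_smul_right, hue,
    real_inner_self_eq_norm_sq, hu]
  simpa using Real.arccos_cos hψ.1 hψ.2

lemma angle_polarPoint (hu : ‖u‖ = 1) (he : ‖e‖ = 1) (hue : ⟪u, e⟫ = 0) {r ψ : ℝ} (hr : 0 < r)
    (hψ : ψ ∈ Icc 0 Real.pi) : angle u (polarPoint u e r ψ) = ψ := by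
  rw [polarPoint, angle_smul_right_of_pos _ _ hr, angle_direction hu he hue hψ]

lemma LipOn.cos {L : ℝ} {f : ℝ → ℝ} (hf : LipOn L f) : LipOn L fun s => Real.cos (f s) := by
  obtain ⟨K, hK⟩ := hf
  exact ⟨_, Real.lipschitzWith_cos.comp_lipschitzOnWith hK⟩

lemma LipOn.sin {L : ℝ} {f : ℝ → ℝ} (hf : LipOn L f) : LipOn L fun s => Real.sin (f s) := by
  obtain ⟨K, hK⟩ := hf
  exact ⟨_, Real.lipschitzWith_sin.comp_lipschitzOnWith hK⟩

lemma exists_lipschitzOnWith_polarPoint (hu : ‖u‖ = 1) (he : ‖e‖ = 1) {T : ℝ} {r ψ : ℝ → ℝ}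
    (hr : LipOn T r) (hψ : LipOn T ψ) :
    ∃ K : ℝ≥0, LipschitzOnWith K (fun t => polarPoint u e (r t) (ψ t)) (Icc 0 T) := by
  obtain ⟨K₁, h1, h1'⟩ := (hr.mul hψ.cos).exists_abs_le
  obtain ⟨K₂, h2, h2'⟩ := (hr.mul hψ.sin).exists_abs_le
  refine ⟨(K₁ + K₂).toNNReal, LipschitzOnWith.of_dist_le_mul fun x hx y hy => ?_⟩
  rw [Real.coe_toNNReal _ (by positivity)]
  simp only [polarPoint_eq_comb, dist_eq_norm]
  have : ∀ a b a' b' : ℝ, a • u + b • e - (a' • u + b' • e) = (a - a') • u + (b - b') • e :=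
    fun a b a' b' => by module
  rw [this]
  refine (norm_add_le _ _).trans ?_
  rw [norm_smul, norm_smul, hu, he, mul_one, mul_one, Real.norm_eq_abs, Real.norm_eq_abs,
    Real.norm_eq_abs, add_mul]
  exact add_le_add (h1' x hx y hy) (h2' x hx y hy)

lemma warpNorm_polarPoint (hu : ‖u‖ = 1) (he : ‖e‖ = 1) (hue : ⟪u, e⟫ = 0) (G : ℝ → ℝ)
    {r ψ : ℝ → ℝ} {t : ℝ} (hr : DifferentiableAt ℝ r t) (hψ : DifferentiableAt ℝ ψ t)
    (h0 : 0 < r t) :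
    warpNorm G (polarPoint u e (r t) (ψ t)) (deriv (fun t => polarPoint u e (r t) (ψ t)) t) =
      √(deriv r t ^ 2 + G (r t) ^ 2 * deriv ψ t ^ 2) := by
  have hd : HasDerivAt (fun t => polarPoint u e (r t) (ψ t))
      ((deriv r t * Real.cos (ψ t) + r t * (-Real.sin (ψ t) * deriv ψ t)) • u +
        (deriv r t * Real.sin (ψ t) + r t * (Real.cos (ψ t) * deriv ψ t)) • e) t := by
    simp only [polarPoint_eq_comb]
    exact ((hr.hasDerivAt.mul hψ.hasDerivAt.cos).smul_const u).add
      ((hr.hasDerivAt.mul hψ.hasDerivAt.sin).smul_const e)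
  have hn : polarPoint u e (r t) (ψ t) ≠ 0 := by
    rw [← norm_pos_iff, norm_polarPoint hu he hue h0.le]; exact h0
  rw [hd.deriv, warpNorm, if_neg hn, norm_polarPoint hu he hue h0.le, norm_comb hu he hue,
    polarPoint, smul_smul, inv_mul_cancel₀ h0.ne', one_smul]
  have hin : ∀ a b a' b' : ℝ, ⟪a • u + b • e, a' • u + b' • e⟫ = a * a' + b * b' := by
    intro a b a' b'
    simp only [inner_add_left, inner_add_right, inner_smul_left, inner_smul_right, hue,
      real_inner_comm, real_inner_self_eq_norm_sq, hu, he]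
    simp
    ring
  rw [hin]
  have hcs := Real.sin_sq_add_cos_sq (ψ t)
  set C := Real.cos (ψ t)
  set S := Real.sin (ψ t)
  have e1 : (deriv r t * C + r t * (-S * deriv ψ t)) * C +
      (deriv r t * S + r t * (C * deriv ψ t)) * S = deriv r t := by
    linear_combination deriv r t * hcs
  have e2 : (deriv r t * C + r t * (-S * deriv ψ t)) ^ 2 +
      (deriv r t * S + r t * (C * deriv ψ t)) ^ 2 = deriv r t ^ 2 + r t ^ 2 * deriv ψ t ^ 2 := by
    linear_combination (deriv r t ^ 2 + r t ^ 2 * deriv ψ t ^ 2) * hcs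
  rw [e1, e2]
  congr 1
  field_simp
  ring

variable {p : M} {G : ℝ → ℝ} {Φ : Euc n ≃ M}

lemma IsSphericallySymmetric.dist_polarPoint_le (hS : IsSphericallySymmetric p G Φ)
    (hu : ‖u‖ = 1) (he : ‖e‖ = 1) (hue : ⟪u, e⟫ = 0) {T : ℝ} {r ψ : ℝ → ℝ}
    (hr : LipOn T r) (hψ : LipOn T ψ) (hpos : ∀ t ∈ Icc 0 T, 0 < r t) {a b : ℝ}
    (ha : 0 ≤ a) (hab : a ≤ b) (hb : b ≤ T) :
    ENNReal.ofReal
      (dist (Φ (polarPoint u e (r a) (ψ a))) (Φ (polarPoint u e (r b) (ψ b)))) ≤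
      ∫⁻ t in Icc a b, ENNReal.ofReal (√(deriv r t ^ 2 + G (r t) ^ 2 * deriv ψ t ^ 2)) := by
  obtain ⟨K, hK⟩ := exists_lipschitzOnWith_polarPoint hu he hr hψ
  refine (hS.dist_le_arc hK ha hab hb).trans (le_of_eq ?_)
  rw [← Measure.restrict_congr_set Ioo_ae_eq_Icc]
  refine setLIntegral_congr_fun_ae measurableSet_Ioo ?_
  filter_upwards [hr.ae_differentiableAt, hψ.ae_differentiableAt] with t h1 h2 ht
  have ht' : t ∈ Ioo 0 T := ⟨ha.trans_lt ht.1, ht.2.trans_le hb⟩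
  rw [warpNorm_polarPoint hu he hue G (h1 ht') (h2 ht') (hpos t ⟨ht'.1.le, ht'.2.le⟩)]

lemma IsSphericallySymmetric.dist_polarPoint_le_integral (hS : IsSphericallySymmetric p G Φ)
    (hu : ‖u‖ = 1) (he : ‖e‖ = 1) (hue : ⟪u, e⟫ = 0) {T : ℝ} (hT : 0 < T) {r ψ : ℝ → ℝ}
    (hr : LipOn T r) (hψ : LipOn T ψ) (hpos : ∀ t ∈ Icc 0 T, 0 < r t) :
    dist (Φ (polarPoint u e (r 0) (ψ 0))) (Φ (polarPoint u e (r T) (ψ T))) ≤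
      ∫ t in 0..T, √(deriv r t ^ 2 + G (r t) ^ 2 * deriv ψ t ^ 2) := by
  have h := hS.dist_polarPoint_le hu he hue hr hψ hpos le_rfl hT.le le_rfl
  rw [← Measure.restrict_congr_set Ioc_ae_eq_Icc,
    ← MeasureTheory.ofReal_integral_eq_lintegral_ofReal] at h
  · rw [intervalIntegral.integral_of_le hT.le]
    exact (ENNReal.ofReal_le_ofReal_iff (integral_nonneg fun _ => Real.sqrt_nonneg _)).1 h
  · exact (intervalIntegrable_iff_integrableOn_Ioc_of_le hT.le).1
      (hS.1.intervalIntegrable_sqrt_energy hT hr hψ hpos)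
  · exact Eventually.of_forall fun _ => Real.sqrt_nonneg _

lemma IsSphericallySymmetric.dist_polarPoint_le_sub (hS : IsSphericallySymmetric p G Φ)
    (hu : ‖u‖ = 1) (he : ‖e‖ = 1) (hue : ⟪u, e⟫ = 0) {T : ℝ} {r ψ : ℝ → ℝ}
    (hr : LipOn T r) (hψ : LipOn T ψ) (hpos : ∀ t ∈ Icc 0 T, 0 < r t)
    (hsp : ∀ᵐ s, s ∈ Ioo 0 T → deriv r s ^ 2 + G (r s) ^ 2 * deriv ψ s ^ 2 ≤ 1) {a b : ℝ}
    (ha : 0 ≤ a) (hab : a ≤ b) (hb : b ≤ T) :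
    dist (Φ (polarPoint u e (r a) (ψ a))) (Φ (polarPoint u e (r b) (ψ b))) ≤ b - a := by
  have h := hS.dist_polarPoint_le hu he hue hr hψ hpos ha hab hb
  refine (ENNReal.ofReal_le_ofReal_iff (sub_nonneg.2 hab)).1 (h.trans ?_)
  rw [← Measure.restrict_congr_set Ioo_ae_eq_Icc]
  calc _ ≤ ∫⁻ _ in Ioo a b, 1 := by
        refine setLIntegral_mono_ae' measurableSet_Ioo ?_
        filter_upwards [hsp] with t h1 ht
        rw [← ENNReal.ofReal_one]
        exact ENNReal.ofReal_le_ofReal (Real.sqrt_le_one.2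
          (h1 ⟨ha.trans_lt ht.1, ht.2.trans_le hb⟩))
    _ = _ := by simp

end polarPoint

lemma isMinGeodesicFromTo_of_dist_le {γ : ℝ → M} {x y : M} (h0 : γ 0 = x) (h1 : γ (dist x y) = y)
    (h : ∀ s ∈ Icc 0 (dist x y), ∀ t ∈ Icc 0 (dist x y), s ≤ t → dist (γ s) (γ t) ≤ t - s) :
    IsMinGeodesicFromTo γ x y := by
  have hz : (0 : ℝ) ∈ Icc 0 (dist x y) := ⟨le_rfl, dist_nonneg⟩
  have hL : dist x y ∈ Icc 0 (dist x y) := ⟨dist_nonneg, le_rfl⟩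
  have key : ∀ s ∈ Icc 0 (dist x y), ∀ t ∈ Icc 0 (dist x y), s ≤ t →
      dist (γ s) (γ t) = t - s := by
    intro s hs t ht hst
    refine le_antisymm (h s hs t ht hst) ?_
    have h2 := h 0 hz s hs hs.1
    have h3 := h t ht _ hL ht.2
    rw [h0] at h2
    rw [h1] at h3
    linarith [dist_triangle4 x (γ s) (γ t) y]
  refine ⟨h0, h1, fun s hs t ht => ?_⟩
  rcases le_total s t with hst | hst
  · rw [key s hs t ht hst, abs_sub_comm, abs_of_nonneg (sub_nonneg.2 hst)]
  · rw [dist_comm, key t ht s hs hst, abs_of_nonneg (sub_nonneg.2 hst)]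

lemma IsMinGeodesicFromTo.dist_left {γ : ℝ → M} {x y : M} (h : IsMinGeodesicFromTo γ x y) {s : ℝ}
    (hs : s ∈ Icc 0 (dist x y)) : dist x (γ s) = s := by
  have := h.2.2 0 ⟨le_rfl, dist_nonneg⟩ s hs
  rwa [h.1, zero_sub, abs_neg, abs_of_nonneg hs.1] at this

lemma IsMinGeodesicFromTo.dist_right {γ : ℝ → M} {x y : M} (h : IsMinGeodesicFromTo γ x y) {s : ℝ}
    (hs : s ∈ Icc 0 (dist x y)) : dist (γ s) y = dist x y - s := by
  have := h.2.2 s hs _ ⟨dist_nonneg, le_rfl⟩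
  rwa [h.2.1, abs_sub_comm, abs_of_nonneg (sub_nonneg.2 hs.2)] at this

lemma IsMinGeodesicFromTo.trans {γ₁ γ₂ : ℝ → M} {x y z : M} (h1 : IsMinGeodesicFromTo γ₁ x z)
    (h2 : IsMinGeodesicFromTo γ₂ z y) (h : dist x z + dist z y = dist x y) :
    IsMinGeodesicFromTo (fun s => if s ≤ dist x z then γ₁ s else γ₂ (s - dist x z)) x y := by
  have hz : γ₂ 0 = z := h2.1
  have hmem : ∀ s ∈ Icc 0 (dist x y), ¬ s ≤ dist x z → s - dist x z ∈ Icc 0 (dist z y) :=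
    fun s hs hs' => ⟨by linarith, by linarith [hs.2]⟩
  refine isMinGeodesicFromTo_of_dist_le ?_ ?_ ?_
  · simp [h1.1]
  · by_cases hzy : dist x y ≤ dist x z
    · have : dist z y = 0 := le_antisymm (by linarith) dist_nonneg
      have hzy' : z = y := dist_eq_zero.1 this
      subst hzy'
      simp [h1.2.1]
    · rw [if_neg hzy, ← h, add_sub_cancel_left, h2.2.1]
  · intro s hs t ht hst
    by_cases ht' : t ≤ dist x z
    · have hs' := hst.trans ht'
      simp only [hs', ht', if_true]
      rw [h1.2.2 s ⟨hs.1, hs'⟩ t ⟨ht.1, ht'⟩, abs_sub_comm, abs_of_nonneg (sub_nonneg.2 hst)]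
    · by_cases hs' : s ≤ dist x z
      · simp only [hs', ht', if_true, if_false]
        have e1 := h1.dist_right ⟨hs.1, hs'⟩
        have e2 := h2.dist_left (hmem t ht ht')
        linarith [dist_triangle (γ₁ s) z (γ₂ (t - dist x z))]
      · simp only [hs', ht', if_false]
        rw [h2.2.2 _ (hmem s hs hs') _ (hmem t ht ht'), abs_sub_comm, abs_of_nonneg] <;> linarith

section Existence

variable {n : ℕ} {p : M} {G : ℝ → ℝ} {Φ : Euc n ≃ M}

lemma lintegral_Icc_add_le (f : ℝ → ℝ≥0∞) {a b c : ℝ} (hab : a ≤ b) (hbc : b ≤ c) :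
    (∫⁻ t in Icc a b, f t) + ∫⁻ t in Icc b c, f t ≤ ∫⁻ t in Icc a c, f t := by
  rw [← Measure.restrict_congr_set Ioc_ae_eq_Icc, ← Measure.restrict_congr_set Ioc_ae_eq_Icc,
    ← Measure.restrict_congr_set Ioc_ae_eq_Icc, ← Ioc_union_Ioc_eq_Ioc hab hbc,
    lintegral_union measurableSet_Ioc (Ioc_disjoint_Ioc_of_le le_rfl)]

lemma IsSphericallySymmetric.norm_symm (hS : IsSphericallySymmetric p G Φ) (x : M) :
    ‖Φ.symm x‖ = dist x p := by
  rw [← hS.2.2.1, Equiv.apply_symm_apply]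

lemma IsSphericallySymmetric.continuous_symm (hS : IsSphericallySymmetric p G Φ)
    (hN : NonposCurvWarping G) : Continuous Φ.symm := by
  refine LipschitzWith.continuous (K := 1) (LipschitzWith.of_dist_le_mul fun x y => ?_)
  simpa [dist_eq_norm] using hS.norm_sub_le_dist hN (Φ.symm x) (Φ.symm y)

lemma IsSphericallySymmetric.continuous [ProperSpace M] (hS : IsSphericallySymmetric p G Φ)
    (hN : NonposCurvWarping G) : Continuous Φ := by
  have h : IsProperMap Φ.symm := by
    refine isProperMap_iff_tendsto_cocompact.2 ⟨hS.continuous_symm hN, ?_⟩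
    rw [← Metric.cobounded_eq_cocompact, ← Metric.cobounded_eq_cocompact,
      ← tendsto_norm_atTop_iff_cobounded]
    simpa only [hS.norm_symm] using tendsto_dist_right_cobounded_atTop p
  refine continuous_iff_isClosed.2 fun C hC => ?_
  rw [← Equiv.image_symm_eq_preimage]
  exact h.isClosedMap C hC

lemma IsSphericallySymmetric.exists_almost_geodesic [ProperSpace M]
    (hS : IsSphericallySymmetric p G Φ) (hN : NonposCurvWarping G) (x y : M)
    {ε : ℝ} (hε : 0 < ε) :
    ∃ γ : ℝ → M, (∀ s ∈ Icc 0 (dist x y), dist x (γ s) = s) ∧ dist (γ (dist x y)) y ≤ ε ∧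
      ∀ s ∈ Icc 0 (dist x y), ∀ t ∈ Icc 0 (dist x y), dist (γ s) (γ t) ≤ |s - t| + ε := by
  obtain ⟨T, c, K, hT, hc0, hcT, hc, hlen⟩ := hS.exists_curve (Φ.symm x) (Φ.symm y)
    (D := dist x y + ε) (by simpa using hε)
  have hx : Φ (c 0) = x := by rw [hc0, Equiv.apply_symm_apply]
  have hy : Φ (c T) = y := by rw [hcT, Equiv.apply_symm_apply]
  have key : ∀ a b, 0 ≤ a → a ≤ b → b ≤ T →
      dist x (Φ (c a)) + dist (Φ (c a)) (Φ (c b)) + dist (Φ (c b)) y ≤ dist x y + ε := by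
    intro a b ha hab hb
    have h1 := hS.dist_le_arc hc le_rfl ha (hab.trans hb)
    have h2 := hS.dist_le_arc hc ha hab hb
    have h3 := hS.dist_le_arc hc (ha.trans hab) hb le_rfl
    rw [hx] at h1
    rw [hy] at h3
    have := (add_le_add (add_le_add h1 h2) h3).trans
      ((add_le_add_left (lintegral_Icc_add_le _ ha hab) _).trans
        ((lintegral_Icc_add_le _ (ha.trans hab) hb).trans hlen.le))
    rw [← ENNReal.ofReal_add dist_nonneg dist_nonneg, ← ENNReal.ofReal_add (by positivity)
      dist_nonneg] at this
    exact (ENNReal.ofReal_le_ofReal_iff (by positivity)).1 this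
  have hcont : ContinuousOn (fun t => dist x (Φ (c t))) (Icc 0 T) :=
    (continuous_const.dist (hS.continuous hN)).comp_continuousOn hc.continuousOn
  have hex : ∀ s, ∃ t, s ∈ Icc 0 (dist x y) → t ∈ Icc 0 T ∧ dist x (Φ (c t)) = s := by
    intro s
    by_cases hs : s ∈ Icc 0 (dist x y)
    · have := intermediate_value_Icc hT hcont
      rw [hx, hy, dist_self] at this
      obtain ⟨t, ht, hts⟩ := this hs
      exact ⟨t, fun _ => ⟨ht, hts⟩⟩
    · exact ⟨0, fun h => absurd h hs⟩
  choose τ hτ using hex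
  refine ⟨fun s => Φ (c (τ s)), fun s hs => (hτ s hs).2, ?_, ?_⟩
  · obtain ⟨h1, h2⟩ := hτ (dist x y) ⟨dist_nonneg, le_rfl⟩
    have := key _ _ h1.1 le_rfl h1.2
    rw [dist_self, h2] at this
    linarith
  · intro s hs t ht
    obtain ⟨h1, h2⟩ := hτ s hs
    obtain ⟨h3, h4⟩ := hτ t ht
    rcases le_total (τ s) (τ t) with hst | hst
    · have := key _ _ h1.1 hst h3.2
      have := dist_triangle x (Φ (c (τ t))) y
      linarith [neg_le_abs (s - t)]
    · have := key _ _ h3.1 hst h1.2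
      have := dist_triangle x (Φ (c (τ s))) y
      rw [dist_comm]
      linarith [le_abs_self (s - t)]

lemma IsSphericallySymmetric.exists_geodesic [ProperSpace M] (hS : IsSphericallySymmetric p G Φ)
    (hN : NonposCurvWarping G) (x y : M) : ∃ γ : ℝ → M, IsMinGeodesicFromTo γ x y := by
  set L := dist x y with hL
  have hL0 : 0 ≤ L := dist_nonneg
  let ε : ℕ → ℝ := fun k => 1 / ((k : ℝ) + 1)
  let S : ℕ → Set (ℝ → M) := fun k =>
    (univ.pi fun _ => closedBall x L) ∩ ({γ | ∀ s ∈ Icc 0 L, dist x (γ s) = s} ∩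
      ({γ | dist (γ L) y ≤ ε k} ∩
        {γ | ∀ s ∈ Icc 0 L, ∀ t ∈ Icc 0 L, dist (γ s) (γ t) ≤ |s - t| + ε k}))
  have hcomp : IsCompact (univ.pi fun _ : ℝ => closedBall x L) :=
    isCompact_univ_pi fun _ => isCompact_closedBall x L
  have hclosed : ∀ k, IsClosed (S k) := by
    intro k
    refine hcomp.isClosed.inter (IsClosed.inter ?_ (IsClosed.inter ?_ ?_))
    · simp only [ofPred_forall]
      exact isClosed_iInter fun s => isClosed_iInter fun _ =>
        isClosed_eq (by fun_prop) (by fun_prop)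
    · exact isClosed_le (by fun_prop) (by fun_prop)
    · simp only [ofPred_forall]
      exact isClosed_iInter fun s => isClosed_iInter fun _ => isClosed_iInter fun t =>
        isClosed_iInter fun _ => isClosed_le (by fun_prop) (by fun_prop)
  have hanti : ∀ k, S (k + 1) ⊆ S k := by
    intro k γ hγ
    have hε : ε (k + 1) ≤ ε k := by
      simp only [ε]
      gcongr
      simp
    exact ⟨hγ.1, hγ.2.1, hγ.2.2.1.trans hε, fun s hs t ht =>
      (hγ.2.2.2 s hs t ht).trans (by gcongr)⟩
  have hne : ∀ k, (S k).Nonempty := by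
    intro k
    obtain ⟨γ, h1, h2, h3⟩ := hS.exists_almost_geodesic hN x y (ε := ε k) (by positivity)
    refine ⟨fun s => if s ∈ Icc 0 L then γ s else x, ?_, ?_, ?_, ?_⟩
    · intro s _
      by_cases hs : s ∈ Icc 0 L
      · simp only [hs, if_true, mem_closedBall]
        rw [dist_comm, h1 s hs]
        exact hs.2
      · simp only [hs, if_false, mem_closedBall, dist_self]
        exact hL0
    · intro s hs
      simp only [hs, if_true]
      exact h1 s hs
    · have : L ∈ Icc 0 L := ⟨hL0, le_rfl⟩
      simp only [mem_ofPred_eq, this, if_true]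
      exact h2
    · intro s hs t ht
      simp only [hs, ht, if_true]
      exact h3 s hs t ht
  obtain ⟨γ, hγ⟩ := IsCompact.nonempty_iInter_of_sequence_nonempty_isCompact_isClosed S hanti hne
    (hcomp.of_isClosed_subset (hclosed 0) inter_subset_left) hclosed
  have hγ' : ∀ k, γ ∈ S k := fun k => mem_iInter.1 hγ k
  have hε : Tendsto ε atTop (nhds 0) := tendsto_one_div_add_atTop_nhds_zero_nat
  have h1 := (hγ' 0).2.1
  refine ⟨γ, isMinGeodesicFromTo_of_dist_le ?_ ?_ fun s hs t ht hst => ?_⟩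
  · exact (dist_eq_zero.1 (h1 0 ⟨le_rfl, hL0⟩)).symm
  · exact dist_le_zero.1 (ge_of_tendsto' hε fun k => (hγ' k).2.2.1)
  · have := ge_of_tendsto' (tendsto_const_nhds.add hε) fun k => (hγ' k).2.2.2 s hs t ht
    rwa [add_zero, abs_sub_comm, abs_of_nonneg (sub_nonneg.2 hst)] at this

lemma IsSphericallySymmetric.exists_geodesic_through [ProperSpace M]
    (hS : IsSphericallySymmetric p G Φ) (hN : NonposCurvWarping G) {x y z : M}
    (h : dist x z + dist z y = dist x y) :
    ∃ γ : ℝ → M, IsMinGeodesicFromTo γ x y ∧ γ (dist x z) = z := by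
  obtain ⟨γ₁, h1⟩ := hS.exists_geodesic hN x z
  obtain ⟨γ₂, h2⟩ := hS.exists_geodesic hN z y
  exact ⟨_, h1.trans h2 h, by simp [h1.2.1]⟩

lemma IsSphericallySymmetric.dCompl_empty [ProperSpace M]
    (hS : IsSphericallySymmetric p G Φ) (hN : NonposCurvWarping G) (x y : M) :
    dCompl (∅ : Set M) x y = ENNReal.ofReal (dist x y) := by
  refine le_antisymm ?_ (le_sInf ?_)
  · obtain ⟨γ, hγ⟩ := hS.exists_geodesic hN x y
    have hlip : LipschitzOnWith 1 γ (Icc 0 (dist x y)) :=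
      LipschitzOnWith.of_dist_le_mul fun s hs t ht => by
        rw [hγ.2.2 s hs t ht, Real.dist_eq, NNReal.coe_one, one_mul]
    have hmem : dCompl (∅ : Set M) x y ≤ pathLength γ (dist x y) :=
      sInf_le ⟨dist x y, γ, dist_nonneg, hγ.1, hγ.2.1, ⟨1, hlip⟩, fun _ _ => notMem_empty _, rfl⟩
    refine hmem.trans ?_
    have h1 := hlip.comp_eVariationOn_le (mapsTo_id (Icc 0 (dist x y)))
    have h2 := (monotoneOn_id (s := Icc 0 (dist x y))).eVariationOn_eq
      (a := 0) (b := dist x y) ⟨le_rfl, dist_nonneg⟩ ⟨dist_nonneg, le_rfl⟩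
    rw [inter_self] at h2
    rw [ENNReal.coe_one, one_mul, Function.comp_id] at h1
    simpa [pathLength] using h1.trans h2.le
  · rintro _ ⟨T, γ, hT, rfl, rfl, -, -, rfl⟩
    rw [← edist_dist]
    exact eVariationOn.edist_le γ (left_mem_Icc.2 hT) (right_mem_Icc.2 hT)

lemma IsSphericallySymmetric.mem_omegaSeq_one [ProperSpace M]
    (hS : IsSphericallySymmetric p G Φ) (hN : NonposCurvWarping G) {q x : M} {lam : ℝ}
    (hlam : 0 < lam) : x ∈ OmegaSeq p q lam 1 ↔ lam * dist x p < dist q x := by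
  simp only [OmegaSeq, empty_union, mem_empty_iff_false, not_false_eq_true, true_and,
    mem_ofPred_eq, hS.dCompl_empty hN]
  rw [dist_comm x q, ENNReal.ofReal_lt_ofReal_iff_of_nonneg (by positivity)]

lemma IsSphericallySymmetric.visibleThrough_omegaSeq_one [ProperSpace M]
    (hS : IsSphericallySymmetric p G Φ) (hN : NonposCurvWarping G) {q x : M} {lam : ℝ}
    (hlam : 0 < lam) : VisibleThrough (OmegaSeq p q lam 1) q x ↔
      ∀ z, dist q z + dist z x = dist q x → dist q z ≤ lam * dist z p := by
  constructor
  · intro h z hz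
    obtain ⟨γ, hγ, hγz⟩ := hS.exists_geodesic_through hN hz
    have := h γ hγ (dist q z) ⟨dist_nonneg, by linarith [dist_nonneg (x := z) (y := x)]⟩
    rwa [hγz, hS.mem_omegaSeq_one hN hlam, not_lt] at this
  · intro h γ hγ t ht
    rw [hS.mem_omegaSeq_one hN hlam, not_lt]
    exact h _ (by rw [hγ.dist_left ht, hγ.dist_right ht, add_sub_cancel])

end Existence

section Profile

variable {n : ℕ} {p : M} {G : ℝ → ℝ} {Φ : Euc n ≃ M} {u e : Euc n}

lemma polarPoint_zero (u e : Euc n) (r : ℝ) : polarPoint u e r 0 = r • u := by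
  simp [polarPoint]

lemma exists_eq_polarPoint (hu : ‖u‖ = 1) {y : Euc n} (hy0 : y ≠ 0) (h0 : angle u y ≠ 0)
    (hπ : angle u y ≠ Real.pi) :
    ∃ e : Euc n, ‖e‖ = 1 ∧ ⟪u, e⟫ = 0 ∧ y = polarPoint u e ‖y‖ (angle u y) := by
  set ψ := angle u y with hψ
  have hsin : 0 < Real.sin ψ := Real.sin_pos_of_pos_of_lt_pi
    (lt_of_le_of_ne (angle_nonneg _ _) (Ne.symm h0)) (lt_of_le_of_ne (angle_le_pi _ _) hπ)
  have hy : 0 < ‖y‖ := norm_pos_iff.2 hy0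
  have hin : ⟪u, y⟫ = ‖y‖ * Real.cos ψ := by
    rw [← cos_angle_mul_norm_mul_norm, hu, hψ]; ring
  have hpos : 0 < ‖y‖ * Real.sin ψ := mul_pos hy hsin
  have huu : ⟪u, u⟫ = 1 := by rw [real_inner_self_eq_norm_sq, hu]; norm_num
  have hn : ‖y - (‖y‖ * Real.cos ψ) • u‖ = ‖y‖ * Real.sin ψ := by
    refine (pow_left_inj₀ (norm_nonneg _) hpos.le two_ne_zero).1 ?_
    rw [norm_sub_sq_real, inner_smul_right, real_inner_comm, hin, norm_smul, hu, mul_one,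
      Real.norm_eq_abs, sq_abs]
    linear_combination (-‖y‖ ^ 2) * Real.sin_sq_add_cos_sq ψ
  refine ⟨(‖y‖ * Real.sin ψ)⁻¹ • (y - (‖y‖ * Real.cos ψ) • u), ?_, ?_, ?_⟩
  · rw [norm_smul, hn, norm_inv, Real.norm_of_nonneg hpos.le, inv_mul_cancel₀ hpos.ne']
  · rw [inner_smul_right, inner_sub_right, inner_smul_right, huu, hin]
    ring
  · rw [polarPoint_eq_comb, smul_smul, mul_inv_cancel₀ hpos.ne', one_smul]
    module

lemma IsSphericallySymmetric.norm_pos_of_between (hS : IsSphericallySymmetric p G Φ) {x y z : M}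
    (hxy : dist x y < dist x p + dist y p) (hz : dist x z + dist z y = dist x y) :
    0 < ‖Φ.symm z‖ := by
  rw [hS.norm_symm]
  refine dist_pos.2 ?_
  rintro rfl
  rw [dist_comm y] at hxy
  linarith

/-- The polar coordinates along a minimizing geodesic avoiding the centre are Lipschitz, with speed
at most one. -/
lemma IsSphericallySymmetric.polar_along_geodesic (hS : IsSphericallySymmetric p G Φ)
    (hN : NonposCurvWarping G) {x y : M} (hxy : dist x y < dist x p + dist y p) {γ : ℝ → M}
    (hγ : IsMinGeodesicFromTo γ x y) (u : Euc n) :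
    LipOn (dist x y) (fun s => ‖Φ.symm (γ s)‖) ∧
    LipOn (dist x y) (fun s => angle u (Φ.symm (γ s))) ∧
    (∀ s ∈ Icc 0 (dist x y), 0 < ‖Φ.symm (γ s)‖) ∧
    ∀ᵐ s, s ∈ Ioo 0 (dist x y) → deriv (fun s => ‖Φ.symm (γ s)‖) s ^ 2 +
      G ‖Φ.symm (γ s)‖ ^ 2 * deriv (fun s => angle u (Φ.symm (γ s))) s ^ 2 ≤ 1 := by
  have hpos : ∀ s ∈ Icc 0 (dist x y), 0 < ‖Φ.symm (γ s)‖ := fun s hs =>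
    hS.norm_pos_of_between hxy (by rw [hγ.dist_left hs, hγ.dist_right hs, add_sub_cancel])
  have hsub : ∀ s ∈ Icc 0 (dist x y), ∀ t ∈ Icc 0 (dist x y),
      ‖Φ.symm (γ s) - Φ.symm (γ t)‖ ≤ |s - t| := fun s hs t ht => by
    simpa [hγ.2.2 s hs t ht] using hS.norm_sub_le_dist hN (Φ.symm (γ s)) (Φ.symm (γ t))
  have hr : LipOn (dist x y) (fun s => ‖Φ.symm (γ s)‖) :=
    LipOn.of_abs_le (K := 1) fun s hs t ht => by
      rw [one_mul]
      exact (abs_norm_sub_norm_le _ _).trans (hsub s hs t ht)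
  obtain ⟨m, hm, hmr⟩ := hr.exists_pos_le dist_nonneg hpos
  have hψ : LipOn (dist x y) (fun s => angle u (Φ.symm (γ s))) :=
    LipOn.of_abs_le (K := Real.pi / (2 * m)) fun s hs t ht =>
      (abs_angle_sub_le hm u (hmr s hs) (hmr t ht)).trans
        (mul_le_mul_of_nonneg_left (hsub s hs t ht) (by positivity))
  refine ⟨hr, hψ, hpos, ?_⟩
  filter_upwards [hr.ae_differentiableAt, hψ.ae_differentiableAt] with t h1 h2 ht
  have ht' := Ioo_subset_Icc_self ht
  have hd1 := (h1 ht).hasDerivAt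
  have hd2 := (h2 ht).hasDerivAt
  set r := fun s => ‖Φ.symm (γ s)‖
  set ψ := fun s => angle u (Φ.symm (γ s))
  have key : ∀ ρ, 0 < ρ → ρ < r t → deriv r t ^ 2 + G ρ ^ 2 * deriv ψ t ^ 2 ≤ 1 := by
    intro ρ hρ hρt
    have l1 := hasDerivAt_iff_tendsto_slope.1 hd1
    have l2 := hasDerivAt_iff_tendsto_slope.1 hd2
    refine le_of_tendsto ((l1.pow 2).add ((l2.pow 2).const_mul (G ρ ^ 2))) ?_
    have hnear : ∀ᶠ s in nhds t, s ∈ Ioo 0 (dist x y) ∧ |s - t| < r t - ρ :=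
      (isOpen_Ioo.eventually_mem ht).and (Metric.ball_mem_nhds t (sub_pos.2 hρt))
    filter_upwards [hnear.filter_mono nhdsWithin_le_nhds, self_mem_nhdsWithin] with s hs hst
    have hst' : s - t ≠ 0 := sub_ne_zero.2 hst
    have hd := hγ.2.2 t ht' s (Ioo_subset_Icc_self hs.1)
    have := hS.polar_rect_le_dist hN u (x := Φ.symm (γ t)) (y := Φ.symm (γ s)) hρ (by
      rw [Equiv.apply_symm_apply, Equiv.apply_symm_apply, hd, abs_sub_comm]
      have := hs.2
      simp only [r] at this
      linarith)
    rw [Equiv.apply_symm_apply, Equiv.apply_symm_apply, hd, sq_abs] at this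
    simp only [slope_def_field, div_pow]
    rw [mul_div_assoc', ← add_div, div_le_one (by positivity)]
    simp only [r, ψ]
    linarith [sq_abs (t - s), (by ring : (t - s) ^ 2 = (s - t) ^ 2)]
  have hrt : 0 < r t := hpos t ht'
  have hcont : Tendsto (fun ρ => deriv r t ^ 2 + G ρ ^ 2 * deriv ψ t ^ 2)
      (nhdsWithin (r t) (Iio (r t)))
      (nhds (deriv r t ^ 2 + G (r t) ^ 2 * deriv ψ t ^ 2)) :=
    (((((hS.1.hasDerivAt hrt).continuousAt.tendsto.mono_left nhdsWithin_le_nhds).pow 2).mul_const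
      _).const_add _)
  refine le_of_tendsto hcont ?_
  filter_upwards [Ioo_mem_nhdsLT hrt] with ρ hρ
  exact key ρ hρ.1 hρ.2

/-- The polar coordinates along a minimizing geodesic between two points of a half-plane bounded by
an axis through the centre. -/
lemma IsSphericallySymmetric.isMinProfile (hS : IsSphericallySymmetric p G Φ)
    (hN : NonposCurvWarping G) (hu : ‖u‖ = 1) (he : ‖e‖ = 1) (hue : ⟪u, e⟫ = 0) {x y : Euc n}
    (hxy : dist (Φ x) (Φ y) < ‖x‖ + ‖y‖) (hpos : 0 < dist (Φ x) (Φ y))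
    (hx : x = polarPoint u e ‖x‖ (angle u x)) (hy : y = polarPoint u e ‖y‖ (angle u y))
    {γ : ℝ → M} (hγ : IsMinGeodesicFromTo γ (Φ x) (Φ y)) :
    IsMinProfile G (dist (Φ x) (Φ y)) (fun s => ‖Φ.symm (γ s)‖)
      (fun s => angle u (Φ.symm (γ s))) := by
  obtain ⟨h1, h2, h3, h4⟩ := hS.polar_along_geodesic hN
    (by rwa [hS.2.2.1, hS.2.2.1]) hγ u
  refine ⟨h1, h2, h3, h4, fun ρ φ hρ hφ hp a1 a2 a3 a4 => ?_⟩
  have := hS.dist_polarPoint_le_integral hu he hue hpos hρ hφ hp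
  simp only [hγ.1, hγ.2.1, Equiv.symm_apply_apply] at a1 a2 a3 a4
  rwa [a1, a2, a3, a4, ← hx, ← hy] at this

lemma IsSphericallySymmetric.stewart [ProperSpace M] (hS : IsSphericallySymmetric p G Φ)
    (hN : NonposCurvWarping G) {x y z : M} (hxy : dist x y < dist x p + dist y p)
    (hz : dist x z + dist z y = dist x y) :
    dist x y * dist z p ^ 2 ≤ dist z y * dist x p ^ 2 + dist x z * dist y p ^ 2 -
      dist x z * dist z y * dist x y := by
  obtain ⟨a, rfl⟩ := Φ.surjective x
  obtain ⟨b, rfl⟩ := Φ.surjective y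
  have ha : 0 < ‖a‖ := by
    rw [norm_pos_iff]
    rintro rfl
    rw [hS.2.1, dist_self, zero_add, dist_comm] at hxy
    exact lt_irrefl _ hxy
  have hb : 0 < ‖b‖ := by
    rw [norm_pos_iff]
    rintro rfl
    rw [hS.2.1, dist_self, add_zero] at hxy
    exact lt_irrefl _ hxy
  rcases (dist_nonneg (x := Φ a) (y := z)).eq_or_lt with h0 | h0
  · have := dist_eq_zero.1 h0.symm
    subst this
    simp
  rcases (dist_nonneg (x := z) (y := Φ b)).eq_or_lt with h1 | h1
  · have := dist_eq_zero.1 h1.symm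
    subst this
    simp
  have hu : ‖‖a‖⁻¹ • a‖ = 1 := by rw [norm_smul, norm_inv, norm_norm, inv_mul_cancel₀ ha.ne']
  by_cases hπ : angle a b = Real.pi
  · exfalso
    obtain ⟨-, r, hr, rfl⟩ := angle_eq_pi_iff.1 hπ
    have := hS.norm_sub_le_dist hN a (r • a)
    rw [hS.2.2.1, hS.2.2.1] at hxy
    have h2 : ‖a - r • a‖ = (1 - r) * ‖a‖ := by
      rw [show a - r • a = (1 - r) • a by module, norm_smul, Real.norm_of_nonneg (by linarith)]
    rw [norm_smul, Real.norm_of_nonpos hr.le] at hxy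
    linarith
  by_cases h00 : angle a b = 0
  · obtain ⟨-, r, hr, rfl⟩ := angle_eq_zero_iff.1 h00
    have hd := hS.dist_radial hN hu ‖a‖ (r * ‖a‖)
    rw [smul_smul, smul_smul, mul_assoc, mul_inv_cancel₀ ha.ne', one_smul, mul_one] at hd
    have t1 := dist_triangle (Φ a) z p
    have t2 := dist_triangle z (Φ a) p
    have t3 := dist_triangle (Φ (r • a)) z p
    have t4 := dist_triangle z (Φ (r • a)) p
    rw [dist_comm z (Φ a)] at t2
    rw [dist_comm (Φ (r • a)) z] at t3
    simp only [hS.2.2.1, norm_smul, Real.norm_of_nonneg hr.le] at t1 t2 t3 t4 ⊢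
    rcases le_total ‖a‖ (r * ‖a‖) with hle | hle
    · rw [abs_of_nonpos (by linarith)] at hd
      rw [show dist z p = ‖a‖ + dist (Φ a) z by linarith,
        show r * ‖a‖ = ‖a‖ + dist (Φ a) z + dist z (Φ (r • a)) by linarith, ← hz]
      exact le_of_eq (by ring)
    · rw [abs_of_nonneg (by linarith)] at hd
      rw [show dist z p = ‖a‖ - dist (Φ a) z by linarith,
        show r * ‖a‖ = ‖a‖ - dist (Φ a) z - dist z (Φ (r • a)) by linarith, ← hz]
      exact le_of_eq (by ring)
  · obtain ⟨e, he, hue, hbe⟩ := exists_eq_polarPoint hu (norm_pos_iff.1 hb)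
      (by rwa [angle_smul_left_of_pos _ _ (by positivity)])
      (by rwa [angle_smul_left_of_pos _ _ (by positivity)])
    obtain ⟨γ, hγ, hγz⟩ := hS.exists_geodesic_through hN hz
    have hax : a = polarPoint (‖a‖⁻¹ • a) e ‖a‖ (angle (‖a‖⁻¹ • a) a) := by
      rw [angle_smul_left_of_pos _ _ (by positivity), angle_self (norm_pos_iff.1 ha),
        polarPoint_zero, smul_smul, mul_inv_cancel₀ ha.ne', one_smul]
    have hP := hS.isMinProfile hN hu he hue (by rwa [hS.2.2.1, hS.2.2.1] at hxy) (by linarith) hax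
      hbe hγ
    have := hP.stewart hS.1 hN (s := dist (Φ a) z) ⟨h0, by linarith⟩
    simp only [hγz, hγ.1, hγ.2.1, hS.norm_symm, Equiv.symm_apply_apply] at this
    rw [hS.2.2.1, hS.2.2.1]
    rw [show dist (Φ a) (Φ b) - dist (Φ a) z = dist z (Φ b) by linarith] at this
    exact this

end Profile

section Planar

variable {n : ℕ} {p : M} {G : ℝ → ℝ} {Φ : Euc n ≃ M} {u e : Euc n} {l t θ : ℝ}

lemma polarPoint_ne_zero (hu : ‖u‖ = 1) (he : ‖e‖ = 1) (hue : ⟪u, e⟫ = 0) (ht : 0 < t) (θ : ℝ) :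
    polarPoint u e t θ ≠ 0 := by
  rw [← norm_pos_iff, norm_polarPoint hu he hue ht.le]; exact ht

lemma IsSphericallySymmetric.dist_axis_polarPoint_lt (hS : IsSphericallySymmetric p G Φ)
    (hN : NonposCurvWarping G) (hu : ‖u‖ = 1) (he : ‖e‖ = 1) (hue : ⟪u, e⟫ = 0) (hl : 0 < l)
    (ht : 0 < t) (hθ : θ ∈ Ico 0 Real.pi) :
    dist (Φ (l • u)) (Φ (polarPoint u e t θ)) < l + t := by
  have := hS.dist_lt_add hN (x := l • u) (y := polarPoint u e t θ)
    (by rw [← polarPoint_zero u e]; exact polarPoint_ne_zero hu he hue hl 0)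
    (polarPoint_ne_zero hu he hue ht θ) (by
      rw [angle_smul_left_of_pos _ _ hl, angle_polarPoint hu he hue ht ⟨hθ.1, hθ.2.le⟩]
      exact hθ.2.ne)
  rwa [norm_polarPoint hu he hue ht.le, norm_smul, hu, mul_one, Real.norm_of_nonneg hl.le] at this

lemma IsSphericallySymmetric.dist_axis_polarPoint_pos (hu : ‖u‖ = 1)
    (he : ‖e‖ = 1) (hue : ⟪u, e⟫ = 0) (hl : 0 < l) (ht : 0 < t) (hθ : θ ∈ Ioo 0 Real.pi) :
    0 < dist (Φ (l • u)) (Φ (polarPoint u e t θ)) := by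
  refine dist_pos.2 fun h => hθ.1.ne ?_
  have := Φ.injective h
  rw [← angle_polarPoint hu he hue ht (Ioo_subset_Icc_self hθ), ← this,
    angle_smul_right_of_pos _ _ hl, angle_self (norm_pos_iff.1 (by rw [hu]; exact one_pos))]

lemma IsSphericallySymmetric.isMinProfile_axis (hS : IsSphericallySymmetric p G Φ)
    (hN : NonposCurvWarping G) (hu : ‖u‖ = 1) (he : ‖e‖ = 1) (hue : ⟪u, e⟫ = 0) (hl : 0 < l)
    (ht : 0 < t) (hθ : θ ∈ Ioo 0 Real.pi) {γ : ℝ → M}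
    (hγ : IsMinGeodesicFromTo γ (Φ (l • u)) (Φ (polarPoint u e t θ))) :
    IsMinProfile G (dist (Φ (l • u)) (Φ (polarPoint u e t θ))) (fun s => ‖Φ.symm (γ s)‖)
      (fun s => angle u (Φ.symm (γ s))) := by
  have hn : ‖l • u‖ = l := by rw [norm_smul, hu, mul_one, Real.norm_of_nonneg hl.le]
  refine hS.isMinProfile hN hu he hue ?_ (dist_axis_polarPoint_pos hu he hue hl ht hθ) ?_ ?_ hγ
  · rw [hn, norm_polarPoint hu he hue ht.le]
    exact hS.dist_axis_polarPoint_lt hN hu he hue hl ht ⟨hθ.1.le, hθ.2⟩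
  · rw [hn, angle_smul_right_of_pos _ _ hl, angle_self (norm_pos_iff.1 (by rw [hu]; exact one_pos)),
      polarPoint_zero]
  · rw [norm_polarPoint hu he hue ht.le, angle_polarPoint hu he hue ht (Ioo_subset_Icc_self hθ)]

/-- The profile of the minimizing geodesic from the axis to a point with polar coordinates `(t, θ)`
is unique, and it is the same in all half-planes bounded by the axis. -/
lemma IsSphericallySymmetric.exists_profile [ProperSpace M] (hS : IsSphericallySymmetric p G Φ)
    (hN : NonposCurvWarping G) (hu : ‖u‖ = 1) (he : ‖e‖ = 1) (hue : ⟪u, e⟫ = 0) (hl : 0 < l)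
    (ht : 0 < t) (hθ : θ ∈ Ioo 0 Real.pi) :
    ∃ (L : ℝ) (r ψ : ℝ → ℝ), 0 < L ∧ IsMinProfile G L r ψ ∧ r 0 = l ∧ r L = t ∧ ψ 0 = 0 ∧
      ψ L = θ ∧ ∀ e' : Euc n, ‖e'‖ = 1 → ⟪u, e'⟫ = 0 →
        dist (Φ (l • u)) (Φ (polarPoint u e' t θ)) = L ∧
        (∀ z, dist (Φ (l • u)) z + dist z (Φ (polarPoint u e' t θ)) = L →
          dist z p = r (dist (Φ (l • u)) z) ∧
            angle u (Φ.symm z) = ψ (dist (Φ (l • u)) z)) ∧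
        ∀ s ∈ Icc 0 L, dist (Φ (l • u)) (Φ (polarPoint u e' (r s) (ψ s))) = s ∧
          dist (Φ (polarPoint u e' (r s) (ψ s))) (Φ (polarPoint u e' t θ)) = L - s := by
  have hu0 : angle u (l • u) = 0 := by
    rw [angle_smul_right_of_pos _ _ hl, angle_self (norm_pos_iff.1 (by rw [hu]; exact one_pos))]
  have hn : ‖l • u‖ = l := by rw [norm_smul, hu, mul_one, Real.norm_of_nonneg hl.le]
  have hprof : ∀ e' : Euc n, ‖e'‖ = 1 → ⟪u, e'⟫ = 0 → ∀ γ : ℝ → M,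
      IsMinGeodesicFromTo γ (Φ (l • u)) (Φ (polarPoint u e' t θ)) →
      ∃ (r ψ : ℝ → ℝ), IsMinProfile G (dist (Φ (l • u)) (Φ (polarPoint u e' t θ))) r ψ ∧
        r 0 = l ∧ r (dist (Φ (l • u)) (Φ (polarPoint u e' t θ))) = t ∧ ψ 0 = 0 ∧
        ψ (dist (Φ (l • u)) (Φ (polarPoint u e' t θ))) = θ ∧
        ∀ s, dist (γ s) p = r s ∧ angle u (Φ.symm (γ s)) = ψ s := by
    intro e' he' hue' γ hγ
    refine ⟨_, _, hS.isMinProfile_axis hN hu he' hue' hl ht hθ hγ, ?_, ?_, ?_, ?_, fun s =>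
      ⟨(hS.norm_symm _).symm, rfl⟩⟩
    · simp only [hγ.1, Equiv.symm_apply_apply, hn]
    · simp only [hγ.2.1, Equiv.symm_apply_apply, norm_polarPoint hu he' hue' ht.le]
    · simp only [hγ.1, Equiv.symm_apply_apply, hu0]
    · simp only [hγ.2.1, Equiv.symm_apply_apply,
        angle_polarPoint hu he' hue' ht (Ioo_subset_Icc_self hθ)]
  have hle : ∀ (e' : Euc n), ‖e'‖ = 1 → ⟪u, e'⟫ = 0 → ∀ (L : ℝ) (r ψ : ℝ → ℝ), 0 ≤ L →
      IsMinProfile G L r ψ → r 0 = l → r L = t → ψ 0 = 0 → ψ L = θ → ∀ s ∈ Icc 0 L,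
      dist (Φ (l • u)) (Φ (polarPoint u e' (r s) (ψ s))) ≤ s ∧
        dist (Φ (polarPoint u e' (r s) (ψ s))) (Φ (polarPoint u e' t θ)) ≤ L - s := by
    intro e' he' hue' L r ψ hL hP h1 h2 h3 h4 s hs
    have b1 := hS.dist_polarPoint_le_sub hu he' hue' hP.lip_r hP.lip_ψ hP.pos hP.speed le_rfl
      hs.1 hs.2
    have b2 := hS.dist_polarPoint_le_sub hu he' hue' hP.lip_r hP.lip_ψ hP.pos hP.speed hs.1
      hs.2 le_rfl
    rw [h1, h3, polarPoint_zero, sub_zero] at b1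
    rw [h2, h4] at b2
    exact ⟨b1, b2⟩
  have hdle : ∀ e₁ e₂ : Euc n, ‖e₁‖ = 1 → ⟪u, e₁⟫ = 0 → ‖e₂‖ = 1 → ⟪u, e₂⟫ = 0 →
      dist (Φ (l • u)) (Φ (polarPoint u e₂ t θ)) ≤
        dist (Φ (l • u)) (Φ (polarPoint u e₁ t θ)) := by
    intro e₁ e₂ h1 h1' h2 h2'
    obtain ⟨γ, hγ⟩ := hS.exists_geodesic hN (Φ (l • u)) (Φ (polarPoint u e₁ t θ))
    obtain ⟨r, ψ, hP, a1, a2, a3, a4, -⟩ := hprof e₁ h1 h1' γ hγ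
    have := (hle e₂ h2 h2' _ r ψ dist_nonneg hP a1 a2 a3 a4 _ ⟨dist_nonneg, le_rfl⟩).1
    rwa [a2, a4] at this
  have hL := dist_axis_polarPoint_pos (Φ := Φ) hu he hue hl ht hθ
  obtain ⟨γ, hγ⟩ := hS.exists_geodesic hN (Φ (l • u)) (Φ (polarPoint u e t θ))
  obtain ⟨r, ψ, hP, a1, a2, a3, a4, -⟩ := hprof e he hue γ hγ
  refine ⟨_, r, ψ, hL, hP, a1, a2, a3, a4, fun e' he' hue' => ?_⟩
  have hd : dist (Φ (l • u)) (Φ (polarPoint u e' t θ)) =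
      dist (Φ (l • u)) (Φ (polarPoint u e t θ)) :=
    le_antisymm (hdle _ _ he hue he' hue') (hdle _ _ he' hue' he hue)
  refine ⟨hd, fun z hz => ?_, fun s hs => ?_⟩
  · obtain ⟨γ', hγ', hγz⟩ := hS.exists_geodesic_through hN (hz.trans hd.symm)
    obtain ⟨r', ψ', hP', b1, b2, b3, b4, b5⟩ := hprof e' he' hue' γ' hγ'
    rw [hd] at hP' b2 b4
    have hmem : dist (Φ (l • u)) z ∈ Icc 0 (dist (Φ (l • u)) (Φ (polarPoint u e t θ))) :=
      ⟨dist_nonneg, by linarith [dist_nonneg (x := z) (y := Φ (polarPoint u e' t θ))]⟩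
    have := b5 (dist (Φ (l • u)) z)
    rw [hγz] at this
    rw [hP.eqOn_radius hS.1 hN hL hP' (a1.trans b1.symm) (a2.trans b2.symm) _ hmem,
      hP.eqOn_angle hS.1 hN hL hP' (a1.trans b1.symm) (a2.trans b2.symm) (a3.trans b3.symm)
        (a4.trans b4.symm) _ hmem]
    exact this
  · obtain ⟨c1, c2⟩ := hle e' he' hue' _ r ψ hL.le hP a1 a2 a3 a4 s hs
    have := dist_triangle (Φ (l • u)) (Φ (polarPoint u e' (r s) (ψ s)))
      (Φ (polarPoint u e' t θ))
    exact ⟨by linarith, by linarith⟩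

end Planar

section Boundary

variable {n : ℕ} {p q : M} {G : ℝ → ℝ} {Φ : Euc n ≃ M} {u e θ : Euc n} {l lam t φ : ℝ}

/-- The radial function of the star-shaped set `Ω_1`. -/
def boundaryRadius (p q : M) (lam : ℝ) (Φ : Euc n ≃ M) (θ : Euc n) : ℝ :=
  sSup {r : ℝ | Φ (r • θ) ∈ OmegaSeq p q lam 1}

lemma IsSphericallySymmetric.dist_radial_le (hS : IsSphericallySymmetric p G Φ)
    (hN : NonposCurvWarping G) (hθ : ‖θ‖ = 1) (r s : ℝ) :
    dist q (Φ (r • θ)) ≤ dist q (Φ (s • θ)) + |r - s| := by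
  have := dist_triangle_right q (Φ (r • θ)) (Φ (s • θ))
  rwa [hS.dist_radial hN hθ] at this

lemma IsSphericallySymmetric.boundaryRadius_spec [ProperSpace M]
    (hS : IsSphericallySymmetric p G Φ) (hN : NonposCurvWarping G) (hq : q ≠ p) (hlam : 1 < lam)
    (hθ : ‖θ‖ = 1) :
    0 < boundaryRadius p q lam Φ θ ∧
      dist q (Φ (boundaryRadius p q lam Φ θ • θ)) = lam * boundaryRadius p q lam Φ θ ∧
      (∀ r, 0 ≤ r → (lam * r < dist q (Φ (r • θ)) ↔ r < boundaryRadius p q lam Φ θ)) ∧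
      boundaryRadius p q lam Φ θ ≤ dist q p / (lam - 1) := by
  have hl : 0 < dist q p := dist_pos.2 hq
  have hlam' : 0 < lam - 1 := sub_pos.2 hlam
  have hle := fun r s => hS.dist_radial_le (q := q) hN hθ r s
  have h00 : dist q (Φ ((0 : ℝ) • θ)) = dist q p := by rw [zero_smul, hS.2.1]
  have hcont : ContinuousOn (fun r => dist q (Φ (r • θ)) - lam * r)
      (Icc 0 (dist q p / (lam - 1))) :=
    ((continuous_const.dist ((hS.continuous hN).comp (by fun_prop))).sub
      (by fun_prop)).continuousOn
  have hR : 0 ≤ dist q p / (lam - 1) := by positivity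
  obtain ⟨f, hf, hf0⟩ := intermediate_value_Icc' hR hcont (show (0 : ℝ) ∈ _ by
    refine ⟨?_, by rw [h00]; simp⟩
    have := hle (dist q p / (lam - 1)) 0
    rw [h00, sub_zero, abs_of_nonneg hR] at this
    have h2 : lam * (dist q p / (lam - 1)) = dist q p / (lam - 1) + dist q p := by
      field_simp
      ring
    linarith)
  simp only at hf0
  have hfpos : 0 < f := by
    refine lt_of_le_of_ne hf.1 ?_
    rintro rfl
    rw [h00, mul_zero, sub_zero] at hf0
    exact hl.ne' hf0
  have hiff : ∀ r, 0 ≤ r → (lam * r < dist q (Φ (r • θ)) ↔ r < f) := by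
    intro r hr
    constructor
    · intro h
      by_contra! hlt
      have := hle r f
      rw [abs_of_nonneg (sub_nonneg.2 hlt)] at this
      nlinarith
    · intro h
      have := hle f r
      rw [abs_of_nonneg (sub_nonneg.2 h.le)] at this
      nlinarith
  have hmem : ∀ r : ℝ, Φ (r • θ) ∈ OmegaSeq p q lam 1 ↔ lam * |r| < dist q (Φ (r • θ)) := by
    intro r
    rw [hS.mem_omegaSeq_one hN (by linarith), hS.2.2.1, norm_smul, hθ, mul_one, Real.norm_eq_abs]
  have hf_eq : boundaryRadius p q lam Φ θ = f := by
    refine IsLUB.csSup_eq ⟨fun r hr => ?_, fun b hb => ?_⟩ ⟨0, ?_⟩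
    · rcases le_total r 0 with h | h
      · exact h.trans hf.1
      · exact ((hiff r h).1 (by rwa [mem_ofPred_eq, hmem, abs_of_nonneg h] at hr)).le
    · refine le_of_forall_lt_imp_le_of_dense fun r hr => ?_
      rcases lt_or_ge r 0 with h | h
      · refine h.le.trans (hb ?_)
        rw [mem_ofPred_eq, hmem, abs_zero]
        exact (hiff 0 le_rfl).2 hfpos
      · refine hb ?_
        rw [mem_ofPred_eq, hmem, abs_of_nonneg h]
        exact (hiff r h).2 hr
    · rw [mem_ofPred_eq, hmem, abs_zero]
      exact (hiff 0 le_rfl).2 hfpos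
  rw [hf_eq]
  exact ⟨hfpos, by linarith, hiff, hf.2⟩

lemma IsSphericallySymmetric.eq_boundaryRadius [ProperSpace M]
    (hS : IsSphericallySymmetric p G Φ) (hN : NonposCurvWarping G) (hq : q ≠ p) (hlam : 1 < lam)
    (hθ : ‖θ‖ = 1) (ht : 0 ≤ t) (h : dist q (Φ (t • θ)) = lam * t) :
    t = boundaryRadius p q lam Φ θ := by
  obtain ⟨h1, h2, h3, -⟩ := hS.boundaryRadius_spec hN hq hlam hθ
  refine le_antisymm ?_ (not_lt.1 fun hlt => ((h3 t ht).2 hlt).ne' h)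
  by_contra! hlt
  have := hS.dist_radial_le (q := q) hN hθ t (boundaryRadius p q lam Φ θ)
  rw [abs_of_nonneg (sub_nonneg.2 hlt.le), h, h2] at this
  nlinarith

/-- No point between `q` and `x` lies in `Ω_1`. -/
def SeesPoint (p q : M) (lam : ℝ) (x : M) : Prop :=
  ∀ z, dist q z + dist z x = dist q x → dist q z ≤ lam * dist z p

lemma smul_polarPoint_one (u e : Euc n) (r φ : ℝ) :
    r • polarPoint u e 1 φ = polarPoint u e r φ := by
  simp [polarPoint]

lemma IsSphericallySymmetric.sees_iff_sees_polarPoint [ProperSpace M]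
    (hS : IsSphericallySymmetric p G Φ) (hN : NonposCurvWarping G) (hlam : 1 < lam)
    (hu : ‖u‖ = 1) (hl : 0 < l) (he : ‖e‖ = 1) (hue : ⟪u, e⟫ = 0) (hθ : ‖θ‖ = 1)
    (hφ : angle u θ ∈ Ioo 0 Real.pi) :
    SeesPoint p (Φ (l • u)) lam (Φ (boundaryRadius p (Φ (l • u)) lam Φ θ • θ)) ↔
      SeesPoint p (Φ (l • u)) lam
        (Φ (polarPoint u e (boundaryRadius p (Φ (l • u)) lam Φ (polarPoint u e 1 (angle u θ)))
          (angle u θ))) := by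
  have hq : Φ (l • u) ≠ p := by
    rw [← hS.2.1]
    refine Φ.injective.ne ?_
    rw [← norm_pos_iff, norm_smul, hu, mul_one, Real.norm_of_nonneg hl.le]
    exact hl
  obtain ⟨e', he', hue', hθe⟩ := exists_eq_polarPoint hu
    (norm_pos_iff.1 (by rw [hθ]; exact one_pos)) hφ.1.ne' hφ.2.ne
  rw [hθ] at hθe
  set φ := angle u θ
  have key : ∀ e₁ e₂ : Euc n, ‖e₁‖ = 1 → ⟪u, e₁⟫ = 0 → ‖e₂‖ = 1 → ⟪u, e₂⟫ = 0 →
      SeesPoint p (Φ (l • u)) lam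
        (Φ (boundaryRadius p (Φ (l • u)) lam Φ (polarPoint u e₁ 1 φ) • polarPoint u e₁ 1 φ)) →
      SeesPoint p (Φ (l • u)) lam
        (Φ (boundaryRadius p (Φ (l • u)) lam Φ (polarPoint u e₂ 1 φ) • polarPoint u e₂ 1 φ)) := by
    intro e₁ e₂ h1 h1' h2 h2' hsee z hz
    obtain ⟨f1, f2, -, -⟩ := hS.boundaryRadius_spec hN hq hlam
      (norm_polarPoint hu h1 h1' zero_le_one φ)
    set f := boundaryRadius p (Φ (l • u)) lam Φ (polarPoint u e₁ 1 φ)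
    obtain ⟨L, r, ψ, hL, hP, -, -, -, -, hall⟩ := hS.exists_profile hN hu h1 h1' hl f1 hφ
    obtain ⟨d1, -, d3⟩ := hall e₁ h1 h1'
    obtain ⟨d1', d2', -⟩ := hall e₂ h2 h2'
    have hf : f = boundaryRadius p (Φ (l • u)) lam Φ (polarPoint u e₂ 1 φ) := by
      refine hS.eq_boundaryRadius hN hq hlam (norm_polarPoint hu h2 h2' zero_le_one φ) f1.le ?_
      rw [smul_polarPoint_one, d1', ← d1, ← smul_polarPoint_one, f2]
    rw [← hf, smul_polarPoint_one, d1'] at hz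
    have hmem : dist (Φ (l • u)) z ∈ Icc 0 L :=
      ⟨dist_nonneg, by linarith [dist_nonneg (x := z) (y := Φ (polarPoint u e₂ f φ))]⟩
    obtain ⟨g1, g2⟩ := d3 _ hmem
    have := hsee (Φ (polarPoint u e₁ (r (dist (Φ (l • u)) z)) (ψ (dist (Φ (l • u)) z))))
      (by rw [smul_polarPoint_one, g1, g2, d1]; ring)
    rw [g1, hS.2.2.1, norm_polarPoint hu h1 h1' (hP.pos _ hmem).le] at this
    rwa [(d2' z hz).1]
  rw [← smul_polarPoint_one]
  conv_lhs => rw [hθe]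
  exact ⟨key _ _ he' hue' he hue, key _ _ he hue he' hue'⟩

end Boundary

section Plane

variable {n : ℕ} {p : M} {G : ℝ → ℝ} {Φ : Euc n ≃ M} {u e : Euc n} {l lam φ : ℝ}

/-- The radius at which the ray of angle `φ` in the half-plane `(u, e)` leaves `Ω_1`. -/
def planeRadius (p : M) (lam : ℝ) (Φ : Euc n ≃ M) (u e : Euc n) (l φ : ℝ) : ℝ :=
  boundaryRadius p (Φ (l • u)) lam Φ (polarPoint u e 1 φ)

/-- The boundary point of `Ω_1` at angle `φ` in the half-plane `(u, e)` is visible. -/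
def VisibleAngle (p : M) (lam : ℝ) (Φ : Euc n ≃ M) (u e : Euc n) (l φ : ℝ) : Prop :=
  SeesPoint p (Φ (l • u)) lam (Φ (polarPoint u e (planeRadius p lam Φ u e l φ) φ))

lemma IsSphericallySymmetric.dist_axis (hS : IsSphericallySymmetric p G Φ) (hu : ‖u‖ = 1)
    (hl : 0 < l) : dist (Φ (l • u)) p = l := by
  rw [hS.2.2.1, norm_smul, hu, mul_one, Real.norm_of_nonneg hl.le]

lemma IsSphericallySymmetric.axis_ne (hS : IsSphericallySymmetric p G Φ) (hu : ‖u‖ = 1)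
    (hl : 0 < l) : Φ (l • u) ≠ p := dist_pos.1 (by rwa [hS.dist_axis hu hl])

lemma IsSphericallySymmetric.dist_polarPoint (hS : IsSphericallySymmetric p G Φ)
    (hu : ‖u‖ = 1) (he : ‖e‖ = 1) (hue : ⟪u, e⟫ = 0) {t : ℝ} (ht : 0 ≤ t) (φ : ℝ) :
    dist (Φ (polarPoint u e t φ)) p = t := by
  rw [hS.2.2.1, norm_polarPoint hu he hue ht]

lemma IsSphericallySymmetric.planeRadius_spec [ProperSpace M]
    (hS : IsSphericallySymmetric p G Φ) (hN : NonposCurvWarping G) (hlam : 1 < lam)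
    (hu : ‖u‖ = 1) (he : ‖e‖ = 1) (hue : ⟪u, e⟫ = 0) (hl : 0 < l) (φ : ℝ) :
    0 < planeRadius p lam Φ u e l φ ∧
      dist (Φ (l • u)) (Φ (polarPoint u e (planeRadius p lam Φ u e l φ) φ)) =
        lam * planeRadius p lam Φ u e l φ ∧
      (∀ r, 0 ≤ r → (lam * r < dist (Φ (l • u)) (Φ (polarPoint u e r φ)) ↔
        r < planeRadius p lam Φ u e l φ)) ∧
      planeRadius p lam Φ u e l φ ≤ l / (lam - 1) := by
  have := hS.boundaryRadius_spec hN (hS.axis_ne hu hl) hlam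
    (norm_polarPoint hu he hue zero_le_one φ)
  simpa only [planeRadius, smul_polarPoint_one, hS.dist_axis hu hl] using this

lemma IsSphericallySymmetric.eq_planeRadius [ProperSpace M]
    (hS : IsSphericallySymmetric p G Φ) (hN : NonposCurvWarping G) (hlam : 1 < lam)
    (hu : ‖u‖ = 1) (he : ‖e‖ = 1) (hue : ⟪u, e⟫ = 0) (hl : 0 < l) {r : ℝ} (hr : 0 ≤ r)
    (h : dist (Φ (l • u)) (Φ (polarPoint u e r φ)) = lam * r) :
    r = planeRadius p lam Φ u e l φ :=
  hS.eq_boundaryRadius hN (hS.axis_ne hu hl) hlam (norm_polarPoint hu he hue zero_le_one φ) hr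
    (by rwa [smul_polarPoint_one])

lemma IsSphericallySymmetric.law_of_cosines_le (hS : IsSphericallySymmetric p G Φ)
    (hN : NonposCurvWarping G) (hu : ‖u‖ = 1) (he : ‖e‖ = 1) (hue : ⟪u, e⟫ = 0) (l r φ : ℝ) :
    l ^ 2 + r ^ 2 - 2 * l * r * Real.cos φ ≤
      dist (Φ (l • u)) (Φ (polarPoint u e r φ)) ^ 2 := by
  have h := pow_le_pow_left₀ (norm_nonneg _)
    (hS.norm_sub_le_dist hN (l • u) (polarPoint u e r φ)) 2
  refine le_trans (le_of_eq ?_) h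
  rw [polarPoint_eq_comb, show l • u - ((r * Real.cos φ) • u + (r * Real.sin φ) • e) =
    (l - r * Real.cos φ) • u + (-(r * Real.sin φ)) • e by module, norm_comb hu he hue]
  linear_combination (-r ^ 2) * Real.sin_sq_add_cos_sq φ

lemma IsSphericallySymmetric.exists_visibleAngle [ProperSpace M]
    (hS : IsSphericallySymmetric p G Φ) (hN : NonposCurvWarping G) (hlam : 1 < lam)
    (hu : ‖u‖ = 1) (he : ‖e‖ = 1) (hue : ⟪u, e⟫ = 0) (hl : 0 < l) :
    ∃ φ ∈ Ioo 0 Real.pi, VisibleAngle p lam Φ u e l φ := by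
  have hπ := Real.pi_pos
  obtain ⟨f1, -, f3, -⟩ := hS.planeRadius_spec hN hlam hu he hue hl (Real.pi / 2)
  set f := planeRadius p lam Φ u e l (Real.pi / 2)
  have hlt := (f3 (f / 2) (by positivity)).2 (by linarith)
  obtain ⟨L, r, ψ, hL, hP, r0, rL, ψ0, ψL, hall⟩ := hS.exists_profile hN hu he hue hl
    (half_pos f1) (θ := Real.pi / 2) ⟨by linarith, by linarith⟩
  obtain ⟨d1, d2, d3⟩ := hall e he hue
  rw [d1] at hlt
  have hcont : ContinuousOn (fun s => lam * r s - s) (Icc 0 L) :=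
    (hP.lip_r.continuousOn.const_mul _).sub continuousOn_id
  have hcomp : IsCompact (Icc 0 L ∩ (fun s => lam * r s - s) ⁻¹' Iic 0) :=
    isCompact_Icc.of_isClosed_subset
      (hcont.preimage_isClosed_of_isClosed isClosed_Icc isClosed_Iic) inter_subset_left
  obtain ⟨s, ⟨hs, hs0⟩, hmin⟩ := hcomp.exists_isLeast
    ⟨L, ⟨hL.le, le_rfl⟩, by simp only [mem_preimage, mem_Iic, rL]; linarith⟩
  have hbelow : ∀ s' ∈ Icc 0 s, s' ≤ lam * r s' := by
    intro s' hs'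
    rcases hs'.2.eq_or_lt with rfl | hlt'
    · obtain ⟨s₂, hs₂, h0⟩ := intermediate_value_Icc' hs.1 (hcont.mono (Icc_subset_Icc_right hs.2))
        (show (0 : ℝ) ∈ _ from ⟨hs0, by simp only [r0]; nlinarith⟩)
      have := hmin ⟨⟨hs₂.1, hs₂.2.trans hs.2⟩, h0.le⟩
      rw [le_antisymm hs₂.2 this] at h0
      simp only at h0
      linarith
    · by_contra! hc
      exact absurd (hmin ⟨⟨hs'.1, hs'.2.trans hs.2⟩, by
        simp only [mem_preimage, mem_Iic]; linarith⟩) (not_le.2 hlt')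
  have hspos : 0 < s := by
    refine lt_of_le_of_ne hs.1 ?_
    rintro rfl
    simp only [mem_preimage, mem_Iic, r0] at hs0
    nlinarith
  have hmono := hP.strictMonoOn_angle hS.1 hL (by rw [ψ0, ψL]; linarith)
  have hψ1 : 0 < ψ s := ψ0 ▸ hmono ⟨le_rfl, hL.le⟩ hs hspos
  have hψ2 : ψ s ≤ Real.pi / 2 := ψL ▸ hmono.monotoneOn hs ⟨hL.le, le_rfl⟩ hs.2
  obtain ⟨g1, g2⟩ := d3 s hs
  have hr : r s = planeRadius p lam Φ u e l (ψ s) := by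
    refine hS.eq_planeRadius hN hlam hu he hue hl (hP.pos s hs).le ?_
    rw [g1]
    have := hbelow s ⟨hs.1, le_rfl⟩
    simp only [mem_preimage, mem_Iic] at hs0
    linarith
  refine ⟨ψ s, ⟨hψ1, by linarith⟩, fun z hz => ?_⟩
  rw [← hr, g1] at hz
  have hzL : dist (Φ (l • u)) z + dist z (Φ (polarPoint u e (f / 2) (Real.pi / 2))) = L := by
    have t1 := dist_triangle z (Φ (polarPoint u e (r s) (ψ s)))
      (Φ (polarPoint u e (f / 2) (Real.pi / 2)))
    have t2 := dist_triangle (Φ (l • u)) z (Φ (polarPoint u e (f / 2) (Real.pi / 2)))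
    linarith
  rw [(d2 z hzL).1]
  exact hbelow _ ⟨dist_nonneg, by
    linarith [dist_nonneg (x := z) (y := Φ (polarPoint u e (r s) (ψ s)))]⟩

lemma IsSphericallySymmetric.visibleAngle_le_pi_div_two [ProperSpace M]
    (hS : IsSphericallySymmetric p G Φ) (hN : NonposCurvWarping G) (hlam : 1 < lam)
    (hu : ‖u‖ = 1) (he : ‖e‖ = 1) (hue : ⟪u, e⟫ = 0) (hl : 0 < l) (hφ : φ ∈ Ioo 0 Real.pi)
    (hV : VisibleAngle p lam Φ u e l φ) : φ ≤ Real.pi / 2 := by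
  by_contra! hgt
  have hcos : Real.cos φ < 0 := Real.cos_neg_of_pi_div_two_lt_of_lt hgt
    (by linarith [hφ.2, Real.pi_pos])
  unfold VisibleAngle at hV
  obtain ⟨f1, f2, -, -⟩ := hS.planeRadius_spec hN hlam hu he hue hl φ
  set f := planeRadius p lam Φ u e l φ
  have hcosine := hS.law_of_cosines_le hN hu he hue l f φ
  obtain ⟨L, r, ψ, hL, hP, r0, rL, -, -, hall⟩ := hS.exists_profile hN hu he hue hl f1 hφ
  obtain ⟨d1, d2, d3⟩ := hall e he hue
  rw [d1] at f2 hcosine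
  have hlf : 0 < l * f * -Real.cos φ := mul_pos (mul_pos hl f1) (neg_pos.2 hcos)
  have hlam2 : 0 < lam ^ 2 - 1 := by nlinarith
  have hbig : lam ^ 2 * l ^ 2 / ((lam ^ 2 - 1) * L) < L := by
    rw [div_lt_iff₀ (by positivity)]
    have : l ^ 2 + f ^ 2 < lam ^ 2 * f ^ 2 := by rw [f2] at hcosine; nlinarith
    rw [f2]
    nlinarith
  obtain ⟨s, hs1, hs2⟩ := exists_between hbig
  have hs0 : 0 < s := lt_of_le_of_lt (by positivity) hs1
  rw [div_lt_iff₀ (by positivity)] at hs1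
  have hst := hP.stewart hS.1 hN ⟨hs0, hs2⟩
  obtain ⟨g1, g2⟩ := d3 s ⟨hs0.le, hs2.le⟩
  have hv := hV (Φ (polarPoint u e (r s) (ψ s))) (by rw [g1, g2, d1]; ring)
  have hrs := hP.pos s ⟨hs0.le, hs2.le⟩
  rw [g1, hS.dist_polarPoint hu he hue hrs.le] at hv
  rw [r0, rL] at hst
  have h1 : s ^ 2 ≤ lam ^ 2 * r s ^ 2 := by
    rw [← mul_pow]; exact pow_le_pow_left₀ hs0.le hv 2
  have h2 : L * s ^ 2 ≤ lam ^ 2 * ((L - s) * l ^ 2 + s * f ^ 2 - s * (L - s) * L) := by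
    have := mul_le_mul_of_nonneg_left hst (sq_nonneg lam)
    have := mul_le_mul_of_nonneg_left h1 hL.le
    linarith
  have h3 : (L - s) * (s * ((lam ^ 2 - 1) * L) - lam ^ 2 * l ^ 2) ≤ 0 := by
    have : lam ^ 2 * f ^ 2 = L ^ 2 := by rw [f2]; ring
    nlinarith
  nlinarith

end Plane

section Crossing

variable {n : ℕ} {p : M} {G : ℝ → ℝ} {Φ : Euc n ≃ M} {u e : Euc n} {l lam t φ φ₁ φ₂ : ℝ}

/-- The ray of angle `φ₂` meets the geodesic joining the axis point of radius `l` to the point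
with polar coordinates `(t, φ₁)` at radius `ρ`. -/
def CrossesAt (Φ : Euc n ≃ M) (u e : Euc n) (l φ₁ φ₂ ρ t : ℝ) : Prop :=
  dist (Φ (l • u)) (Φ (polarPoint u e ρ φ₂)) +
      dist (Φ (polarPoint u e ρ φ₂)) (Φ (polarPoint u e t φ₁)) =
    dist (Φ (l • u)) (Φ (polarPoint u e t φ₁))

lemma continuous_polarPoint (u e : Euc n) :
    Continuous fun x : ℝ × ℝ => polarPoint u e x.1 x.2 := by
  unfold polarPoint
  fun_prop

lemma IsSphericallySymmetric.isClosed_crossesAt [ProperSpace M]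
    (hS : IsSphericallySymmetric p G Φ)
    (hN : NonposCurvWarping G) (u e : Euc n) (l φ₁ φ₂ : ℝ) :
    IsClosed {x : ℝ × ℝ | CrossesAt Φ u e l φ₁ φ₂ x.2 x.1} := by
  have h : ∀ φ : ℝ, Continuous fun r : ℝ => Φ (polarPoint u e r φ) := fun φ =>
    (hS.continuous hN).comp ((continuous_polarPoint u e).comp (by fun_prop :
      Continuous fun r : ℝ => (r, φ)))
  have h1 := (h φ₁).comp (continuous_fst (X := ℝ) (Y := ℝ))
  have h2 := (h φ₂).comp (continuous_snd (X := ℝ) (Y := ℝ))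
  exact isClosed_eq ((continuous_const.dist h2).add (h2.dist h1)) (continuous_const.dist h1)

lemma IsSphericallySymmetric.exists_crossesAt [ProperSpace M]
    (hS : IsSphericallySymmetric p G Φ) (hN : NonposCurvWarping G)
    (hu : ‖u‖ = 1) (he : ‖e‖ = 1) (hue : ⟪u, e⟫ = 0) (hl : 0 < l) (h₂ : 0 < φ₂) (h₂₁ : φ₂ < φ₁)
    (h₁ : φ₁ < Real.pi) (ht : 0 ≤ t) :
    ∃ ρ ∈ Icc 0 (t + 2 * l), CrossesAt Φ u e l φ₁ φ₂ ρ t := by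
  rcases ht.eq_or_lt with rfl | ht
  · refine ⟨0, ⟨le_rfl, by linarith⟩, ?_⟩
    simp [CrossesAt, polarPoint]
  obtain ⟨L, r, ψ, hL, hP, r0, rL, ψ0, ψL, hall⟩ := hS.exists_profile hN hu he hue hl ht
    (θ := φ₁) ⟨h₂.trans h₂₁, h₁⟩
  obtain ⟨d1, d2, d3⟩ := hall e he hue
  obtain ⟨s, hs, hsψ⟩ := intermediate_value_Icc hL.le hP.lip_ψ.continuousOn
    (show φ₂ ∈ _ from ⟨ψ0.symm ▸ h₂.le, ψL.symm ▸ h₂₁.le⟩)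
  obtain ⟨g1, g2⟩ := d3 s hs
  have hrs := hP.pos s hs
  have hdL := hS.dist_axis_polarPoint_lt hN hu he hue hl ht (θ := φ₁) ⟨(h₂.trans h₂₁).le, h₁⟩
  have htri := dist_triangle_left (Φ (polarPoint u e (r s) (ψ s))) p (Φ (l • u))
  rw [hS.dist_polarPoint hu he hue hrs.le, g1, hS.dist_axis hu hl] at htri
  refine ⟨r s, ⟨hrs.le, by linarith [hs.2]⟩, ?_⟩
  rw [CrossesAt, ← hsψ, g1, g2, d1]
  ring

lemma IsSphericallySymmetric.crossesAt_pos [ProperSpace M]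
    (hS : IsSphericallySymmetric p G Φ)
    (hN : NonposCurvWarping G) (hu : ‖u‖ = 1) (he : ‖e‖ = 1) (hue : ⟪u, e⟫ = 0) (hl : 0 < l)
    (h₁ : φ₁ ∈ Ioo 0 Real.pi) (ht : 0 < t) {ρ : ℝ} (hρ : 0 ≤ ρ)
    (h : CrossesAt Φ u e l φ₁ φ₂ ρ t) : 0 < ρ := by
  have := hS.norm_pos_of_between (x := Φ (l • u)) (y := Φ (polarPoint u e t φ₁)) (by
    rw [hS.dist_axis hu hl, hS.dist_polarPoint hu he hue ht.le]
    exact hS.dist_axis_polarPoint_lt hN hu he hue hl ht ⟨h₁.1.le, h₁.2⟩) h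
  rwa [Equiv.symm_apply_apply, norm_polarPoint hu he hue hρ] at this

lemma IsSphericallySymmetric.crossesAt_unique [ProperSpace M]
    (hS : IsSphericallySymmetric p G Φ)
    (hN : NonposCurvWarping G) (hu : ‖u‖ = 1) (he : ‖e‖ = 1) (hue : ⟪u, e⟫ = 0) (hl : 0 < l)
    (h₂ : φ₂ ∈ Icc 0 Real.pi) (h₁ : φ₁ ∈ Ioo 0 Real.pi) (ht : 0 < t) {ρ ρ' : ℝ} (hρ : 0 ≤ ρ)
    (hρ' : 0 ≤ ρ') (h : CrossesAt Φ u e l φ₁ φ₂ ρ t) (h' : CrossesAt Φ u e l φ₁ φ₂ ρ' t) :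
    ρ = ρ' := by
  obtain ⟨L, r, ψ, hL, hP, r0, rL, ψ0, ψL, hall⟩ := hS.exists_profile hN hu he hue hl ht h₁
  obtain ⟨d1, d2, d3⟩ := hall e he hue
  have hmono := hP.strictMonoOn_angle hS.1 hL (by rw [ψ0, ψL]; exact h₁.1)
  have key : ∀ {σ : ℝ}, 0 ≤ σ → CrossesAt Φ u e l φ₁ φ₂ σ t →
      ∃ s ∈ Icc 0 L, σ = r s ∧ φ₂ = ψ s := by
    intro σ hσ hc
    have hpos := hS.crossesAt_pos hN hu he hue hl h₁ ht hσ hc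
    rw [CrossesAt, d1] at hc
    obtain ⟨a1, a2⟩ := d2 _ hc
    refine ⟨dist (Φ (l • u)) (Φ (polarPoint u e σ φ₂)), ⟨dist_nonneg, ?_⟩, ?_, ?_⟩
    · rw [← hc]; exact le_add_of_nonneg_right dist_nonneg
    · rw [← a1, hS.dist_polarPoint hu he hue hσ]
    · rw [← a2, Equiv.symm_apply_apply, angle_polarPoint hu he hue hpos h₂]
  obtain ⟨s, hs, rfl, e1⟩ := key hρ h
  obtain ⟨s', hs', rfl, e2⟩ := key hρ' h'
  rw [hmono.injOn hs hs' (e1.symm.trans e2)]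

/-- If the boundary point of angle `φ₁` is visible, then the boundary point of a smaller angle
`φ₂` lies on the geodesic to a point of `Ω_1` or its boundary at angle `φ₁`. -/
lemma IsSphericallySymmetric.exists_crossesAt_planeRadius [ProperSpace M]
    (hS : IsSphericallySymmetric p G Φ) (hN : NonposCurvWarping G) (hlam : 1 < lam)
    (hu : ‖u‖ = 1) (he : ‖e‖ = 1) (hue : ⟪u, e⟫ = 0) (hl : 0 < l) (h₂ : 0 < φ₂) (h₂₁ : φ₂ < φ₁)
    (h₁ : φ₁ < Real.pi) (hV : VisibleAngle p lam Φ u e l φ₁) :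
    ∃ t, 0 < t ∧ t ≤ planeRadius p lam Φ u e l φ₁ ∧
      CrossesAt Φ u e l φ₁ φ₂ (planeRadius p lam Φ u e l φ₂) t := by
  have h₁' : φ₁ ∈ Ioo 0 Real.pi := ⟨h₂.trans h₂₁, h₁⟩
  have h₂' : φ₂ ∈ Icc 0 Real.pi := ⟨h₂.le, (h₂₁.trans h₁).le⟩
  obtain ⟨f1pos, f1eq, -, -⟩ := hS.planeRadius_spec hN hlam hu he hue hl φ₁
  obtain ⟨f2pos, -, f2iff, -⟩ := hS.planeRadius_spec hN hlam hu he hue hl φ₂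
  unfold VisibleAngle at hV
  set f₁ := planeRadius p lam Φ u e l φ₁
  set f₂ := planeRadius p lam Φ u e l φ₂
  set R := f₁ + 2 * l
  have hclosed : ∀ a b : ℝ,
      IsClosed (Prod.fst '' (Icc 0 f₁ ×ˢ Icc a b ∩ {x | CrossesAt Φ u e l φ₁ φ₂ x.2 x.1})) :=
    fun a b => (((isCompact_Icc.prod isCompact_Icc).inter_right
      (hS.isClosed_crossesAt hN u e l φ₁ φ₂)).image continuous_fst).isClosed
  have hcover : Icc 0 f₁ ⊆
      Prod.fst '' (Icc 0 f₁ ×ˢ Icc 0 f₂ ∩ {x | CrossesAt Φ u e l φ₁ φ₂ x.2 x.1}) ∪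
      Prod.fst '' (Icc 0 f₁ ×ˢ Icc f₂ R ∩ {x | CrossesAt Φ u e l φ₁ φ₂ x.2 x.1}) := by
    intro t ht
    obtain ⟨ρ, hρ, hc⟩ := hS.exists_crossesAt hN hu he hue hl h₂ h₂₁ h₁ ht.1
    rcases le_total ρ f₂ with h | h
    · exact Or.inl ⟨(t, ρ), ⟨⟨ht, hρ.1, h⟩, hc⟩, rfl⟩
    · exact Or.inr ⟨(t, ρ), ⟨⟨ht, h, hρ.2.trans (by linarith [ht.2])⟩, hc⟩, rfl⟩
  have hzero : (0 : ℝ) ∈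
      Prod.fst '' (Icc 0 f₁ ×ˢ Icc 0 f₂ ∩ {x | CrossesAt Φ u e l φ₁ φ₂ x.2 x.1}) := by
    refine ⟨(0, 0), ⟨⟨⟨le_rfl, f1pos.le⟩, le_rfl, f2pos.le⟩, ?_⟩, rfl⟩
    simp [CrossesAt, polarPoint]
  have hend : f₁ ∈
      Prod.fst '' (Icc 0 f₁ ×ˢ Icc f₂ R ∩ {x | CrossesAt Φ u e l φ₁ φ₂ x.2 x.1}) := by
    obtain ⟨ρ, hρ, hc⟩ := hS.exists_crossesAt hN hu he hue hl h₂ h₂₁ h₁ f1pos.le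
    refine ⟨(f₁, ρ), ⟨⟨⟨f1pos.le, le_rfl⟩, ?_, hρ.2⟩, hc⟩, rfl⟩
    have := hV _ hc
    rw [hS.dist_polarPoint hu he hue hρ.1] at this
    by_contra! hlt
    exact absurd ((f2iff ρ hρ.1).2 hlt) (not_lt.2 this)
  obtain ⟨t, ht, ⟨⟨_, ρ⟩, ⟨⟨-, hρ⟩, hc⟩, rfl⟩, ⟨⟨_, ρ'⟩, ⟨⟨-, hρ'⟩, hc'⟩, rfl⟩⟩ :=
    isPreconnected_closed_iff.1 (isPreconnected_Icc (a := (0 : ℝ)) (b := f₁)) _ _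
      (hclosed 0 f₂) (hclosed f₂ R) hcover ⟨0, ⟨le_rfl, f1pos.le⟩, hzero⟩
      ⟨f₁, ⟨f1pos.le, le_rfl⟩, hend⟩
  simp only [mem_ofPred_eq] at hρ hρ' hc hc' ht
  rename_i t t'
  have hρ'0 : 0 < ρ' := f2pos.trans_le hρ'.1
  rcases ht.1.eq_or_lt with rfl | ht0
  · exfalso
    have hp : Φ (polarPoint u e 0 φ₁) = p := by simp [polarPoint, hS.2.1]
    rw [CrossesAt, hp, hS.dist_polarPoint hu he hue hρ'0.le, hS.dist_axis hu hl] at hc'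
    have := hS.law_of_cosines_le hN hu he hue l ρ' φ₂
    rw [eq_sub_of_add_eq hc'] at this
    have hcos : Real.cos φ₂ < 1 := by
      have := Real.cos_lt_cos_of_nonneg_of_le_pi le_rfl h₂'.2 h₂
      rwa [Real.cos_zero] at this
    nlinarith [mul_pos (mul_pos hl hρ'0) (sub_pos.2 hcos)]
  · have := hS.crossesAt_unique hN hu he hue hl h₂' h₁' ht0 hρ.1 hρ'0.le hc hc'
    have hf : ρ = f₂ := le_antisymm hρ.2 (this ▸ hρ'.1)
    exact ⟨_, ht0, ht.2, hf ▸ hc⟩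

end Crossing

section Monotone

variable {n : ℕ} {p : M} {G : ℝ → ℝ} {Φ : Euc n ≃ M} {u e : Euc n} {l lam φ₁ φ₂ : ℝ}

lemma stewart_apollonius_contradiction {lam a b σ h f t : ℝ} (hlam : 1 < lam) (ha : 0 ≤ a)
    (hb : 0 < b) (hh : 0 ≤ h) (ht : 0 ≤ t) (hσ : lam * h < σ)
    (hf : lam * f = σ + a) (htD : lam * t ≤ σ + a + b)
    (hst : (a + b) * f ^ 2 ≤ b * h ^ 2 + a * t ^ 2 - a * b * (a + b)) : False := by
  have hlam0 : 0 < lam := one_pos.trans hlam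
  have h1 : b * (lam * h) ^ 2 < b * σ ^ 2 :=
    mul_lt_mul_of_pos_left (pow_lt_pow_left₀ hσ (by positivity) two_ne_zero) hb
  have h2 : a * (lam * t) ^ 2 ≤ a * (σ + a + b) ^ 2 :=
    mul_le_mul_of_nonneg_left (pow_le_pow_left₀ (by positivity) htD 2) ha
  have h3 := mul_le_mul_of_nonneg_left hst (sq_nonneg lam)
  have h4 : (a + b) * (lam * f) ^ 2 = (a + b) * (σ + a) ^ 2 := by rw [hf]
  have h5 : 0 ≤ a * b * (a + b) * (lam ^ 2 - 1) :=
    mul_nonneg (by positivity) (by nlinarith)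
  nlinarith

lemma IsSphericallySymmetric.visibleAngle_of_lt [ProperSpace M]
    (hS : IsSphericallySymmetric p G Φ) (hN : NonposCurvWarping G) (hlam : 1 < lam)
    (hu : ‖u‖ = 1) (he : ‖e‖ = 1) (hue : ⟪u, e⟫ = 0) (hl : 0 < l) (h₂ : 0 < φ₂) (h₂₁ : φ₂ < φ₁)
    (h₁ : φ₁ < Real.pi) (hV : VisibleAngle p lam Φ u e l φ₁) :
    VisibleAngle p lam Φ u e l φ₂ := by
  obtain ⟨t, ht, htf, hc⟩ :=
    hS.exists_crossesAt_planeRadius hN hlam hu he hue hl h₂ h₂₁ h₁ hV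
  obtain ⟨-, f1eq, f1iff, -⟩ := hS.planeRadius_spec hN hlam hu he hue hl φ₁
  obtain ⟨f2pos, f2eq, -, -⟩ := hS.planeRadius_spec hN hlam hu he hue hl φ₂
  have hlt := hS.dist_axis_polarPoint_lt hN hu he hue hl ht (θ := φ₁) ⟨(h₂.trans h₂₁).le, h₁⟩
  have htD : lam * t ≤ dist (Φ (l • u)) (Φ (polarPoint u e t φ₁)) := by
    rcases htf.eq_or_lt with h | h
    · rw [h, f1eq]
    · exact ((f1iff t ht.le).2 h).le
  unfold VisibleAngle
  have hb : 0 < dist (Φ (polarPoint u e (planeRadius p lam Φ u e l φ₂) φ₂))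
      (Φ (polarPoint u e t φ₁)) := by
    refine dist_pos.2 fun h => h₂₁.ne ?_
    rw [← angle_polarPoint hu he hue f2pos ⟨h₂.le, (h₂₁.trans h₁).le⟩, Φ.injective h,
      angle_polarPoint hu he hue ht ⟨(h₂.trans h₂₁).le, h₁.le⟩]
  have hdf := hS.dist_polarPoint hu he hue f2pos.le φ₂
  have hdt := hS.dist_polarPoint hu he hue ht.le φ₁
  rw [CrossesAt] at hc
  generalize Φ (polarPoint u e (planeRadius p lam Φ u e l φ₂) φ₂) = x at *
  generalize Φ (polarPoint u e t φ₁) = y at *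
  intro z hz
  by_contra! hvis
  have hqp := dist_triangle (Φ (l • u)) z p
  rw [hS.dist_axis hu hl] at hqp
  have hzy : dist z x + dist x y = dist z y := by
    have h1 := dist_triangle z x y
    have h2 := dist_triangle (Φ (l • u)) z y
    linarith
  have hst := hS.stewart hN (x := z) (y := y) (z := x) (by linarith) hzy
  rw [← hzy, hdf, hdt] at hst
  exact stewart_apollonius_contradiction hlam (dist_nonneg (x := z) (y := x)) hb dist_nonneg ht.le
    hvis (f2eq.symm.trans hz.symm) (by linarith) hst

/-- The supremum of the visible angles in a half-plane is visible. -/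
lemma IsSphericallySymmetric.visibleAngle_sSup [ProperSpace M]
    (hS : IsSphericallySymmetric p G Φ) (hN : NonposCurvWarping G) (hlam : 1 < lam)
    (hu : ‖u‖ = 1) (he : ‖e‖ = 1) (hue : ⟪u, e⟫ = 0) (hl : 0 < l) {V : Set ℝ}
    (hV : V ⊆ Ioo 0 Real.pi) (hVvis : ∀ φ ∈ V, VisibleAngle p lam Φ u e l φ) (hne : V.Nonempty)
    (ha : sSup V ∈ Ioo 0 Real.pi) : VisibleAngle p lam Φ u e l (sSup V) := by
  obtain ⟨fpos, feq, -, -⟩ := hS.planeRadius_spec hN hlam hu he hue hl (sSup V)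
  intro z₀ hz₀
  set s := dist (Φ (l • u)) z₀
  let X : ℝ × ℝ × M → M := fun x => Φ (polarPoint u e x.2.1 x.1)
  let m : ℝ × ℝ × M → ℝ := fun x => min s (dist (Φ (l • u)) (X x))
  let K : Set (ℝ × ℝ × M) := Icc 0 Real.pi ×ˢ Icc 0 (l / (lam - 1)) ×ˢ closedBall (Φ (l • u)) s ∩
    {x | dist (Φ (l • u)) (X x) = lam * x.2.1 ∧ dist (Φ (l • u)) x.2.2 = m x ∧
      dist x.2.2 (X x) = dist (Φ (l • u)) (X x) - m x ∧ m x ≤ lam * dist x.2.2 p}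
  have hX : Continuous X := (hS.continuous hN).comp ((continuous_polarPoint u e).comp
    (by fun_prop : Continuous fun x : ℝ × ℝ × M => (x.2.1, x.1)))
  have hm : Continuous m := continuous_const.min (continuous_const.dist hX)
  have hz : Continuous fun x : ℝ × ℝ × M => x.2.2 := by fun_prop
  have hK : IsCompact K := by
    refine (isCompact_Icc.prod (isCompact_Icc.prod (isCompact_closedBall _ _))).inter_right ?_
    refine (isClosed_eq (continuous_const.dist hX) (by fun_prop)).inter
      ((isClosed_eq (continuous_const.dist hz) hm).inter
        ((isClosed_eq (hz.dist hX) ((continuous_const.dist hX).sub hm)).inter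
          (isClosed_le hm (continuous_const.mul (hz.dist continuous_const)))))
  have hsub : V ⊆ Prod.fst '' K := by
    intro φ hφ
    obtain ⟨gpos, geq, -, gle⟩ := hS.planeRadius_spec hN hlam hu he hue hl φ
    have hvis := hVvis φ hφ
    unfold VisibleAngle at hvis
    set g := planeRadius p lam Φ u e l φ
    obtain ⟨γ, hγ⟩ := hS.exists_geodesic hN (Φ (l • u)) (Φ (polarPoint u e g φ))
    set μ := min s (dist (Φ (l • u)) (Φ (polarPoint u e g φ))) with hμ
    have hμI : μ ∈ Icc 0 (dist (Φ (l • u)) (Φ (polarPoint u e g φ))) :=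
      ⟨le_min dist_nonneg dist_nonneg, min_le_right _ _⟩
    have e1 := hγ.dist_left hμI
    have e2 := hγ.dist_right hμI
    refine ⟨(φ, g, γ μ), ⟨⟨⟨(hV hφ).1.le, (hV hφ).2.le⟩, ⟨gpos.le, gle⟩, ?_⟩,
      geq, e1, e2, ?_⟩, rfl⟩
    · rw [mem_closedBall, dist_comm, e1]
      exact min_le_left _ _
    · have := hvis (γ μ) (by rw [e1, e2]; ring)
      rwa [e1] at this
  have hbdd : BddAbove V := ⟨Real.pi, fun φ hφ => (hV hφ).2.le⟩
  obtain ⟨⟨a, f, z⟩, ⟨⟨-, hf, -⟩, h1, h2, h3, h4⟩, haeq⟩ :=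
    closure_minimal hsub (hK.image continuous_fst).isClosed (csSup_mem_closure hne hbdd)
  simp only at haeq
  subst haeq
  simp only [X, m] at h1 h2 h3 h4
  have hfF : f = planeRadius p lam Φ u e l (sSup V) :=
    hS.eq_planeRadius hN hlam hu he hue hl hf.1 h1
  have hms : min s (dist (Φ (l • u)) (Φ (polarPoint u e f (sSup V)))) = s := by
    rw [hfF, ← hz₀]
    exact min_eq_left (le_add_of_nonneg_right dist_nonneg)
  rw [hms] at h2 h3 h4
  obtain ⟨L, r, ψ, -, -, -, -, -, -, hall⟩ := hS.exists_profile hN hu he hue hl fpos ha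
  obtain ⟨d1, d2, -⟩ := hall e he hue
  rw [hfF, d1] at h3
  rw [d1] at hz₀
  have hzr := (d2 z (by rw [h2, h3]; ring)).1
  rw [h2] at hzr
  rw [(d2 z₀ hz₀).1]
  exact hzr ▸ h4

end Monotone

section Axis

variable {n : ℕ} {p q : M} {G : ℝ → ℝ} {Φ : Euc n ≃ M} {u : Euc n} {l lam : ℝ}

lemma IsSphericallySymmetric.seesPoint_axis [ProperSpace M]
    (hS : IsSphericallySymmetric p G Φ) (hN : NonposCurvWarping G) (hlam : 1 < lam)
    (hu : ‖u‖ = 1) (hl : 0 < l) :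
    SeesPoint p (Φ (l • u)) lam (Φ (boundaryRadius p (Φ (l • u)) lam Φ u • u)) := by
  obtain ⟨f1, f2, -, -⟩ := hS.boundaryRadius_spec hN (hS.axis_ne hu hl) hlam hu
  set f := boundaryRadius p (Φ (l • u)) lam Φ u
  intro z hz
  have hr := hS.dist_radial hN hu l f
  have hlf : l - f = lam * f := by
    rw [hr] at f2
    rcases abs_cases (l - f) with ⟨h, -⟩ | ⟨h, -⟩ <;> nlinarith
  have hzp := dist_triangle (Φ (l • u)) z p
  rw [hS.dist_axis hu hl] at hzp
  rw [f2] at hz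
  have h1 : dist (Φ (l • u)) z ≤ lam * f := by
    linarith [dist_nonneg (x := z) (y := Φ (f • u))]
  nlinarith

lemma IsSphericallySymmetric.not_seesPoint_antipodal [ProperSpace M]
    (hS : IsSphericallySymmetric p G Φ) (hN : NonposCurvWarping G) (hlam : 1 < lam)
    (hu : ‖u‖ = 1) (hl : 0 < l) :
    ¬ SeesPoint p (Φ (l • u)) lam (Φ (boundaryRadius p (Φ (l • u)) lam Φ (-u) • -u)) := by
  obtain ⟨f1, -, -, -⟩ := hS.boundaryRadius_spec hN (hS.axis_ne hu hl) hlam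
    ((norm_neg u).trans hu)
  set f := boundaryRadius p (Φ (l • u)) lam Φ (-u)
  intro hV
  have hr := hS.dist_radial hN hu l (-f)
  rw [sub_neg_eq_add, abs_of_pos (by linarith), neg_smul, ← smul_neg] at hr
  have := hV p (by
    rw [hS.dist_axis hu hl, hr, dist_comm, hS.2.2.1, norm_smul, norm_neg, hu, mul_one,
      Real.norm_of_nonneg f1.le])
  rw [hS.dist_axis hu hl, dist_self, mul_zero] at this
  exact absurd hl (not_lt.2 this)

/-- For a radial obstacle, visibility of boundary points is monotone in the angle to the axis. -/
lemma IsSphericallySymmetric.exists_visibility_angle [ProperSpace M]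
    (hS : IsSphericallySymmetric p G Φ) (hN : NonposCurvWarping G) (hlam : 1 < lam)
    (hu : ‖u‖ = 1) (hl : 0 < l) :
    ∃ a, 0 < a ∧ a ≤ Real.pi / 2 ∧ ∀ θ : Euc n, ‖θ‖ = 1 →
      (SeesPoint p (Φ (l • u)) lam (Φ (boundaryRadius p (Φ (l • u)) lam Φ θ • θ)) ↔
        angle u θ ≤ a) := by
  have hπ := Real.pi_pos
  have hu0 : u ≠ 0 := norm_ne_zero_iff.1 (by rw [hu]; exact one_ne_zero)
  have hends : ∀ a : ℝ, 0 < a → a ≤ Real.pi / 2 → (∀ θ : Euc n, ‖θ‖ = 1 →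
      angle u θ ∈ Ioo 0 Real.pi →
      (SeesPoint p (Φ (l • u)) lam (Φ (boundaryRadius p (Φ (l • u)) lam Φ θ • θ)) ↔
        angle u θ ≤ a)) → ∀ θ : Euc n, ‖θ‖ = 1 →
      (SeesPoint p (Φ (l • u)) lam (Φ (boundaryRadius p (Φ (l • u)) lam Φ θ • θ)) ↔
        angle u θ ≤ a) := by
    intro a ha0 ha h θ hθ
    rcases (angle_nonneg u θ).eq_or_lt with h0 | h0
    · obtain ⟨-, c, hc, rfl⟩ := angle_eq_zero_iff.1 h0.symm
      rw [norm_smul, hu, mul_one, Real.norm_of_nonneg hc.le] at hθ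
      rw [hθ, one_smul, angle_self hu0]
      exact iff_of_true (hS.seesPoint_axis hN hlam hu hl) ha0.le
    rcases (angle_le_pi u θ).eq_or_lt with h1 | h1
    · obtain ⟨-, c, hc, rfl⟩ := angle_eq_pi_iff.1 h1
      rw [norm_smul, hu, mul_one, Real.norm_of_nonpos hc.le] at hθ
      rw [h1, show c = -1 by linarith, neg_one_smul]
      exact iff_of_false (hS.not_seesPoint_antipodal hN hlam hu hl) (by linarith)
    · exact h θ hθ ⟨h0, h1⟩
  by_cases hex : ∃ e : Euc n, ‖e‖ = 1 ∧ ⟪u, e⟫ = 0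
  · obtain ⟨e, he, hue⟩ := hex
    set V := {φ ∈ Ioo 0 Real.pi | VisibleAngle p lam Φ u e l φ} with hV
    obtain ⟨φ₀, hφ₀, hvis₀⟩ := hS.exists_visibleAngle hN hlam hu he hue hl
    have hne : V.Nonempty := ⟨φ₀, hφ₀, hvis₀⟩
    have hle : ∀ φ ∈ V, φ ≤ Real.pi / 2 := fun φ hφ =>
      hS.visibleAngle_le_pi_div_two hN hlam hu he hue hl hφ.1 hφ.2
    have hbdd : BddAbove V := ⟨_, hle⟩
    have ha0 : 0 < sSup V := hφ₀.1.trans_le (le_csSup hbdd ⟨hφ₀, hvis₀⟩)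
    have ha : sSup V ≤ Real.pi / 2 := csSup_le hne hle
    have hmem := hS.visibleAngle_sSup hN hlam hu he hue hl (V := V) (fun φ hφ => hφ.1)
      (fun φ hφ => hφ.2) hne ⟨ha0, by linarith⟩
    refine ⟨sSup V, ha0, ha, hends _ ha0 ha fun θ hθ hφ => ?_⟩
    rw [hS.sees_iff_sees_polarPoint hN hlam hu hl he hue hθ hφ]
    refine ⟨fun h => le_csSup hbdd ⟨hφ, h⟩, fun h => ?_⟩
    rcases h.eq_or_lt with h | h
    · rw [← h] at hmem
      exact hmem
    · exact hS.visibleAngle_of_lt hN hlam hu he hue hl hφ.1 h (by linarith) hmem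
  · refine ⟨Real.pi / 2, by linarith, le_rfl, hends _ (by linarith) le_rfl fun θ hθ hφ => ?_⟩
    obtain ⟨e, he, hue, -⟩ := exists_eq_polarPoint hu
      (norm_ne_zero_iff.1 (by rw [hθ]; exact one_ne_zero)) hφ.1.ne' hφ.2.ne
    exact absurd ⟨e, he, hue⟩ hex

end Axis

/-- Lemma 3.4.  Suppose `M` is spherically symmetric about
`p` and nonpositively curved.  There exists `0 < a < π` such that the
boundary point `(f₁(θ), θ) ∈ ∂Ω_1` (where `f₁` is the radial function of
the open star-shaped set `Ω_1`, here realized as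
`f₁ θ = sSup {r | Φ (r • θ) ∈ Ω_1}`) is visible₁ exactly when
`∠(θ,u₀) ≤ a`; moreover `a ≤ π − arccos(λ⁻¹)`, so `a` is bounded away from
`π` in terms of `λ` alone. -/
theorem visibility_angle_exists
    {M : Type*} [MetricSpace M] [ProperSpace M] {n : ℕ}
    (p : M) (G : ℝ → ℝ) (Φ : Euc n ≃ M)
    (hsym : IsSphericallySymmetric p G Φ) (hnpc : NonposCurvWarping G)
    (q : M) (hq : q ≠ p) (lam : ℝ) (hlam : 1 < lam) :
    ∃ a : ℝ, 0 < a ∧ a < Real.pi ∧ a ≤ Real.pi - Real.arccos lam⁻¹ ∧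
      ∀ θ : Euc n, ‖θ‖ = 1 →
        (VisibleThrough (OmegaSeq p q lam 1) q
            (Φ (sSup {r : ℝ | Φ (r • θ) ∈ OmegaSeq p q lam 1} • θ)) ↔
          angle θ (polarTheta Φ q) ≤ a) := by
  have hl : 0 < ‖Φ.symm q‖ := by
    rw [hsym.norm_symm]
    exact dist_pos.2 hq
  have hu : ‖polarTheta Φ q‖ = 1 := by
    rw [polarTheta, norm_smul, norm_inv, norm_norm, inv_mul_cancel₀ hl.ne']
  have hqu : Φ (‖Φ.symm q‖ • polarTheta Φ q) = q := by
    rw [polarTheta, smul_smul, mul_inv_cancel₀ hl.ne', one_smul, Equiv.apply_symm_apply]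
  obtain ⟨a, ha0, ha, hvis⟩ := hsym.exists_visibility_angle hnpc hlam hu hl
  have harccos : Real.arccos lam⁻¹ ≤ Real.pi / 2 :=
    Real.arccos_le_pi_div_two.2 (inv_nonneg.2 (by linarith))
  refine ⟨a, ha0, by linarith [Real.pi_pos], by linarith, fun θ hθ => ?_⟩
  rw [hsym.visibleThrough_omegaSeq_one hnpc (by linarith), angle_comm]
  have h := hvis θ hθ
  rw [hqu] at h
  exact h

end GrowthComp
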